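/- There exists a constant C > 0, depending only on T, α, β, K and δ, such that for every classical solution (v,u,θ,w,b) of the planar compressible MHD system on ℝ × [0,T] with (K,δ)-admissible initial data, one has sup_{0≤t≤T} ∫_ℝ ( θ^β θ_x )² dx + ∫₀^T ∫_ℝ θ^β θ_t² dx dt ≤ C. -/

import Mathlib

open MeasureTheory Set Filter

noncomputable section

/-- Viscosity function `μ(z) = 1 + α z^(−α)` (here `μ̃₁ = 1`, `μ̃₂ = α`). -/
def visc (α z : ℝ) : ℝ := 1 + α * z ^ (-α)

/-- Squared Euclidean norm on `ℝ × ℝ` (used for the transverse fields `w, b ∈ ℝ²`). -/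
def sq2 (p : ℝ × ℝ) : ℝ := p.1 ^ 2 + p.2 ^ 2

/-- Partial derivative with respect to the first (spatial) variable. -/
def pdx {E : Type*} [NormedAddCommGroup E] [NormedSpace ℝ E]
    (f : ℝ → ℝ → E) (x t : ℝ) : E := deriv (fun y => f y t) x

/-- Partial derivative with respect to the second (time) variable, taken within `[0, T]`
(so it is one-sided at the endpoints). -/
def pdt (T : ℝ) {E : Type*} [NormedAddCommGroup E] [NormedSpace ℝ E]
    (f : ℝ → ℝ → E) (x t : ℝ) : E := derivWithin (fun s => f x s) (Icc 0 T) t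

/-- A classical solution of the planar compressible MHD system (in Lagrangian coordinates,
with all physical constants normalized to `1` and `μ̃₂ = α`) on `ℝ × [0,T]`:
all the derivatives appearing in the equations exist and are continuous, `v, θ > 0`,
the five equations hold pointwise, the solution tends to `(1,0,1,0,0)` as `|x| → ∞`
uniformly in `t ∈ [0,T]`, and `v−1, u, θ−1, b, w` and their first spatial derivatives
are square-integrable in `x` for each `t ∈ [0,T]`. -/
structure IsClassicalSolution (α β T : ℝ) (v u θ : ℝ → ℝ → ℝ)
    (w b : ℝ → ℝ → ℝ × ℝ) : Prop where
  v_pos : ∀ x : ℝ, ∀ t ∈ Icc (0:ℝ) T, 0 < v x t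
  θ_pos : ∀ x : ℝ, ∀ t ∈ Icc (0:ℝ) T, 0 < θ x t
  diff_x : ∀ x : ℝ, ∀ t ∈ Icc (0:ℝ) T,
    DifferentiableAt ℝ (fun y => v y t) x ∧ DifferentiableAt ℝ (fun y => u y t) x ∧
    DifferentiableAt ℝ (fun y => θ y t) x ∧ DifferentiableAt ℝ (fun y => w y t) x ∧
    DifferentiableAt ℝ (fun y => b y t) x
  diff_xx : ∀ x : ℝ, ∀ t ∈ Icc (0:ℝ) T,
    DifferentiableAt ℝ (fun y => pdx u y t) x ∧ DifferentiableAt ℝ (fun y => pdx θ y t) x ∧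
    DifferentiableAt ℝ (fun y => pdx w y t) x ∧ DifferentiableAt ℝ (fun y => pdx b y t) x
  diff_t : ∀ x : ℝ, ∀ t ∈ Icc (0:ℝ) T,
    DifferentiableWithinAt ℝ (fun s => v x s) (Icc 0 T) t ∧
    DifferentiableWithinAt ℝ (fun s => u x s) (Icc 0 T) t ∧
    DifferentiableWithinAt ℝ (fun s => θ x s) (Icc 0 T) t ∧
    DifferentiableWithinAt ℝ (fun s => w x s) (Icc 0 T) t ∧
    DifferentiableWithinAt ℝ (fun s => b x s) (Icc 0 T) t
  cont : ContinuousOn (fun p : ℝ × ℝ =>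
      (v p.1 p.2, u p.1 p.2, θ p.1 p.2, w p.1 p.2, b p.1 p.2)) (univ ×ˢ Icc 0 T)
  cont_dx : ContinuousOn (fun p : ℝ × ℝ =>
      (pdx v p.1 p.2, pdx u p.1 p.2, pdx θ p.1 p.2, pdx w p.1 p.2, pdx b p.1 p.2))
      (univ ×ˢ Icc 0 T)
  cont_dxx : ContinuousOn (fun p : ℝ × ℝ =>
      (pdx (pdx u) p.1 p.2, pdx (pdx θ) p.1 p.2, pdx (pdx w) p.1 p.2, pdx (pdx b) p.1 p.2))
      (univ ×ˢ Icc 0 T)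
  cont_dt : ContinuousOn (fun p : ℝ × ℝ =>
      (pdt T v p.1 p.2, pdt T u p.1 p.2, pdt T θ p.1 p.2, pdt T w p.1 p.2, pdt T b p.1 p.2))
      (univ ×ˢ Icc 0 T)
  eq_mass : ∀ x : ℝ, ∀ t ∈ Icc (0:ℝ) T, pdt T v x t = pdx u x t
  eq_mom : ∀ x : ℝ, ∀ t ∈ Icc (0:ℝ) T,
    pdt T u x t + pdx (fun y s => θ y s / v y s + sq2 (b y s) / 2) x t
      = pdx (fun y s => visc α (v y s) * pdx u y s / v y s) x t
  eq_w : ∀ x : ℝ, ∀ t ∈ Icc (0:ℝ) T,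
    pdt T w x t - pdx b x t = pdx (fun y s => (v y s)⁻¹ • pdx w y s) x t
  eq_b : ∀ x : ℝ, ∀ t ∈ Icc (0:ℝ) T,
    pdt T (fun y s => v y s • b y s) x t - pdx w x t
      = pdx (fun y s => (v y s)⁻¹ • pdx b y s) x t
  eq_temp : ∀ x : ℝ, ∀ t ∈ Icc (0:ℝ) T,
    pdt T θ x t + θ x t / v x t * pdx u x t
      = pdx (fun y s => θ y s ^ β * pdx θ y s / v y s) x t
        + (visc α (v x t) * pdx u x t ^ 2 + sq2 (pdx w x t) + sq2 (pdx b x t)) / v x t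
  farfield : ∀ ε > (0:ℝ), ∃ M : ℝ, ∀ x : ℝ, ∀ t ∈ Icc (0:ℝ) T, M ≤ |x| →
    |v x t - 1| < ε ∧ |u x t| < ε ∧ |θ x t - 1| < ε ∧
    Real.sqrt (sq2 (b x t)) < ε ∧ Real.sqrt (sq2 (w x t)) < ε
  sq_int : ∀ t ∈ Icc (0:ℝ) T,
    Integrable (fun x => (v x t - 1) ^ 2) ∧ Integrable (fun x => (u x t) ^ 2) ∧
    Integrable (fun x => (θ x t - 1) ^ 2) ∧ Integrable (fun x => sq2 (b x t)) ∧
    Integrable (fun x => sq2 (w x t)) ∧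
    Integrable (fun x => (pdx v x t) ^ 2) ∧ Integrable (fun x => (pdx u x t) ^ 2) ∧
    Integrable (fun x => (pdx θ x t) ^ 2) ∧ Integrable (fun x => sq2 (pdx b x t)) ∧
    Integrable (fun x => sq2 (pdx w x t))

/-- The initial data of a solution are `(K, δ)`-admissible: the `H¹`-type norm of
`(v₀−1, u₀, θ₀−1, b₀, w₀)` is at most `K²` and `v₀ ≥ δ`, `θ₀ ≥ δ`. -/
def Admissible (K δ : ℝ) (v u θ : ℝ → ℝ → ℝ) (w b : ℝ → ℝ → ℝ × ℝ) : Prop :=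
  (∫ x : ℝ, ((v x 0 - 1) ^ 2 + (u x 0) ^ 2 + (θ x 0 - 1) ^ 2 + sq2 (b x 0) + sq2 (w x 0)
      + (pdx v x 0) ^ 2 + (pdx u x 0) ^ 2 + (pdx θ x 0) ^ 2
      + sq2 (pdx b x 0) + sq2 (pdx w x 0))) ≤ K ^ 2 ∧
  (∀ x : ℝ, δ ≤ v x 0) ∧ (∀ x : ℝ, δ ≤ θ x 0)

/-- Gronwall's inequality in differential form with a dissipation term `d`. -/
theorem gronwall_dissipation {T : ℝ} {y y' A c d : ℝ → ℝ}
    (hy : ContinuousOn y (Icc 0 T)) (hA : Continuous A) (hc : Continuous c) (hd : Continuous d)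
    (hA0 : ∀ t ∈ Icc 0 T, 0 ≤ A t) (hc0 : ∀ t ∈ Icc 0 T, 0 ≤ c t) (hd0 : ∀ t ∈ Icc 0 T, 0 ≤ d t)
    (hder : ∀ t ∈ Ioo 0 T, HasDerivAt y (y' t) t)
    (h : ∀ t ∈ Ioo 0 T, y' t + d t ≤ A t * y t + c t) :
    ∀ t ∈ Icc 0 T, y t + ∫ s in (0:ℝ)..t, d s
      ≤ (y 0 + ∫ s in (0:ℝ)..t, c s) * Real.exp (∫ s in (0:ℝ)..t, A s) := by
  intro t ht
  set α : ℝ → ℝ := fun t => ∫ s in (0:ℝ)..t, A s with hα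
  have hαd : ∀ t, HasDerivAt α (A t) t := fun t =>
    intervalIntegral.integral_hasDerivAt_right (hA.intervalIntegrable _ _)
      (hA.stronglyMeasurableAtFilter _ _) hA.continuousAt
  have hαc : Continuous α := continuous_iff_continuousAt.2 fun t => (hαd t).continuousAt
  set β : ℝ → ℝ := fun t => ∫ s in (0:ℝ)..t, Real.exp (-α s) * (d s - c s) with hβ
  have hgc : Continuous (fun s => Real.exp (-α s) * (d s - c s)) := by fun_prop
  have hβd : ∀ t, HasDerivAt β (Real.exp (-α t) * (d t - c t)) t := fun t =>
    intervalIntegral.integral_hasDerivAt_right (hgc.intervalIntegrable _ _)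
      (hgc.stronglyMeasurableAtFilter _ _) hgc.continuousAt
  have hβc : Continuous β := continuous_iff_continuousAt.2 fun t => (hβd t).continuousAt
  have hanti : AntitoneOn (fun t => Real.exp (-α t) * y t + β t) (Icc 0 T) := by
    apply antitoneOn_of_hasDerivWithinAt_nonpos (convex_Icc 0 T)
      (f' := fun t => (Real.exp (-α t) * (-A t)) * y t + Real.exp (-α t) * y' t
        + Real.exp (-α t) * (d t - c t))
    · exact ((by fun_prop : Continuous fun t => Real.exp (-α t)).continuousOn.mul hy).add
        hβc.continuousOn
    · intro x hx
      rw [interior_Icc] at hx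
      exact ((((hαd x).neg.exp).mul (hder x hx)).add (hβd x)).hasDerivWithinAt
    · intro x hx
      rw [interior_Icc] at hx
      have := h x hx
      have he := Real.exp_pos (-α x)
      have : Real.exp (-α x) * (y' x + d x - A x * y x - c x) ≤ 0 :=
        mul_nonpos_of_nonneg_of_nonpos he.le (by linarith)
      linarith
  have h0T : (0:ℝ) ∈ Icc 0 T := ⟨le_rfl, ht.1.trans ht.2⟩
  have hmain := hanti h0T ht ht.1
  simp only [hα, hβ, intervalIntegral.integral_same, neg_zero, Real.exp_zero, one_mul,
    add_zero] at hmain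
  have hαmono : ∀ s ∈ Icc 0 t, 0 ≤ α s ∧ α s ≤ α t := by
    intro s hs
    have h1 : 0 ≤ α s := intervalIntegral.integral_nonneg hs.1
      (fun r hr => hA0 r ⟨hr.1, hr.2.trans (hs.2.trans ht.2)⟩)
    refine ⟨h1, ?_⟩
    have h2 : α t = α s + ∫ r in s..t, A r :=
      (intervalIntegral.integral_add_adjacent_intervals (hA.intervalIntegrable _ _)
        (hA.intervalIntegrable _ _)).symm
    have h3 : 0 ≤ ∫ r in s..t, A r := intervalIntegral.integral_nonneg hs.2
      (fun r hr => hA0 r ⟨hs.1.trans hr.1, hr.2.trans ht.2⟩)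
    linarith
  have hbt : β t = (∫ s in (0:ℝ)..t, Real.exp (-α s) * d s)
      - ∫ s in (0:ℝ)..t, Real.exp (-α s) * c s := by
    rw [← intervalIntegral.integral_sub]
    · simp only [hβ]; congr 1; ext s; ring
    · exact Continuous.intervalIntegrable (by fun_prop) _ _
    · exact Continuous.intervalIntegrable (by fun_prop) _ _
  have hc1 : ∫ s in (0:ℝ)..t, Real.exp (-α s) * c s ≤ ∫ s in (0:ℝ)..t, c s := by
    apply intervalIntegral.integral_mono_on ht.1
      (Continuous.intervalIntegrable (by fun_prop) _ _) (hc.intervalIntegrable _ _)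
    intro s hs
    have h1 : Real.exp (-α s) ≤ 1 := Real.exp_le_one_iff.2 (by linarith [(hαmono s hs).1])
    nlinarith [hc0 s ⟨hs.1, hs.2.trans ht.2⟩]
  have hd1 : ∫ s in (0:ℝ)..t, d s ≤ Real.exp (α t) * ∫ s in (0:ℝ)..t, Real.exp (-α s) * d s := by
    rw [← intervalIntegral.integral_const_mul]
    apply intervalIntegral.integral_mono_on ht.1 (hd.intervalIntegrable _ _)
      (Continuous.intervalIntegrable (by fun_prop) _ _)
    intro s hs
    rw [← mul_assoc, ← Real.exp_add]
    have h1 : 1 ≤ Real.exp (α t + -α s) := Real.one_le_exp (by linarith [(hαmono s hs).2])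
    nlinarith [hd0 s ⟨hs.1, hs.2.trans ht.2⟩]
  have hm : Real.exp (-α t) * y t + β t ≤ y 0 := hmain
  rw [hbt] at hm
  have he : Real.exp (α t) * Real.exp (-α t) = 1 := by
    rw [← Real.exp_add]; simp
  have hmul := mul_le_mul_of_nonneg_left
    (show Real.exp (-α t) * y t + (∫ s in (0:ℝ)..t, Real.exp (-α s) * d s)
      ≤ y 0 + ∫ s in (0:ℝ)..t, c s by linarith) (Real.exp_pos (α t)).le
  have : Real.exp (α t) * (Real.exp (-α t) * y t) = y t := by rw [← mul_assoc, he, one_mul]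
  change y t + _ ≤ (y 0 + _) * Real.exp (α t)
  linarith

/-- Differentiation under the integral sign over a compact interval. -/
theorem hasDerivAt_integral_of_continuous {T a b : ℝ} {E Et : ℝ → ℝ → ℝ}
    (hE : Continuous fun p : ℝ × ℝ => E p.1 p.2) (hEt : Continuous fun p : ℝ × ℝ => Et p.1 p.2)
    (hd : ∀ x, ∀ t ∈ Ioo 0 T, HasDerivAt (fun s => E x s) (Et x t) t) {t : ℝ}
    (ht : t ∈ Ioo 0 T) :
    HasDerivAt (fun t => ∫ x in a..b, E x t) (∫ x in a..b, Et x t) t := by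
  obtain ⟨C, hC⟩ := (isCompact_uIcc (a := a) (b := b)).prod (isCompact_Icc (a := (0:ℝ)) (b := T))
    |>.exists_bound_of_continuousOn hEt.continuousOn
  refine (intervalIntegral.hasDerivAt_integral_of_dominated_loc_of_deriv_le
    (F := fun t x => E x t) (F' := fun t x => Et x t) (bound := fun _ => C)
    (Ioo_mem_nhds ht.1 ht.2) ?_ ?_ ?_ ?_ ?_ ?_).2
  · exact Eventually.of_forall fun s =>
      (show Continuous fun x => E x s by fun_prop).aestronglyMeasurable
  · exact Continuous.intervalIntegrable (by fun_prop) _ _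
  · exact (show Continuous fun x => Et x t by fun_prop).aestronglyMeasurable
  · exact Eventually.of_forall fun x hx s hs =>
      hC (x, s) ⟨uIoc_subset_uIcc hx, hs.1.le, hs.2.le⟩
  · exact intervalIntegrable_const
  · exact Eventually.of_forall fun x _ s hs => hd x s hs

/-- Continuity of parametric integrals over a compact interval. -/
theorem continuous_integral_param {a b : ℝ} {E : ℝ → ℝ → ℝ}
    (hE : Continuous fun p : ℝ × ℝ => E p.1 p.2) : Continuous fun t => ∫ x in a..b, E x t :=
  intervalIntegral.continuous_parametric_intervalIntegral_of_continuous'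
    (f := fun t x => E x t) (by
      change Continuous fun p : ℝ × ℝ => E p.2 p.1
      fun_prop) a b

/-- Derivative of a weighted Dirichlet integral, without assuming that `∂ₜ∂ₓ g` exists. -/
theorem hasDerivAt_dirichlet_integral {T a : ℝ} {ψ ψx ψt g gx gxx gt : ℝ → ℝ → ℝ}
    (cψ : Continuous fun p : ℝ × ℝ => ψ p.1 p.2) (cψx : Continuous fun p : ℝ × ℝ => ψx p.1 p.2)
    (cψt : Continuous fun p : ℝ × ℝ => ψt p.1 p.2)
    (cg : Continuous fun p : ℝ × ℝ => g p.1 p.2) (cgx : Continuous fun p : ℝ × ℝ => gx p.1 p.2)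
    (cgxx : Continuous fun p : ℝ × ℝ => gxx p.1 p.2)
    (cgt : Continuous fun p : ℝ × ℝ => gt p.1 p.2)
    (hψx : ∀ x t, HasDerivAt (fun y => ψ y t) (ψx x t) x)
    (hψt : ∀ x, ∀ t ∈ Ioo 0 T, HasDerivAt (fun s => ψ x s) (ψt x t) t)
    (hgx : ∀ x t, HasDerivAt (fun y => g y t) (gx x t) x)
    (hgxx : ∀ x t, HasDerivAt (fun y => gx y t) (gxx x t) x)
    (hgt : ∀ x, ∀ t ∈ Ioo 0 T, HasDerivAt (fun s => g x s) (gt x t) t)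
    (hl : ∀ t, ψ (-a) t = 0) (hr : ∀ t, ψ a t = 0) {t : ℝ} (ht : t ∈ Ioo 0 T) :
    HasDerivAt (fun t => ∫ x in -a..a, ψ x t * gx x t ^ 2)
      (∫ x in -a..a, (ψt x t * gx x t ^ 2 - 2 * gt x t * (ψx x t * gx x t + ψ x t * gxx x t)))
      t := by
  have hibp : ∀ s, (∫ x in -a..a, ψ x t * (gx x s ^ 2 - gx x t ^ 2))
      = -∫ x in -a..a, (g x s - g x t) * (ψx x t * (gx x s + gx x t)
          + ψ x t * (gxx x s + gxx x t)) := by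
    intro s
    have hD : ∀ x, HasDerivAt (fun x => (g x s - g x t) * (ψ x t * (gx x s + gx x t)))
        ((gx x s - gx x t) * (ψ x t * (gx x s + gx x t)) + (g x s - g x t) *
          (ψx x t * (gx x s + gx x t) + ψ x t * (gxx x s + gxx x t))) x := fun x =>
      ((hgx x s).sub (hgx x t)).mul ((hψx x t).mul ((hgxx x s).add (hgxx x t)))
    have hF := intervalIntegral.integral_eq_sub_of_hasDerivAt (a := -a) (b := a)
      (fun x _ => hD x) (Continuous.intervalIntegrable (by fun_prop) _ _)
    rw [hl, hr] at hF
    rw [← sub_eq_zero, sub_neg_eq_add, ← intervalIntegral.integral_add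
      (Continuous.intervalIntegrable (by fun_prop) _ _)
      (Continuous.intervalIntegrable (by fun_prop) _ _)]
    refine Eq.trans ?_ (hF.trans (by ring))
    congr 1; ext x; ring
  have hdecomp : ∀ s, (∫ x in -a..a, ψ x s * gx x s ^ 2) = (∫ x in -a..a, ψ x t * gx x t ^ 2)
      + ((∫ x in -a..a, (ψ x s - ψ x t) * gx x s ^ 2)
      - ∫ x in -a..a, (g x s - g x t) * (ψx x t * (gx x s + gx x t)
          + ψ x t * (gxx x s + gxx x t))) := by
    intro s
    rw [sub_eq_add_neg (∫ x in -a..a, (ψ x s - ψ x t) * gx x s ^ 2), ← hibp s,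
      ← intervalIntegral.integral_add (Continuous.intervalIntegrable (by fun_prop) _ _)
      (Continuous.intervalIntegrable (by fun_prop) _ _),
      ← intervalIntegral.integral_add (Continuous.intervalIntegrable (by fun_prop) _ _)
      (Continuous.intervalIntegrable (by fun_prop) _ _)]
    congr 1; ext x; ring
  have key : ∀ {f ft h : ℝ → ℝ → ℝ}, Continuous (fun p : ℝ × ℝ => f p.1 p.2) →
      Continuous (fun p : ℝ × ℝ => ft p.1 p.2) → Continuous (fun p : ℝ × ℝ => h p.1 p.2) →
      (∀ x, ∀ t ∈ Ioo 0 T, HasDerivAt (fun s => f x s) (ft x t) t) →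
      HasDerivAt (fun s => ∫ x in -a..a, (f x s - f x t) * h x s)
        (∫ x in -a..a, ft x t * h x t) t := by
    intro f ft h cf cft ch hf
    rw [hasDerivAt_iff_tendsto_slope]
    obtain ⟨C, hC⟩ := (isCompact_uIcc (a := -a) (b := a)).prod
      (isCompact_Icc (a := (0:ℝ)) (b := T)) |>.exists_bound_of_continuousOn cft.continuousOn
    obtain ⟨C', hC'⟩ := (isCompact_uIcc (a := -a) (b := a)).prod
      (isCompact_Icc (a := (0:ℝ)) (b := T)) |>.exists_bound_of_continuousOn ch.continuousOn
    have hslope : ∀ s, slope (fun s => ∫ x in -a..a, (f x s - f x t) * h x s) t s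
        = ∫ x in -a..a, slope (f x) t s * h x s := by
      intro s
      simp only [slope, vsub_eq_sub, sub_self, zero_mul, intervalIntegral.integral_zero, sub_zero,
        smul_eq_mul]
      rw [← intervalIntegral.integral_const_mul]
      congr 1; ext x; ring
    rw [show slope (fun s => ∫ x in -a..a, (f x s - f x t) * h x s) t = _ from funext hslope]
    apply intervalIntegral.tendsto_integral_filter_of_dominated_convergence (fun _ => C * C')
    · refine Eventually.of_forall fun s => Continuous.aestronglyMeasurable ?_
      simp only [slope, vsub_eq_sub, smul_eq_mul]
      fun_prop
    · have hmem : Ioo 0 T ∈ nhdsWithin t {t}ᶜ :=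
        mem_nhdsWithin_of_mem_nhds (Ioo_mem_nhds ht.1 ht.2)
      filter_upwards [hmem, self_mem_nhdsWithin] with s hs hst
      refine Eventually.of_forall fun x hx => ?_
      have hx' := uIoc_subset_uIcc hx
      have h1 : ‖f x s - f x t‖ ≤ C * ‖s - t‖ :=
        (convex_Ioo 0 T).norm_image_sub_le_of_norm_hasDerivWithin_le
          (fun r hr => (hf x r hr).hasDerivWithinAt)
          (fun r hr => hC (x, r) ⟨hx', hr.1.le, hr.2.le⟩) ht hs
      have h2 := hC' (x, s) ⟨hx', hs.1.le, hs.2.le⟩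
      have hC0 : 0 ≤ C := (norm_nonneg _).trans (hC (x, s) ⟨hx', hs.1.le, hs.2.le⟩)
      rw [norm_mul]
      apply mul_le_mul _ h2 (norm_nonneg _) hC0
      rw [slope_def_field, norm_div]
      exact div_le_of_le_mul₀ (norm_nonneg _) hC0 h1
    · exact intervalIntegrable_const
    · refine Eventually.of_forall fun x _ => ?_
      have h1 := (hasDerivAt_iff_tendsto_slope.1 (hf x t ht))
      have h2 : Tendsto (fun s => h x s) (nhdsWithin t {t}ᶜ) (nhds (h x t)) :=
        ((show Continuous fun s => h x s by fun_prop).tendsto t).mono_left nhdsWithin_le_nhds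
      exact h1.mul h2
  have k1 := key cψ cψt (h := fun x s => gx x s ^ 2) (by fun_prop) hψt
  have k2 := key cg cgt (h := fun x s => ψx x t * (gx x s + gx x t)
          + ψ x t * (gxx x s + gxx x t)) (by fun_prop) hgt
  have k := (k1.sub k2).const_add (∫ x in -a..a, ψ x t * gx x t ^ 2)
  refine (k.congr_of_eventuallyEq (Eventually.of_forall fun s => hdecomp s)).congr_deriv ?_
  rw [← intervalIntegral.integral_sub (Continuous.intervalIntegrable (by fun_prop) _ _)
      (Continuous.intervalIntegrable (by fun_prop) _ _)]
  congr 1; ext x; ring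

/-- A continuous function bounded below by a nonnegative one has larger interval integral. -/
theorem integral_le_of_le {f g : ℝ → ℝ} {a b : ℝ} (hab : a ≤ b) (hf : Continuous f)
    (hg : Continuous g) (h : ∀ x ∈ Icc a b, f x ≤ g x) : ∫ x in a..b, f x ≤ ∫ x in a..b, g x :=
  intervalIntegral.integral_mono_on hab (hf.intervalIntegrable _ _) (hg.intervalIntegrable _ _) h

/-- Enlarging the interval increases the integral of a nonnegative continuous function. -/
theorem integral_le_of_subset {f : ℝ → ℝ} {a b c d : ℝ} (hf : Continuous f) (hca : c ≤ a)
    (hab : a ≤ b) (hbd : b ≤ d) (h : ∀ x ∈ Icc c d, 0 ≤ f x) :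
    ∫ x in a..b, f x ≤ ∫ x in c..d, f x := by
  apply intervalIntegral.integral_mono_interval hca hab hbd _ (hf.intervalIntegrable _ _)
  exact (ae_restrict_iff' measurableSet_Ioc).2
    (Eventually.of_forall fun x hx => h x ⟨hx.1.le, hx.2⟩)

/-- The spatial cutoff on `[-a, a]`. -/
def cut (a x : ℝ) : ℝ := 1 - (x / a) ^ 2

/-- The derivative of `cut a`. -/
def dcut (a x : ℝ) : ℝ := -(2 * x / a ^ 2)

@[fun_prop]
theorem continuous_cut (a : ℝ) : Continuous (cut a) := by unfold cut; fun_prop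

@[fun_prop]
theorem continuous_dcut (a : ℝ) : Continuous (dcut a) := by unfold dcut; fun_prop

theorem hasDerivAt_cut (a x : ℝ) : HasDerivAt (cut a) (dcut a x) x := by
  have := (((hasDerivAt_id x).div_const a).pow 2).const_sub 1
  refine this.congr_deriv ?_
  simp [dcut]; ring

theorem hasDerivAt_cut_sq (a x : ℝ) :
    HasDerivAt (fun x => cut a x ^ 2) (2 * cut a x * dcut a x) x := by
  refine ((hasDerivAt_cut a x).pow 2).congr_deriv ?_
  norm_num

theorem cut_left {a : ℝ} (ha : a ≠ 0) : cut a (-a) = 0 := by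
  simp [cut, ha]

theorem cut_right {a : ℝ} (ha : a ≠ 0) : cut a a = 0 := by
  simp [cut, ha]

theorem sq_div_le_one {a x : ℝ} (ha : 0 < a) (hx : x ∈ Icc (-a) a) : (x / a) ^ 2 ≤ 1 := by
  rw [div_pow, div_le_one (by positivity)]
  exact sq_le_sq' hx.1 hx.2

theorem cut_nonneg {a x : ℝ} (ha : 0 < a) (hx : x ∈ Icc (-a) a) : 0 ≤ cut a x := by
  have := sq_div_le_one ha hx
  unfold cut; linarith

theorem cut_le_one (a x : ℝ) : cut a x ≤ 1 := by
  unfold cut; nlinarith [sq_nonneg (x / a)]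

theorem cut_sq_le_one {a x : ℝ} (ha : 0 < a) (hx : x ∈ Icc (-a) a) : cut a x ^ 2 ≤ 1 := by
  have := cut_nonneg ha hx
  have := cut_le_one a x
  nlinarith

theorem half_le_cut_sq {a x : ℝ} (ha : 0 < a) (hx : x ∈ Icc (-(a / 2)) (a / 2)) :
    1 / 2 ≤ cut a x ^ 2 := by
  have h : (x / a) ^ 2 ≤ 1 / 4 := by
    rw [div_pow, div_le_iff₀ (by positivity)]
    nlinarith [sq_le_sq' hx.1 hx.2]
  unfold cut; nlinarith

theorem dcut_sq_le {a x : ℝ} (ha : 0 < a) (hx : x ∈ Icc (-a) a) : dcut a x ^ 2 ≤ 4 / a ^ 2 := by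
  have h := sq_div_le_one ha hx
  have : dcut a x ^ 2 = 4 / a ^ 2 * (x / a) ^ 2 := by
    unfold dcut; field_simp; ring
  rw [this]
  exact mul_le_of_le_one_right (by positivity) h

/-- Integration by parts against the squared cutoff. -/
theorem integral_cut_sq_mul_deriv {a : ℝ} (ha : 0 < a) {F F' : ℝ → ℝ}
    (hF : ∀ x, HasDerivAt F (F' x) x) (cF' : Continuous F') :
    ∫ x in -a..a, cut a x ^ 2 * F' x = -∫ x in -a..a, 2 * cut a x * dcut a x * F x := by
  have cF : Continuous F := continuous_iff_continuousAt.2 fun x => (hF x).continuousAt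
  have h := intervalIntegral.integral_eq_sub_of_hasDerivAt (a := -a) (b := a)
    (fun x _ => (hasDerivAt_cut_sq a x).mul (hF x))
    (Continuous.intervalIntegrable (by fun_prop) _ _)
  rw [intervalIntegral.integral_add (Continuous.intervalIntegrable (by fun_prop) _ _)
      (Continuous.intervalIntegrable (by fun_prop) _ _)] at h
  simp only [Pi.mul_apply, cut_left ha.ne', cut_right ha.ne'] at h
  linarith

/-- Local integrals are controlled by cutoff integrals. -/
theorem integral_le_two_mul_cut {a c d : ℝ} (ha : 0 < a) (hcd : c ≤ d) (hc : -(a / 2) ≤ c)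
    (hd : d ≤ a / 2) {f : ℝ → ℝ} (hf : Continuous f) (h0 : ∀ x, 0 ≤ f x) :
    ∫ x in c..d, f x ≤ 2 * ∫ x in -a..a, cut a x ^ 2 * f x := by
  rw [← intervalIntegral.integral_const_mul]
  calc ∫ x in c..d, f x ≤ ∫ x in c..d, 2 * (cut a x ^ 2 * f x) := by
        apply integral_le_of_le hcd hf (by fun_prop)
        intro x hx
        have := half_le_cut_sq ha (x := x) ⟨hc.trans hx.1, hx.2.trans hd⟩
        nlinarith [h0 x]
    _ ≤ _ := by
        apply integral_le_of_subset (by fun_prop) (by linarith) hcd (by linarith)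
        intro x _
        have := h0 x
        positivity

theorem integral_dcut_sq_le {a : ℝ} (ha : 0 < a) {f : ℝ → ℝ} (hf : Continuous f)
    (h0 : ∀ x, 0 ≤ f x) :
    ∫ x in -a..a, dcut a x ^ 2 * f x
      ≤ 8 / a ^ 2 * ∫ x in -(2 * a)..(2 * a), cut (2 * a) x ^ 2 * f x := by
  have h1 : ∫ x in -a..a, dcut a x ^ 2 * f x ≤ ∫ x in -a..a, 4 / a ^ 2 * f x := by
    apply integral_le_of_le (by linarith) (by fun_prop) (by fun_prop)
    intro x hx
    exact mul_le_mul_of_nonneg_right (dcut_sq_le ha hx) (h0 x)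
  rw [intervalIntegral.integral_const_mul] at h1
  have h2 := integral_le_two_mul_cut (a := 2 * a) (by linarith) (show -a ≤ a by linarith)
    (by linarith) (by linarith) hf h0
  refine h1.trans ((mul_le_mul_of_nonneg_left h2 (by positivity)).trans (le_of_eq ?_))
  ring

/-- Localized one-dimensional Sobolev inequality. -/
theorem cut_mul_sq_le {a ε : ℝ} (ha : 0 < a) (hε : 0 < ε) {g gx : ℝ → ℝ}
    (hg : ∀ x, HasDerivAt g (gx x) x) (cgx : Continuous gx) {x : ℝ} (hx : x ∈ Icc (-a) a) :
    (cut a x * g x) ^ 2 ≤ ε * (∫ x in -a..a, cut a x ^ 2 * gx x ^ 2)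
      + (1 / ε + 1) * (∫ x in -a..a, cut a x ^ 2 * g x ^ 2)
      + ∫ x in -a..a, dcut a x ^ 2 * g x ^ 2 := by
  have cg : Continuous g := continuous_iff_continuousAt.2 fun x => (hg x).continuousAt
  have h := intervalIntegral.integral_eq_sub_of_hasDerivAt (a := -a) (b := x)
    (fun x _ => ((hasDerivAt_cut a x).mul (hg x)).pow 2)
    (Continuous.intervalIntegrable (by fun_prop) _ _)
  simp only [Pi.mul_apply, Pi.pow_apply, cut_left ha.ne', zero_mul, ne_eq, OfNat.ofNat_ne_zero,
    not_false_eq_true, zero_pow, sub_zero] at h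
  rw [← h, ← intervalIntegral.integral_const_mul, ← intervalIntegral.integral_const_mul,
    ← intervalIntegral.integral_add (Continuous.intervalIntegrable (by fun_prop) _ _)
      (Continuous.intervalIntegrable (by fun_prop) _ _),
    ← intervalIntegral.integral_add (Continuous.intervalIntegrable (by fun_prop) _ _)
      (Continuous.intervalIntegrable (by fun_prop) _ _)]
  calc _ ≤ ∫ y in -a..x, (ε * (cut a y ^ 2 * gx y ^ 2) + (1 / ε + 1) * (cut a y ^ 2 * g y ^ 2)
        + dcut a y ^ 2 * g y ^ 2) := by
        apply integral_le_of_le hx.1 (by fun_prop) (by fun_prop)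
        intro y _
        have e1 : 0 ≤ (ε * (cut a y * gx y) - cut a y * g y) ^ 2 / ε := by positivity
        have e2 : (ε * (cut a y * gx y) - cut a y * g y) ^ 2 / ε
          = ε * (cut a y * gx y) ^ 2 - 2 * (cut a y * gx y) * (cut a y * g y)
            + 1 / ε * (cut a y * g y) ^ 2 := by field_simp; ring
        have e3 := sq_nonneg (dcut a y * g y - cut a y * g y)
        norm_num
        rw [one_div] at e2
        nlinarith
    _ ≤ _ := by
        apply integral_le_of_subset (by fun_prop) le_rfl hx.1 hx.2
        intro y _
        positivity

/-- The increment of a `C¹` function on a cell is bounded by the integral of a majorant of its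
derivative. -/
theorem sub_le_integral_cell {g gx m : ℝ → ℝ} {z x y : ℝ} (hg : ∀ x, HasDerivAt g (gx x) x)
    (cgx : Continuous gx) (cm : Continuous m) (hx : x ∈ Icc z (z + 1)) (hy : y ∈ Icc z (z + 1))
    (hm : ∀ x ∈ Icc z (z + 1), |gx x| ≤ m x) : g x - g y ≤ ∫ x in z..(z + 1), m x := by
  have h := intervalIntegral.integral_eq_sub_of_hasDerivAt (a := y) (b := x)
    (fun x _ => hg x) (cgx.intervalIntegrable _ _)
  rw [← h]
  have hm0 : ∀ x ∈ Icc z (z + 1), 0 ≤ m x := fun x hx => (abs_nonneg _).trans (hm x hx)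
  rcases le_total y x with hyx | hxy
  · refine (integral_le_of_le hyx cgx cm fun r hr => ?_).trans
      (integral_le_of_subset cm hy.1 hyx hx.2 hm0)
    exact (le_abs_self _).trans (hm r ⟨hy.1.trans hr.1, hr.2.trans hx.2⟩)
  · rw [intervalIntegral.integral_symm, ← intervalIntegral.integral_neg]
    refine (integral_le_of_le hxy cgx.neg cm fun r hr => ?_).trans
      (integral_le_of_subset cm hx.1 hxy hy.2 hm0)
    exact (neg_le_abs _).trans (hm r ⟨hx.1.trans hr.1, hr.2.trans hy.2⟩)

/-- A continuous function takes somewhere on a cell a value at most its mean. -/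
theorem exists_le_integral_cell {f : ℝ → ℝ} (hf : Continuous f) (z : ℝ) :
    ∃ y ∈ Icc z (z + 1), f y ≤ ∫ x in z..(z + 1), f x := by
  by_contra! hcon
  obtain ⟨y, hy, hmin⟩ := (isCompact_Icc (a := z) (b := z + 1)).exists_isMinOn
    ⟨z, by simp⟩ hf.continuousOn
  have h1 : ∫ _x in z..(z + 1), f y ≤ ∫ x in z..(z + 1), f x :=
    integral_le_of_le (by linarith) (by fun_prop) hf fun x hx => hmin hx
  simp only [intervalIntegral.integral_const, add_sub_cancel_left, one_smul] at h1
  exact absurd (hcon y hy) (not_lt.2 h1)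

/-- The quotient `μ(z) / z`. -/
def kap (α z : ℝ) : ℝ := z⁻¹ + α * z ^ (-α - 1)

/-- The derivative of `kap`. -/
def dkap (α z : ℝ) : ℝ := -(z ^ 2)⁻¹ - α * (α + 1) * z ^ (-α - 2)

/-- A primitive of `kap`. -/
def pot (α z : ℝ) : ℝ := Real.log z - z ^ (-α)

theorem visc_div (α : ℝ) {z : ℝ} (hz : 0 < z) : visc α z / z = kap α z := by
  rw [visc, kap, Real.rpow_sub_one hz.ne']
  field_simp

theorem hasDerivAt_kap (α : ℝ) {z : ℝ} (hz : 0 < z) : HasDerivAt (kap α) (dkap α z) z := by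
  have h := (hasDerivAt_inv hz.ne').add
    ((Real.hasDerivAt_rpow_const (p := -α - 1) (Or.inl hz.ne')).const_mul α)
  refine h.congr_deriv ?_
  rw [dkap, show -α - 1 - 1 = -α - 2 by ring]
  ring

theorem hasDerivAt_pot (α : ℝ) {z : ℝ} (hz : 0 < z) : HasDerivAt (pot α) (kap α z) z := by
  have h := (Real.hasDerivAt_log hz.ne').sub
    (Real.hasDerivAt_rpow_const (p := -α) (Or.inl hz.ne'))
  refine h.congr_deriv ?_
  rw [kap]; ring

theorem HasDerivAt.kap_comp (α : ℝ) {f : ℝ → ℝ} {f' x : ℝ} (h : HasDerivAt f f' x)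
    (hx : 0 < f x) : HasDerivAt (fun y => kap α (f y)) (dkap α (f x) * f') x :=
  HasDerivAt.comp (h₂ := kap α) x (hasDerivAt_kap α hx) h

theorem HasDerivAt.pot_comp (α : ℝ) {f : ℝ → ℝ} {f' x : ℝ} (h : HasDerivAt f f' x)
    (hx : 0 < f x) : HasDerivAt (fun y => pot α (f y)) (kap α (f x) * f') x :=
  HasDerivAt.comp (h₂ := pot α) x (hasDerivAt_pot α hx) h

/-- A real function of `(x, t)` with its classical derivatives, time-differentiable on `(0, T)`. -/
structure Fld (T : ℝ) where
  /-- the function -/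
  f : ℝ → ℝ → ℝ
  /-- first spatial derivative -/
  x : ℝ → ℝ → ℝ
  /-- second spatial derivative -/
  xx : ℝ → ℝ → ℝ
  /-- time derivative -/
  t : ℝ → ℝ → ℝ
  cf : Continuous fun p : ℝ × ℝ => f p.1 p.2
  cx : Continuous fun p : ℝ × ℝ => x p.1 p.2
  cxx : Continuous fun p : ℝ × ℝ => xx p.1 p.2
  ct : Continuous fun p : ℝ × ℝ => t p.1 p.2
  hx : ∀ y s, HasDerivAt (fun z => f z s) (x y s) y
  hxx : ∀ y s, HasDerivAt (fun z => x z s) (xx y s) y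
  ht : ∀ y, ∀ s ∈ Ioo 0 T, HasDerivAt (fun r => f y r) (t y s) s

namespace Fld
variable {T : ℝ} {X : Type*} [TopologicalSpace X]

@[fun_prop]
theorem continuous_f (F : Fld T) {g h : X → ℝ} (hg : Continuous g) (hh : Continuous h) :
    Continuous fun z => F.f (g z) (h z) := F.cf.comp (hg.prodMk hh)

@[fun_prop]
theorem continuous_x (F : Fld T) {g h : X → ℝ} (hg : Continuous g) (hh : Continuous h) :
    Continuous fun z => F.x (g z) (h z) := F.cx.comp (hg.prodMk hh)

@[fun_prop]
theorem continuous_xx (F : Fld T) {g h : X → ℝ} (hg : Continuous g) (hh : Continuous h) :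
    Continuous fun z => F.xx (g z) (h z) := F.cxx.comp (hg.prodMk hh)

@[fun_prop]
theorem continuous_t (F : Fld T) {g h : X → ℝ} (hg : Continuous g) (hh : Continuous h) :
    Continuous fun z => F.t (g z) (h z) := F.ct.comp (hg.prodMk hh)

end Fld

/-- A classical solution in scalar components, extended constantly in time outside `[0, T]`. -/
structure Sol (α β T : ℝ) where
  /-- specific volume -/
  v : ℝ → ℝ → ℝ
  /-- its spatial derivative -/
  vx : ℝ → ℝ → ℝ
  /-- longitudinal velocity -/
  u : Fld T
  /-- temperature -/
  θ : Fld T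
  /-- first transverse velocity -/
  w₁ : Fld T
  /-- second transverse velocity -/
  w₂ : Fld T
  /-- first transverse magnetic field -/
  b₁ : Fld T
  /-- second transverse magnetic field -/
  b₂ : Fld T
  cv : Continuous fun p : ℝ × ℝ => v p.1 p.2
  cvx : Continuous fun p : ℝ × ℝ => vx p.1 p.2
  hvx : ∀ x t, HasDerivAt (fun y => v y t) (vx x t) x
  hvt : ∀ x, ∀ t ∈ Ioo 0 T, HasDerivAt (fun s => v x s) (u.x x t) t
  v_pos : ∀ x t, 0 < v x t
  θ_pos : ∀ x t, 0 < θ.f x t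
  mom : ∀ x t, u.t x t = kap α (v x t) * u.xx x t + dkap α (v x t) * vx x t * u.x x t
    - (θ.x x t / v x t - θ.f x t * vx x t / v x t ^ 2
      + b₁.f x t * b₁.x x t + b₂.f x t * b₂.x x t)
  eqw₁ : ∀ x t, w₁.t x t = b₁.x x t + (w₁.xx x t / v x t - w₁.x x t * vx x t / v x t ^ 2)
  eqw₂ : ∀ x t, w₂.t x t = b₂.x x t + (w₂.xx x t / v x t - w₂.x x t * vx x t / v x t ^ 2)
  eqb₁ : ∀ x t, v x t * b₁.t x t + u.x x t * b₁.f x t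
    = w₁.x x t + (b₁.xx x t / v x t - b₁.x x t * vx x t / v x t ^ 2)
  eqb₂ : ∀ x t, v x t * b₂.t x t + u.x x t * b₂.f x t
    = w₂.x x t + (b₂.xx x t / v x t - b₂.x x t * vx x t / v x t ^ 2)
  temp : ∀ x t, θ.t x t = -(θ.f x t / v x t * u.x x t)
    + (θ.f x t ^ β * θ.xx x t / v x t + β * θ.f x t ^ (β - 1) * θ.x x t ^ 2 / v x t
      - θ.f x t ^ β * θ.x x t * vx x t / v x t ^ 2)
    + (kap α (v x t) * u.x x t ^ 2
      + (w₁.x x t ^ 2 + w₂.x x t ^ 2 + b₁.x x t ^ 2 + b₂.x x t ^ 2) / v x t)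
  far : ∀ ε > (0:ℝ), ∃ M : ℝ, ∀ x t, M ≤ |x| →
    |v x t - 1| < ε ∧ |u.f x t| < ε ∧ |θ.f x t - 1| < ε ∧ |b₁.f x t| < ε ∧ |b₂.f x t| < ε ∧
    |w₁.f x t| < ε ∧ |w₂.f x t| < ε

namespace Sol
variable {α β T : ℝ} {X : Type*} [TopologicalSpace X]

@[fun_prop]
theorem continuous_v (s : Sol α β T) {g h : X → ℝ} (hg : Continuous g) (hh : Continuous h) :
    Continuous fun z => s.v (g z) (h z) := s.cv.comp (hg.prodMk hh)

@[fun_prop]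
theorem continuous_vx (s : Sol α β T) {g h : X → ℝ} (hg : Continuous g) (hh : Continuous h) :
    Continuous fun z => s.vx (g z) (h z) := s.cvx.comp (hg.prodMk hh)

@[simp]
theorem v_ne (s : Sol α β T) (x t : ℝ) : s.v x t ≠ 0 := (s.v_pos x t).ne'

@[simp]
theorem θ_ne (s : Sol α β T) (x t : ℝ) : s.θ.f x t ≠ 0 := (s.θ_pos x t).ne'

@[fun_prop]
theorem continuous_v_rpow (s : Sol α β T) (p : ℝ) {g h : X → ℝ} (hg : Continuous g)
    (hh : Continuous h) : Continuous fun z => s.v (g z) (h z) ^ p :=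
  (s.continuous_v hg hh).rpow_const fun _ => Or.inl (s.v_ne _ _)

@[fun_prop]
theorem continuous_kap (s : Sol α β T) {g h : X → ℝ} (hg : Continuous g) (hh : Continuous h) :
    Continuous fun z => kap α (s.v (g z) (h z)) :=
  ((s.continuous_v hg hh).inv₀ fun _ => s.v_ne _ _).add
    (continuous_const.mul (s.continuous_v_rpow _ hg hh))

@[fun_prop]
theorem continuous_θ_rpow (s : Sol α β T) (p : ℝ) {g h : X → ℝ} (hg : Continuous g)
    (hh : Continuous h) : Continuous fun z => s.θ.f (g z) (h z) ^ p :=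
  (s.θ.continuous_f hg hh).rpow_const fun _ => Or.inl (s.θ_ne _ _)

/-- The integrand of the initial `H¹` bound. -/
def initDensity (s : Sol α β T) (x : ℝ) : ℝ :=
  (s.v x 0 - 1) ^ 2 + s.u.f x 0 ^ 2 + (s.θ.f x 0 - 1) ^ 2
    + (s.b₁.f x 0 ^ 2 + s.b₂.f x 0 ^ 2) + (s.w₁.f x 0 ^ 2 + s.w₂.f x 0 ^ 2)
    + s.vx x 0 ^ 2 + s.u.x x 0 ^ 2 + s.θ.x x 0 ^ 2
    + (s.b₁.x x 0 ^ 2 + s.b₂.x x 0 ^ 2) + (s.w₁.x x 0 ^ 2 + s.w₂.x x 0 ^ 2)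

/-- Admissible initial data for a componentwise solution. -/
structure Init (s : Sol α β T) (K δ : ℝ) : Prop where
  bound : ∀ a, 0 < a → ∫ x in -a..a, s.initDensity x ≤ K ^ 2
  v_ge : ∀ x, δ ≤ s.v x 0
  θ_ge : ∀ x, δ ≤ s.θ.f x 0

end Sol

/-- Projection of time onto `[0, T]`. -/
def clamp (T t : ℝ) : ℝ := max 0 (min t T)

@[fun_prop]
theorem continuous_clamp (T : ℝ) : Continuous (clamp T) := by unfold clamp; fun_prop

theorem clamp_mem {T : ℝ} (hT : 0 < T) (t : ℝ) : clamp T t ∈ Icc 0 T :=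
  ⟨le_max_left _ _, max_le hT.le (min_le_right _ _)⟩

theorem clamp_eq {T t : ℝ} (ht : t ∈ Icc 0 T) : clamp T t = t := by
  rw [clamp, min_eq_left ht.2, max_eq_right ht.1]

theorem continuous_clamp_comp {T : ℝ} (hT : 0 < T) {g : ℝ → ℝ → ℝ}
    (hg : ContinuousOn (fun p : ℝ × ℝ => g p.1 p.2) (univ ×ˢ Icc 0 T)) :
    Continuous fun p : ℝ × ℝ => g p.1 (clamp T p.2) :=
  hg.comp_continuous (f := fun p : ℝ × ℝ => (p.1, clamp T p.2)) (by fun_prop)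
    fun p => ⟨mem_univ _, clamp_mem hT _⟩

theorem hasDerivAt_clamp_comp {T : ℝ} {g : ℝ → ℝ} {g' t : ℝ} (ht : t ∈ Ioo 0 T)
    (hg : HasDerivWithinAt g g' (Icc 0 T) t) : HasDerivAt (fun s => g (clamp T s)) g' t := by
  refine (hg.hasDerivAt (Icc_mem_nhds ht.1 ht.2)).congr_of_eventuallyEq ?_
  filter_upwards [Ioo_mem_nhds ht.1 ht.2] with s hs
  rw [clamp_eq (Ioo_subset_Icc_self hs)]

/-- Extension of a function on `ℝ × [0, T]` to a field. -/
def Fld.ofClamp {T : ℝ} (hT : 0 < T) (g gx gxx gt : ℝ → ℝ → ℝ)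
    (c : ContinuousOn (fun p : ℝ × ℝ => g p.1 p.2) (univ ×ˢ Icc 0 T))
    (cx : ContinuousOn (fun p : ℝ × ℝ => gx p.1 p.2) (univ ×ˢ Icc 0 T))
    (cxx : ContinuousOn (fun p : ℝ × ℝ => gxx p.1 p.2) (univ ×ˢ Icc 0 T))
    (ct : ContinuousOn (fun p : ℝ × ℝ => gt p.1 p.2) (univ ×ˢ Icc 0 T))
    (hx : ∀ x, ∀ t ∈ Icc 0 T, HasDerivAt (fun y => g y t) (gx x t) x)
    (hxx : ∀ x, ∀ t ∈ Icc 0 T, HasDerivAt (fun y => gx y t) (gxx x t) x)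
    (ht : ∀ x, ∀ t ∈ Icc 0 T, HasDerivWithinAt (fun s => g x s) (gt x t) (Icc 0 T) t) :
    Fld T where
  f x t := g x (clamp T t)
  x x t := gx x (clamp T t)
  xx x t := gxx x (clamp T t)
  t x t := gt x (clamp T t)
  cf := continuous_clamp_comp hT c
  cx := continuous_clamp_comp hT cx
  cxx := continuous_clamp_comp hT cxx
  ct := continuous_clamp_comp hT ct
  hx y s := hx y _ (clamp_mem hT s)
  hxx y s := hxx y _ (clamp_mem hT s)
  ht y s hs := by
    rw [clamp_eq (Ioo_subset_Icc_self hs)]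
    exact hasDerivAt_clamp_comp hs (ht y s (Ioo_subset_Icc_self hs))

theorem HasDerivAt.fst_comp {f : ℝ → ℝ × ℝ} {f' : ℝ × ℝ} {x : ℝ} (h : HasDerivAt f f' x) :
    HasDerivAt (fun y => (f y).1) f'.1 x :=
  (ContinuousLinearMap.fst ℝ ℝ ℝ).hasFDerivAt.comp_hasDerivAt x h

theorem HasDerivAt.snd_comp {f : ℝ → ℝ × ℝ} {f' : ℝ × ℝ} {x : ℝ} (h : HasDerivAt f f' x) :
    HasDerivAt (fun y => (f y).2) f'.2 x :=
  (ContinuousLinearMap.snd ℝ ℝ ℝ).hasFDerivAt.comp_hasDerivAt x h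

theorem HasDerivWithinAt.fst_comp {f : ℝ → ℝ × ℝ} {f' : ℝ × ℝ} {s : Set ℝ} {x : ℝ}
    (h : HasDerivWithinAt f f' s x) : HasDerivWithinAt (fun y => (f y).1) f'.1 s x :=
  (ContinuousLinearMap.fst ℝ ℝ ℝ).hasFDerivAt.comp_hasDerivWithinAt x h

theorem HasDerivWithinAt.snd_comp {f : ℝ → ℝ × ℝ} {f' : ℝ × ℝ} {s : Set ℝ} {x : ℝ}
    (h : HasDerivWithinAt f f' s x) : HasDerivWithinAt (fun y => (f y).2) f'.2 s x :=
  (ContinuousLinearMap.snd ℝ ℝ ℝ).hasFDerivAt.comp_hasDerivWithinAt x h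

namespace IsClassicalSolution
variable {α β T : ℝ} {v u θ : ℝ → ℝ → ℝ} {w b : ℝ → ℝ → ℝ × ℝ}

/-- A classical solution in scalar components. -/
def toSol (h : IsClassicalSolution α β T v u θ w b) (hT : 0 < T) : Sol α β T where
  v x t := v x (clamp T t)
  vx x t := pdx v x (clamp T t)
  u := Fld.ofClamp hT u (pdx u) (pdx (pdx u)) (pdt T u) h.cont.snd.fst h.cont_dx.snd.fst
    h.cont_dxx.fst h.cont_dt.snd.fst (fun x t ht => (h.diff_x x t ht).2.1.hasDerivAt)
    (fun x t ht => (h.diff_xx x t ht).1.hasDerivAt)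
    (fun x t ht => (h.diff_t x t ht).2.1.hasDerivWithinAt)
  θ := Fld.ofClamp hT θ (pdx θ) (pdx (pdx θ)) (pdt T θ) h.cont.snd.snd.fst h.cont_dx.snd.snd.fst
    h.cont_dxx.snd.fst h.cont_dt.snd.snd.fst (fun x t ht => (h.diff_x x t ht).2.2.1.hasDerivAt)
    (fun x t ht => (h.diff_xx x t ht).2.1.hasDerivAt)
    (fun x t ht => (h.diff_t x t ht).2.2.1.hasDerivWithinAt)
  w₁ := Fld.ofClamp hT (fun x t => (w x t).1) (fun x t => (pdx w x t).1)
    (fun x t => (pdx (pdx w) x t).1) (fun x t => (pdt T w x t).1)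
    h.cont.snd.snd.snd.fst.fst h.cont_dx.snd.snd.snd.fst.fst
    h.cont_dxx.snd.snd.fst.fst h.cont_dt.snd.snd.snd.fst.fst
    (fun x t ht => (h.diff_x x t ht).2.2.2.1.hasDerivAt.fst_comp)
    (fun x t ht => (h.diff_xx x t ht).2.2.1.hasDerivAt.fst_comp)
    (fun x t ht => (h.diff_t x t ht).2.2.2.1.hasDerivWithinAt.fst_comp)
  w₂ := Fld.ofClamp hT (fun x t => (w x t).2) (fun x t => (pdx w x t).2)
    (fun x t => (pdx (pdx w) x t).2) (fun x t => (pdt T w x t).2)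
    h.cont.snd.snd.snd.fst.snd h.cont_dx.snd.snd.snd.fst.snd
    h.cont_dxx.snd.snd.fst.snd h.cont_dt.snd.snd.snd.fst.snd
    (fun x t ht => (h.diff_x x t ht).2.2.2.1.hasDerivAt.snd_comp)
    (fun x t ht => (h.diff_xx x t ht).2.2.1.hasDerivAt.snd_comp)
    (fun x t ht => (h.diff_t x t ht).2.2.2.1.hasDerivWithinAt.snd_comp)
  b₁ := Fld.ofClamp hT (fun x t => (b x t).1) (fun x t => (pdx b x t).1)
    (fun x t => (pdx (pdx b) x t).1) (fun x t => (pdt T b x t).1)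
    h.cont.snd.snd.snd.snd.fst h.cont_dx.snd.snd.snd.snd.fst
    h.cont_dxx.snd.snd.snd.fst h.cont_dt.snd.snd.snd.snd.fst
    (fun x t ht => (h.diff_x x t ht).2.2.2.2.hasDerivAt.fst_comp)
    (fun x t ht => (h.diff_xx x t ht).2.2.2.hasDerivAt.fst_comp)
    (fun x t ht => (h.diff_t x t ht).2.2.2.2.hasDerivWithinAt.fst_comp)
  b₂ := Fld.ofClamp hT (fun x t => (b x t).2) (fun x t => (pdx b x t).2)
    (fun x t => (pdx (pdx b) x t).2) (fun x t => (pdt T b x t).2)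
    h.cont.snd.snd.snd.snd.snd h.cont_dx.snd.snd.snd.snd.snd
    h.cont_dxx.snd.snd.snd.snd h.cont_dt.snd.snd.snd.snd.snd
    (fun x t ht => (h.diff_x x t ht).2.2.2.2.hasDerivAt.snd_comp)
    (fun x t ht => (h.diff_xx x t ht).2.2.2.hasDerivAt.snd_comp)
    (fun x t ht => (h.diff_t x t ht).2.2.2.2.hasDerivWithinAt.snd_comp)
  cv := continuous_clamp_comp hT h.cont.fst
  cvx := continuous_clamp_comp hT h.cont_dx.fst
  hvx x t := (h.diff_x x _ (clamp_mem hT t)).1.hasDerivAt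
  hvt x t ht := by
    have ht' := Ioo_subset_Icc_self ht
    have := hasDerivAt_clamp_comp ht (h.diff_t x t ht').1.hasDerivWithinAt
    refine this.congr_deriv ?_
    change _ = pdx u x (clamp T t)
    rw [clamp_eq ht', ← h.eq_mass x t ht']
    rfl
  v_pos x t := h.v_pos x _ (clamp_mem hT t)
  θ_pos x t := h.θ_pos x _ (clamp_mem hT t)
  mom x t := by
    have ht := clamp_mem hT t
    simp only [Fld.ofClamp]
    generalize clamp T t = r at ht ⊢
    obtain ⟨dv, -, dθ, -, db⟩ := h.diff_x x r ht
    have hv := h.v_pos x r ht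
    have e := h.eq_mom x r ht
    have e1 : pdx (fun y s => θ y s / v y s + sq2 (b y s) / 2) x r = _ :=
      ((dθ.hasDerivAt.div dv.hasDerivAt hv.ne').add
        (((db.hasDerivAt.fst_comp.pow 2).add (db.hasDerivAt.snd_comp.pow 2)).div_const 2)).deriv
    have hfun : (fun y => visc α (v y r) * pdx u y r / v y r)
        = fun y => kap α (v y r) * pdx u y r := by
      ext y
      rw [← visc_div α (h.v_pos y r ht)]; ring
    have hk : HasDerivAt (fun y => kap α (v y r)) (dkap α (v x r) * pdx v x r) x :=
      dv.hasDerivAt.kap_comp α hv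
    have e2 : pdx (fun y s => visc α (v y s) * pdx u y s / v y s) x r
        = dkap α (v x r) * pdx v x r * pdx u x r + kap α (v x r) * pdx (pdx u) x r :=
      (congrArg (fun g => deriv g x) hfun).trans
        (hk.mul (h.diff_xx x r ht).1.hasDerivAt).deriv
    rw [e1, e2] at e
    rw [eq_sub_of_add_eq e]
    simp only [pdx]
    field_simp
    ring
  eqw₁ x t := by
    have ht := clamp_mem hT t
    simp only [Fld.ofClamp]
    generalize clamp T t = r at ht ⊢
    have hv := h.v_pos x r ht
    have e := h.eq_w x r ht
    have e1 : pdx (fun y s => (v y s)⁻¹ • pdx w y s) x r = _ :=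
      (((h.diff_x x r ht).1.hasDerivAt.inv hv.ne').smul
        (h.diff_xx x r ht).2.2.1.hasDerivAt).deriv
    rw [e1, sub_eq_iff_eq_add] at e
    rw [e]
    simp only [pdx, Prod.fst_add, Prod.smul_fst, smul_eq_mul, Pi.inv_apply]
    field_simp
    ring
  eqw₂ x t := by
    have ht := clamp_mem hT t
    simp only [Fld.ofClamp]
    generalize clamp T t = r at ht ⊢
    have hv := h.v_pos x r ht
    have e := h.eq_w x r ht
    have e1 : pdx (fun y s => (v y s)⁻¹ • pdx w y s) x r = _ :=
      (((h.diff_x x r ht).1.hasDerivAt.inv hv.ne').smul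
        (h.diff_xx x r ht).2.2.1.hasDerivAt).deriv
    rw [e1, sub_eq_iff_eq_add] at e
    rw [e]
    simp only [pdx, Prod.snd_add, Prod.smul_snd, smul_eq_mul, Pi.inv_apply]
    field_simp
    ring
  eqb₁ x t := by
    have ht := clamp_mem hT t
    simp only [Fld.ofClamp]
    generalize clamp T t = r at ht ⊢
    have hv := h.v_pos x r ht
    have e := h.eq_b x r ht
    have e1 : pdx (fun y s => (v y s)⁻¹ • pdx b y s) x r = _ :=
      (((h.diff_x x r ht).1.hasDerivAt.inv hv.ne').smul
        (h.diff_xx x r ht).2.2.2.hasDerivAt).deriv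
    have e2 : pdt T (fun y s => v y s • b y s) x r = _ :=
      ((h.diff_t x r ht).1.hasDerivWithinAt.smul
        (h.diff_t x r ht).2.2.2.2.hasDerivWithinAt).derivWithin (uniqueDiffOn_Icc hT r ht)
    have em := h.eq_mass x r ht
    simp only [pdt] at em
    rw [e1, e2, sub_eq_iff_eq_add, em] at e
    have e' := congrArg Prod.fst e
    simp only [pdx, Prod.fst_add, Prod.smul_fst, smul_eq_mul, Pi.inv_apply] at e'
    simp only [pdx, pdt]
    rw [e']
    field_simp
    ring
  eqb₂ x t := by
    have ht := clamp_mem hT t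
    simp only [Fld.ofClamp]
    generalize clamp T t = r at ht ⊢
    have hv := h.v_pos x r ht
    have e := h.eq_b x r ht
    have e1 : pdx (fun y s => (v y s)⁻¹ • pdx b y s) x r = _ :=
      (((h.diff_x x r ht).1.hasDerivAt.inv hv.ne').smul
        (h.diff_xx x r ht).2.2.2.hasDerivAt).deriv
    have e2 : pdt T (fun y s => v y s • b y s) x r = _ :=
      ((h.diff_t x r ht).1.hasDerivWithinAt.smul
        (h.diff_t x r ht).2.2.2.2.hasDerivWithinAt).derivWithin (uniqueDiffOn_Icc hT r ht)
    have em := h.eq_mass x r ht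
    simp only [pdt] at em
    rw [e1, e2, sub_eq_iff_eq_add, em] at e
    have e' := congrArg Prod.snd e
    simp only [pdx, Prod.snd_add, Prod.smul_snd, smul_eq_mul, Pi.inv_apply] at e'
    simp only [pdx, pdt]
    rw [e']
    field_simp
    ring
  temp x t := by
    have ht := clamp_mem hT t
    simp only [Fld.ofClamp]
    generalize clamp T t = r at ht ⊢
    have hv := h.v_pos x r ht
    have hθ := h.θ_pos x r ht
    have e := h.eq_temp x r ht
    obtain ⟨dv, -, dθ, -, -⟩ := h.diff_x x r ht
    have e1 : pdx (fun y s => θ y s ^ β * pdx θ y s / v y s) x r = _ :=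
      (((dθ.hasDerivAt.rpow_const (Or.inl hθ.ne')).mul
        (h.diff_xx x r ht).2.1.hasDerivAt).div dv.hasDerivAt hv.ne').deriv
    rw [e1] at e
    rw [eq_sub_of_add_eq e, ← visc_div α hv]
    simp only [pdx, sq2, Pi.mul_apply]
    field_simp
    ring
  far ε hε := by
    obtain ⟨M, hM⟩ := h.farfield ε hε
    refine ⟨M, fun x t hx => ?_⟩
    obtain ⟨h1, h2, h3, h4, h5⟩ := hM x _ (clamp_mem hT t) hx
    have hs : ∀ p : ℝ × ℝ, Real.sqrt (sq2 p) < ε → |p.1| < ε ∧ |p.2| < ε := fun p hp =>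
      ⟨(Real.abs_le_sqrt (by unfold sq2; nlinarith [sq_nonneg p.2])).trans_lt hp,
        (Real.abs_le_sqrt (by unfold sq2; nlinarith [sq_nonneg p.1])).trans_lt hp⟩
    exact ⟨h1, h2, h3, (hs _ h4).1, (hs _ h4).2, (hs _ h5).1, (hs _ h5).2⟩

theorem toSol_init (h : IsClassicalSolution α β T v u θ w b) (hT : 0 < T) {K δ : ℝ}
    (ha : Admissible K δ v u θ w b) : (h.toSol hT).Init K δ where
  bound a ha0 := by
    have h0 : (0:ℝ) ∈ Icc 0 T := ⟨le_rfl, hT.le⟩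
    have hc : clamp T 0 = 0 := clamp_eq h0
    obtain ⟨i1, i2, i3, i4, i5, i6, i7, i8, i9, i10⟩ := h.sq_int 0 h0
    have hi := ((((((((i1.add i2).add i3).add i4).add i5).add i6).add i7).add i8).add i9).add i10
    refine le_trans ?_ ha.1
    rw [intervalIntegral.integral_of_le (by linarith)]
    simp only [Sol.initDensity, toSol, Fld.ofClamp, hc]
    refine setIntegral_le_integral (s := Ioc (-a) a) hi (Eventually.of_forall fun x => ?_)
    simp only [Pi.zero_apply]
    positivity
  v_ge x := by
    have hc : clamp T 0 = 0 := clamp_eq ⟨le_rfl, hT.le⟩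
    simpa [toSol, hc] using ha.2.1 x
  θ_ge x := by
    have hc : clamp T 0 = 0 := clamp_eq ⟨le_rfl, hT.le⟩
    simpa [toSol, Fld.ofClamp, hc] using ha.2.2 x

end IsClassicalSolution

/-- Integral against the squared cutoff. -/
def cint (a : ℝ) (f : ℝ → ℝ) : ℝ := ∫ x in -a..a, cut a x ^ 2 * f x

/-- Integral against the squared derivative of the cutoff. -/
def dint (a : ℝ) (f : ℝ → ℝ) : ℝ := ∫ x in -a..a, dcut a x ^ 2 * f x

section cint
variable {a : ℝ} {f g : ℝ → ℝ}

theorem cint_add (cf : Continuous f) (cg : Continuous g) :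
    cint a (fun x => f x + g x) = cint a f + cint a g := by
  unfold cint
  rw [← intervalIntegral.integral_add (Continuous.intervalIntegrable (by fun_prop) _ _)
    (Continuous.intervalIntegrable (by fun_prop) _ _)]
  simp only [mul_add]

theorem cint_sub (cf : Continuous f) (cg : Continuous g) :
    cint a (fun x => f x - g x) = cint a f - cint a g := by
  unfold cint
  rw [← intervalIntegral.integral_sub (Continuous.intervalIntegrable (by fun_prop) _ _)
    (Continuous.intervalIntegrable (by fun_prop) _ _)]
  simp only [mul_sub]

theorem cint_const_mul (c : ℝ) : cint a (fun x => c * f x) = c * cint a f := by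
  unfold cint
  rw [← intervalIntegral.integral_const_mul]
  congr 1; ext x; ring

theorem cint_mono (ha : 0 < a) (cf : Continuous f) (cg : Continuous g) (h : ∀ x, f x ≤ g x) :
    cint a f ≤ cint a g :=
  integral_le_of_le (by linarith) (by fun_prop) (by fun_prop) fun x _ =>
    mul_le_mul_of_nonneg_left (h x) (sq_nonneg _)

theorem cint_mono_on (ha : 0 < a) (cf : Continuous f) (cg : Continuous g)
    (h : ∀ x ∈ Icc (-a) a, f x ≤ g x) : cint a f ≤ cint a g :=
  integral_le_of_le (by linarith) (by fun_prop) (by fun_prop) fun x hx =>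
    mul_le_mul_of_nonneg_left (h x hx) (sq_nonneg _)

theorem cint_nonneg (ha : 0 < a) (h : ∀ x, 0 ≤ f x) : 0 ≤ cint a f :=
  intervalIntegral.integral_nonneg (by linarith) fun x _ => mul_nonneg (sq_nonneg _) (h x)

theorem dint_nonneg (ha : 0 < a) (h : ∀ x, 0 ≤ f x) : 0 ≤ dint a f :=
  intervalIntegral.integral_nonneg (by linarith) fun x _ => mul_nonneg (sq_nonneg _) (h x)

theorem cint_le_integral (ha : 0 < a) (cf : Continuous f) (h : ∀ x, 0 ≤ f x) :
    cint a f ≤ ∫ x in -a..a, f x :=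
  integral_le_of_le (by linarith) (by fun_prop) cf fun x hx =>
    mul_le_of_le_one_left (h x) (cut_sq_le_one ha hx)

theorem integral_le_cint_two (ha : 0 < a) (cf : Continuous f) (h : ∀ x, 0 ≤ f x) :
    ∫ x in -a..a, f x ≤ 2 * cint (2 * a) f :=
  integral_le_two_mul_cut (by linarith) (by linarith) (by linarith) (by linarith) cf h

theorem dint_le (ha : 0 < a) (cf : Continuous f) (h : ∀ x, 0 ≤ f x) :
    dint a f ≤ 8 / a ^ 2 * cint (2 * a) f := integral_dcut_sq_le ha cf h

theorem dint_const_le (ha : 0 < a) {c : ℝ} (hc : 0 ≤ c) : dint a (fun _ => c) ≤ 8 * c / a := by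
  have h := integral_le_of_le (f := fun x => dcut a x ^ 2 * c) (g := fun _ => 4 / a ^ 2 * c)
    (a := -a) (b := a) (by linarith) (by fun_prop) (by fun_prop)
    fun x hx => mul_le_mul_of_nonneg_right (dcut_sq_le ha hx) hc
  refine h.trans (le_of_eq ?_)
  rw [intervalIntegral.integral_const, smul_eq_mul]
  field_simp
  ring

theorem continuous_cint {E : ℝ → ℝ → ℝ} (hE : Continuous fun p : ℝ × ℝ => E p.1 p.2) :
    Continuous fun t => cint a fun x => E x t :=
  continuous_integral_param (E := fun x t => cut a x ^ 2 * E x t) (by fun_prop)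

theorem continuous_dint {E : ℝ → ℝ → ℝ} (hE : Continuous fun p : ℝ × ℝ => E p.1 p.2) :
    Continuous fun t => dint a fun x => E x t :=
  continuous_integral_param (E := fun x t => dcut a x ^ 2 * E x t) (by fun_prop)

theorem hasDerivAt_cint {T : ℝ} {E Et : ℝ → ℝ → ℝ}
    (hE : Continuous fun p : ℝ × ℝ => E p.1 p.2) (hEt : Continuous fun p : ℝ × ℝ => Et p.1 p.2)
    (hd : ∀ x, ∀ t ∈ Ioo 0 T, HasDerivAt (fun s => E x s) (Et x t) t) {t : ℝ}
    (ht : t ∈ Ioo 0 T) :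
    HasDerivAt (fun t => cint a fun x => E x t) (cint a fun x => Et x t) t :=
  hasDerivAt_integral_of_continuous (E := fun x t => cut a x ^ 2 * E x t)
    (Et := fun x t => cut a x ^ 2 * Et x t) (by fun_prop) (by fun_prop)
    (fun x t ht => (hd x t ht).const_mul _) ht

/-- Absorption of a flux term: if `F² ≤ L G` then the cutoff error is controlled by `G`. -/
theorem cint_deriv_le (ha : 0 < a) {F F' G : ℝ → ℝ} {L : ℝ} (hL : 0 < L)
    (hF : ∀ x, HasDerivAt F (F' x) x) (cF' : Continuous F') (cG : Continuous G)
    (h : ∀ x, F x ^ 2 ≤ L * G x) : cint a F' ≤ cint a G + 8 * L / a := by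
  have cF : Continuous F := continuous_iff_continuousAt.2 fun x => (hF x).continuousAt
  have h1 : cint a F' = -∫ x in -a..a, 2 * cut a x * dcut a x * F x :=
    integral_cut_sq_mul_deriv ha hF cF'
  have h2 : -∫ x in -a..a, 2 * cut a x * dcut a x * F x
      ≤ ∫ x in -a..a, (cut a x ^ 2 * G x + dcut a x ^ 2 * L) := by
    rw [← intervalIntegral.integral_neg]
    refine integral_le_of_le (by linarith) (by fun_prop) (by fun_prop) fun x _ => ?_
    have h3 : cut a x ^ 2 * F x ^ 2 ≤ cut a x ^ 2 * (L * G x) :=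
      mul_le_mul_of_nonneg_left (h x) (sq_nonneg _)
    refine le_of_mul_le_mul_left ?_ hL
    nlinarith [sq_nonneg (cut a x * F x + dcut a x * L)]
  rw [intervalIntegral.integral_add (Continuous.intervalIntegrable (by fun_prop) _ _)
    (Continuous.intervalIntegrable (by fun_prop) _ _)] at h2
  have h3 := dint_const_le ha hL.le
  unfold dint at h3
  unfold cint at h1 ⊢
  linarith

end cint

theorem exists_running_sup {g : ℝ → ℝ → ℝ} {c M : ℝ} (cg : Continuous fun p : ℝ × ℝ => g p.1 p.2)
    (hM : 0 ≤ M) (hfar : ∀ x t, M ≤ |x| → g x t ≤ c) :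
    ∃ S : ℝ → ℝ, Continuous S ∧ (∀ t, c ≤ S t) ∧ (∀ x t, g x t ≤ S t) ∧
      ∀ t, S t = c ∨ ∃ x, S t = g x t := by
  have hne : (Icc (-M) M).Nonempty := ⟨0, by simpa using hM⟩
  have hS : Continuous fun t => sSup ((fun x => g x t) '' Icc (-M) M) :=
    isCompact_Icc.continuous_sSup (f := fun t x => g x t) (by
      change Continuous fun p : ℝ × ℝ => g p.2 p.1
      exact cg.comp continuous_swap)
  have hcx : ∀ t, ContinuousOn (fun x => g x t) (Icc (-M) M) := fun t =>
    (cg.comp (continuous_id.prodMk continuous_const)).continuousOn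
  refine ⟨fun t => max c (sSup ((fun x => g x t) '' Icc (-M) M)), by fun_prop,
    fun t => le_max_left _ _, fun x t => ?_, fun t => ?_⟩
  · rcases le_total M |x| with hx | hx
    · exact (hfar x t hx).trans (le_max_left _ _)
    · exact (le_csSup (isCompact_Icc.image_of_continuousOn (hcx t)).bddAbove
        ⟨x, abs_le.1 hx, rfl⟩).trans (le_max_right _ _)
  · obtain ⟨x, -, hx⟩ := isCompact_Icc.exists_sSup_image_eq hne (hcx t)
    rcases max_choice c (sSup ((fun x => g x t) '' Icc (-M) M)) with h | h
    · exact Or.inl h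
    · exact Or.inr ⟨x, h.trans hx⟩

namespace Sol
variable {α β T : ℝ} (s : Sol α β T)

theorem exists_rad : ∃ M : ℝ, 0 ≤ M ∧ ∀ x t, M ≤ |x| →
    |s.v x t - 1| < 1 / 2 ∧ |s.u.f x t| < 1 / 2 ∧ |s.θ.f x t - 1| < 1 / 2 ∧
    |s.b₁.f x t| < 1 / 2 ∧ |s.b₂.f x t| < 1 / 2 ∧ |s.w₁.f x t| < 1 / 2 ∧ |s.w₂.f x t| < 1 / 2 := by
  obtain ⟨M, hM⟩ := s.far (1 / 2) (by norm_num)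
  exact ⟨max M 0, le_max_right _ _, fun x t hx => hM x t ((le_max_left _ _).trans hx)⟩

theorem exists_S : ∃ S : ℝ → ℝ, Continuous S ∧ (∀ t, 2 ≤ S t) ∧ (∀ x t, s.θ.f x t ≤ S t) ∧
    ∀ t, S t = 2 ∨ ∃ x, S t = s.θ.f x t := by
  obtain ⟨M, hM0, hM⟩ := s.exists_rad
  exact exists_running_sup s.θ.cf hM0 fun x t hx => by
    have := abs_lt.1 (hM x t hx).2.2.1
    linarith

theorem exists_B : ∃ B : ℝ → ℝ, Continuous B ∧ (∀ t, 1 ≤ B t) ∧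
    (∀ x t, s.b₁.f x t ^ 2 + s.b₂.f x t ^ 2 ≤ B t) ∧
    ∀ t, B t = 1 ∨ ∃ x, B t = s.b₁.f x t ^ 2 + s.b₂.f x t ^ 2 := by
  obtain ⟨M, hM0, hM⟩ := s.exists_rad
  refine exists_running_sup (g := fun x t => s.b₁.f x t ^ 2 + s.b₂.f x t ^ 2)
    (by fun_prop) hM0 fun x t hx => ?_
  obtain ⟨-, -, -, h1, h2, -⟩ := hM x t hx
  nlinarith [abs_lt.1 h1, abs_lt.1 h2, sq_abs (s.b₁.f x t), sq_abs (s.b₂.f x t),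
    abs_nonneg (s.b₁.f x t), abs_nonneg (s.b₂.f x t)]

/-- The supremum of `max θ 2` in space. -/
def S : ℝ → ℝ := Classical.choose s.exists_S

/-- The supremum of `max |b|² 1` in space. -/
def B : ℝ → ℝ := Classical.choose s.exists_B

@[fun_prop]
theorem continuous_S : Continuous s.S := (Classical.choose_spec s.exists_S).1

theorem two_le_S (t : ℝ) : 2 ≤ s.S t := (Classical.choose_spec s.exists_S).2.1 t

theorem θ_le_S (x t : ℝ) : s.θ.f x t ≤ s.S t := (Classical.choose_spec s.exists_S).2.2.1 x t

theorem S_eq (t : ℝ) : s.S t = 2 ∨ ∃ x, s.S t = s.θ.f x t :=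
  (Classical.choose_spec s.exists_S).2.2.2 t

@[fun_prop]
theorem continuous_B : Continuous s.B := (Classical.choose_spec s.exists_B).1

theorem one_le_B (t : ℝ) : 1 ≤ s.B t := (Classical.choose_spec s.exists_B).2.1 t

theorem b_le_B (x t : ℝ) : s.b₁.f x t ^ 2 + s.b₂.f x t ^ 2 ≤ s.B t :=
  (Classical.choose_spec s.exists_B).2.2.1 x t

theorem B_eq (t : ℝ) : s.B t = 1 ∨ ∃ x, s.B t = s.b₁.f x t ^ 2 + s.b₂.f x t ^ 2 :=
  (Classical.choose_spec s.exists_B).2.2.2 t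

theorem exists_abs_le {g : ℝ → ℝ → ℝ} (cg : Continuous fun p : ℝ × ℝ => g p.1 p.2) {c M : ℝ}
    (hfar : ∀ x t, M ≤ |x| → |g x t| ≤ c) : ∃ L, ∀ x, ∀ t ∈ Icc 0 T, |g x t| ≤ L := by
  obtain ⟨C, hC⟩ := ((isCompact_Icc (a := -M) (b := M)).prod
    (isCompact_Icc (a := 0) (b := T))).exists_bound_of_continuousOn cg.continuousOn
  refine ⟨max c C, fun x t ht => ?_⟩
  rcases le_total M |x| with hx | hx
  · exact (hfar x t hx).trans (le_max_left _ _)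
  · exact (hC (x, t) ⟨abs_le.1 hx, ht⟩).trans (le_max_right _ _)

/-- Qualitative bounds: the solution stays in a compact part of the phase space. -/
structure Box (L : ℝ) : Prop where
  one_le : 1 ≤ L
  v_ge : ∀ x, ∀ t ∈ Icc 0 T, 1 / L ≤ s.v x t
  v_le : ∀ x, ∀ t ∈ Icc 0 T, s.v x t ≤ L
  θ_ge : ∀ x, ∀ t ∈ Icc 0 T, 1 / L ≤ s.θ.f x t
  θ_le : ∀ x, ∀ t ∈ Icc 0 T, s.θ.f x t ≤ L
  u_le : ∀ x, ∀ t ∈ Icc 0 T, |s.u.f x t| ≤ L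
  w₁_le : ∀ x, ∀ t ∈ Icc 0 T, |s.w₁.f x t| ≤ L
  w₂_le : ∀ x, ∀ t ∈ Icc 0 T, |s.w₂.f x t| ≤ L
  b₁_le : ∀ x, ∀ t ∈ Icc 0 T, |s.b₁.f x t| ≤ L
  b₂_le : ∀ x, ∀ t ∈ Icc 0 T, |s.b₂.f x t| ≤ L

theorem exists_box : ∃ L, s.Box L := by
  obtain ⟨M, hM0, hM⟩ := s.exists_rad
  have key : ∀ {g : ℝ → ℝ → ℝ}, (Continuous fun p : ℝ × ℝ => g p.1 p.2) →
      (∀ x t, 0 < g x t) → (∀ x t, M ≤ |x| → |g x t - 1| < 1 / 2) →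
      ∃ L, ∀ x, ∀ t ∈ Icc 0 T, g x t ≤ L ∧ (g x t)⁻¹ ≤ L := by
    intro g cg g0 hg
    obtain ⟨L1, h1⟩ := exists_abs_le (T := T) cg (c := 2) (M := M) fun x t hx => by
      have := abs_lt.1 (hg x t hx)
      rw [abs_of_pos (g0 x t)]; linarith
    obtain ⟨L2, h2⟩ := exists_abs_le (T := T) (g := fun x t => (g x t)⁻¹)
      (cg.inv₀ fun p => (g0 _ _).ne') (c := 2) (M := M) fun x t hx => by
      have := abs_lt.1 (hg x t hx)
      rw [abs_of_pos (inv_pos.2 (g0 x t))]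
      exact inv_le_of_inv_le₀ (by norm_num) (by norm_num; linarith)
    exact ⟨max L1 L2, fun x t ht => ⟨(le_abs_self _).trans ((h1 x t ht).trans (le_max_left _ _)),
      (le_abs_self _).trans ((h2 x t ht).trans (le_max_right _ _))⟩⟩
  obtain ⟨L1, h1⟩ := key s.cv s.v_pos fun x t hx => (hM x t hx).1
  obtain ⟨L2, h2⟩ := key s.θ.cf s.θ_pos fun x t hx => (hM x t hx).2.2.1
  obtain ⟨L3, h3⟩ := exists_abs_le (T := T) s.u.cf fun x t hx => (hM x t hx).2.1.le
  obtain ⟨L4, h4⟩ := exists_abs_le (T := T) s.b₁.cf fun x t hx => (hM x t hx).2.2.2.1.le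
  obtain ⟨L5, h5⟩ := exists_abs_le (T := T) s.b₂.cf fun x t hx => (hM x t hx).2.2.2.2.1.le
  obtain ⟨L6, h6⟩ := exists_abs_le (T := T) s.w₁.cf fun x t hx => (hM x t hx).2.2.2.2.2.1.le
  obtain ⟨L7, h7⟩ := exists_abs_le (T := T) s.w₂.cf fun x t hx => (hM x t hx).2.2.2.2.2.2.le
  have hL : ∃ L, 1 ≤ L ∧ L1 ≤ L ∧ L2 ≤ L ∧ L3 ≤ L ∧ L4 ≤ L ∧ L5 ≤ L ∧ L6 ≤ L ∧ L7 ≤ L := by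
    refine ⟨1 + |L1| + |L2| + |L3| + |L4| + |L5| + |L6| + |L7|, ?_⟩
    have := abs_nonneg L1; have := abs_nonneg L2; have := abs_nonneg L3; have := abs_nonneg L4
    have := abs_nonneg L5; have := abs_nonneg L6; have := abs_nonneg L7
    refine ⟨?_, ?_, ?_, ?_, ?_, ?_, ?_, ?_⟩ <;>
    linarith [le_abs_self L1, le_abs_self L2, le_abs_self L3, le_abs_self L4, le_abs_self L5,
      le_abs_self L6, le_abs_self L7]
  obtain ⟨L, l0, l1, l2, l3, l4, l5, l6, l7⟩ := hL
  have hi : ∀ {z : ℝ}, 0 < z → z⁻¹ ≤ L → 1 / L ≤ z := fun hz h => by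
    rw [one_div]; exact inv_le_of_inv_le₀ hz h
  exact ⟨L, l0, fun x t ht => hi (s.v_pos x t) ((h1 x t ht).2.trans l1),
    fun x t ht => (h1 x t ht).1.trans l1, fun x t ht => hi (s.θ_pos x t) ((h2 x t ht).2.trans l2),
    fun x t ht => (h2 x t ht).1.trans l2, fun x t ht => (h3 x t ht).trans l3,
    fun x t ht => (h6 x t ht).trans l6, fun x t ht => (h7 x t ht).trans l7,
    fun x t ht => (h4 x t ht).trans l4, fun x t ht => (h5 x t ht).trans l5⟩

end Sol

theorem rpow_le_of_mem_box {L z : ℝ} (hL : 1 ≤ L) (h1 : 1 / L ≤ z) (h2 : z ≤ L) (p : ℝ) :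
    z ^ p ≤ L ^ |p| := by
  have hL0 : 0 < L := by linarith
  have hz : 0 < z := lt_of_lt_of_le (by positivity) h1
  rcases le_total 0 p with hp | hp
  · rw [abs_of_nonneg hp]; exact Real.rpow_le_rpow hz.le h2 hp
  · rw [abs_of_nonpos hp, ← neg_neg p, Real.rpow_neg_eq_inv_rpow, neg_neg]
    exact Real.rpow_le_rpow (inv_nonneg.2 hz.le)
      (inv_le_of_inv_le₀ hL0 (by rwa [one_div] at h1)) (by linarith)

/-- Two-sided bound of a real power on `[1/L, L]`. -/
theorem exists_rpow_bound {L : ℝ} (hL : 1 ≤ L) (p : ℝ) :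
    ∃ Q, 1 ≤ Q ∧ ∀ z, 1 / L ≤ z → z ≤ L → z ^ p ≤ Q ∧ 1 / Q ≤ z ^ p := by
  have hL0 : 0 < L := by linarith
  refine ⟨L ^ |p|, Real.one_le_rpow hL (abs_nonneg p), fun z h1 h2 =>
    ⟨rpow_le_of_mem_box hL h1 h2 p, ?_⟩⟩
  have hz : 0 < z := lt_of_lt_of_le (by positivity) h1
  have h := rpow_le_of_mem_box hL h1 h2 (-p)
  rw [abs_neg, Real.rpow_neg hz.le] at h
  rw [one_div]
  exact inv_le_of_inv_le₀ (Real.rpow_pos_of_pos hz p) h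

theorem exists_kap_bound {α L : ℝ} (hα : 0 ≤ α) (hL : 1 ≤ L) :
    ∃ Q, 1 ≤ Q ∧ ∀ z, 1 / L ≤ z → z ≤ L → kap α z ≤ Q ∧ 1 / Q ≤ kap α z ∧ |dkap α z| ≤ Q := by
  have hL0 : 0 < L := by linarith
  obtain ⟨Q1, q1, h1⟩ := exists_rpow_bound hL (-α - 1)
  obtain ⟨Q2, q2, h2⟩ := exists_rpow_bound hL (-α - 2)
  refine ⟨L ^ 2 + α * Q1 + α * (α + 1) * Q2, ?_, fun z hz hz' => ?_⟩
  · have : 0 ≤ α * Q1 + α * (α + 1) * Q2 := by positivity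
    nlinarith
  have hz0 : 0 < z := lt_of_lt_of_le (by positivity) hz
  have hi : z⁻¹ ≤ L := inv_le_of_inv_le₀ hL0 (by rwa [one_div] at hz)
  have hi0 : 0 < z⁻¹ := inv_pos.2 hz0
  obtain ⟨a1, b1⟩ := h1 z hz hz'
  obtain ⟨a2, b2⟩ := h2 z hz hz'
  have r1 := Real.rpow_pos_of_pos hz0 (-α - 1)
  have r2 := Real.rpow_pos_of_pos hz0 (-α - 2)
  have m1 : α * z ^ (-α - 1) ≤ α * Q1 := mul_le_mul_of_nonneg_left a1 hα
  have m2 : α * (α + 1) * z ^ (-α - 2) ≤ α * (α + 1) * Q2 :=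
    mul_le_mul_of_nonneg_left a2 (by positivity)
  have p1 : 0 ≤ α * z ^ (-α - 1) := by positivity
  have p2 : 0 ≤ α * (α + 1) * z ^ (-α - 2) := by positivity
  have p3 : 0 ≤ α * Q1 := by positivity
  have p4 : 0 ≤ α * (α + 1) * Q2 := by positivity
  refine ⟨?_, ?_, ?_⟩
  · unfold kap; nlinarith
  · unfold kap
    have : 1 / (L ^ 2 + α * Q1 + α * (α + 1) * Q2) ≤ 1 / L :=
      one_div_le_one_div_of_le hL0 (by nlinarith)
    have h3 : 1 / L ≤ z⁻¹ := by rw [one_div]; exact inv_anti₀ hz0 hz'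
    linarith
  · have e : dkap α z = -((z⁻¹) ^ 2 + α * (α + 1) * z ^ (-α - 2)) := by
      unfold dkap; rw [inv_pow]; ring
    rw [e, abs_neg, abs_of_nonneg (by positivity)]
    nlinarith

theorem inv_le_kap {α z : ℝ} (hα : 0 ≤ α) (hz : 0 < z) : z⁻¹ ≤ kap α z := by
  have := mul_nonneg hα (Real.rpow_nonneg hz.le (-α - 1))
  unfold kap; linarith

theorem kap_pos {α z : ℝ} (hα : 0 ≤ α) (hz : 0 < z) : 0 < kap α z :=
  (inv_pos.2 hz).trans_le (inv_le_kap hα hz)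

theorem sum_nine_sq_le {C : ℝ} {c₁ c₂ c₃ c₄ c₅ c₆ c₇ c₈ c₉ : ℝ} (h₁ : |c₁| ≤ C) (h₂ : |c₂| ≤ C)
    (h₃ : |c₃| ≤ C) (h₄ : |c₄| ≤ C) (h₅ : |c₅| ≤ C) (h₆ : |c₆| ≤ C) (h₇ : |c₇| ≤ C)
    (h₈ : |c₈| ≤ C) (h₉ : |c₉| ≤ C) (y₁ y₂ y₃ y₄ y₅ y₆ y₇ y₈ y₉ : ℝ) :
    (c₁ * y₁ + c₂ * y₂ + c₃ * y₃ + c₄ * y₄ + c₅ * y₅ + c₆ * y₆ + c₇ * y₇ + c₈ * y₈ + c₉ * y₉) ^ 2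
      ≤ 9 * C ^ 2 * (y₁ ^ 2 + y₂ ^ 2 + y₃ ^ 2 + y₄ ^ 2 + y₅ ^ 2 + y₆ ^ 2 + y₇ ^ 2 + y₈ ^ 2
        + y₉ ^ 2) := by
  have h := sq_sum_le_card_mul_sum_sq (s := Finset.univ)
    (f := ![c₁ * y₁, c₂ * y₂, c₃ * y₃, c₄ * y₄, c₅ * y₅, c₆ * y₆, c₇ * y₇, c₈ * y₈, c₉ * y₉])
  have e : ∀ {c : ℝ} (y : ℝ), |c| ≤ C → (c * y) ^ 2 ≤ C ^ 2 * y ^ 2 := fun y hc => by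
    rw [mul_pow]
    exact mul_le_mul_of_nonneg_right (sq_le_sq' (abs_le.1 hc).1 (abs_le.1 hc).2) (sq_nonneg y)
  simp [Fin.sum_univ_succ] at h
  have := e y₁ h₁; have := e y₂ h₂; have := e y₃ h₃; have := e y₄ h₄; have := e y₅ h₅
  have := e y₆ h₆; have := e y₇ h₇; have := e y₈ h₈; have := e y₉ h₉
  ring_nf at *
  linarith

namespace Sol
variable {α β T : ℝ} (s : Sol α β T)

/-- Energy density with thermal part `H θ`. -/
def en (H : ℝ → ℝ) (x t : ℝ) : ℝ :=
  (s.u.f x t ^ 2 + s.w₁.f x t ^ 2 + s.w₂.f x t ^ 2) / 2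
    + s.v x t * (s.b₁.f x t ^ 2 + s.b₂.f x t ^ 2) / 2 + H (s.θ.f x t)

/-- Dissipation of the energy whose thermal part has derivative `1 - z ^ (-p)`. -/
def diss (p x t : ℝ) : ℝ :=
  p * s.θ.f x t ^ (β - 1 - p) * s.θ.x x t ^ 2 / s.v x t
    + (kap α (s.v x t) * s.u.x x t ^ 2
      + (s.w₁.x x t ^ 2 + s.w₂.x x t ^ 2 + s.b₁.x x t ^ 2 + s.b₂.x x t ^ 2) / s.v x t)
      * s.θ.f x t ^ (-p)

/-- Source term in the energy identity. -/
def src (p x t : ℝ) : ℝ := s.u.x x t * (s.θ.f x t ^ (1 - p) / s.v x t - 1)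

/-- Time derivative of the energy density. -/
def ent (p x t : ℝ) : ℝ :=
  s.u.f x t * s.u.t x t + s.w₁.f x t * s.w₁.t x t + s.w₂.f x t * s.w₂.t x t
    + s.u.x x t * (s.b₁.f x t ^ 2 + s.b₂.f x t ^ 2) / 2
    + s.v x t * (s.b₁.f x t * s.b₁.t x t + s.b₂.f x t * s.b₂.t x t)
    + (1 - s.θ.f x t ^ (-p)) * s.θ.t x t

/-- Energy flux. -/
def flux (p x t : ℝ) : ℝ :=
  -(s.θ.f x t / s.v x t + (s.b₁.f x t ^ 2 + s.b₂.f x t ^ 2) / 2 - 1) * s.u.f x t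
    + s.b₁.f x t * s.w₁.f x t + s.b₂.f x t * s.w₂.f x t
    + kap α (s.v x t) * s.u.f x t * s.u.x x t
    + s.w₁.f x t / s.v x t * s.w₁.x x t + s.w₂.f x t / s.v x t * s.w₂.x x t
    + s.b₁.f x t / s.v x t * s.b₁.x x t + s.b₂.f x t / s.v x t * s.b₂.x x t
    + (1 - s.θ.f x t ^ (-p)) * s.θ.f x t ^ β / s.v x t * s.θ.x x t

theorem hasDerivAt_flux (p x t : ℝ) :
    HasDerivAt (fun y => s.flux p y t) (s.ent p x t - s.src p x t + s.diss p x t) x := by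
  have hv := s.hvx x t
  have hv0 := s.v_pos x t
  have hθ0 := s.θ_pos x t
  have hk := hv.kap_comp α hv0
  have h := (((((((((((s.θ.hx x t).div hv hv0.ne').add
    ((((s.b₁.hx x t).pow 2).add ((s.b₂.hx x t).pow 2)).div_const 2)).sub_const 1).neg.mul
      (s.u.hx x t)).add ((s.b₁.hx x t).mul (s.w₁.hx x t))).add
      ((s.b₂.hx x t).mul (s.w₂.hx x t))).add ((hk.mul (s.u.hx x t)).mul (s.u.hxx x t))).add
      (((s.w₁.hx x t).div hv hv0.ne').mul (s.w₁.hxx x t))).add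
      (((s.w₂.hx x t).div hv hv0.ne').mul (s.w₂.hxx x t))).add
      (((s.b₁.hx x t).div hv hv0.ne').mul (s.b₁.hxx x t))).add
      (((s.b₂.hx x t).div hv hv0.ne').mul (s.b₂.hxx x t))
  have h2 := (((((s.θ.hx x t).rpow_const (p := -p) (Or.inl hθ0.ne')).const_sub 1).mul
    ((s.θ.hx x t).rpow_const (p := β) (Or.inl hθ0.ne'))).div hv hv0.ne').mul (s.θ.hxx x t)
  refine (h.add h2).congr_deriv ?_
  have e1 := s.mom x t
  have e2 := s.eqw₁ x t
  have e3 := s.eqw₂ x t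
  have e4 : s.b₁.t x t = _ := (eq_div_iff hv0.ne').2
    ((mul_comm _ _).trans (eq_sub_of_add_eq (s.eqb₁ x t)))
  have e5 : s.b₂.t x t = _ := (eq_div_iff hv0.ne').2
    ((mul_comm _ _).trans (eq_sub_of_add_eq (s.eqb₂ x t)))
  have e6 := s.temp x t
  simp only [Pi.mul_apply, Pi.add_apply, Pi.neg_apply, Pi.div_apply, Pi.pow_apply]
  unfold ent src diss
  rw [e1, e2, e3, e4, e5, e6, Real.rpow_sub hθ0 (β - 1), Real.rpow_sub hθ0 β,
    Real.rpow_sub hθ0 (-p), Real.rpow_sub hθ0 1, Real.rpow_neg hθ0.le, Real.rpow_one]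
  have hP := (Real.rpow_pos_of_pos hθ0 p).ne'
  field_simp
  ring

theorem hasDerivAt_en {H : ℝ → ℝ} {p : ℝ} (hH : ∀ z, 0 < z → HasDerivAt H (1 - z ^ (-p)) z)
    (x : ℝ) {t : ℝ} (ht : t ∈ Ioo 0 T) :
    HasDerivAt (fun r => s.en H x r) (s.ent p x t) t := by
  have h := (((((s.u.ht x t ht).pow 2).add ((s.w₁.ht x t ht).pow 2)).add
    ((s.w₂.ht x t ht).pow 2)).div_const 2).add (((s.hvt x t ht).mul
      (((s.b₁.ht x t ht).pow 2).add ((s.b₂.ht x t ht).pow 2))).div_const 2)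
  refine (h.add (HasDerivAt.comp (h₂ := H) t (hH _ (s.θ_pos x t)) (s.θ.ht x t ht))).congr_deriv ?_
  simp only [Pi.add_apply, Pi.pow_apply]
  unfold ent
  ring

theorem continuous_H {H H' : ℝ → ℝ} (hH : ∀ z, 0 < z → HasDerivAt H (H' z) z) :
    Continuous fun q : ℝ × ℝ => H (s.θ.f q.1 q.2) :=
  continuous_iff_continuousAt.2 fun _ =>
    ContinuousAt.comp (g := H) (hH _ (s.θ_pos _ _)).continuousAt s.θ.cf.continuousAt

theorem continuous_en {H H' : ℝ → ℝ} (hH : ∀ z, 0 < z → HasDerivAt H (H' z) z) :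
    Continuous fun q : ℝ × ℝ => s.en H q.1 q.2 := by
  have h := s.continuous_H hH
  unfold en
  exact Continuous.add (by fun_prop) h

variable {X : Type*} [TopologicalSpace X]

@[fun_prop]
theorem continuous_diss (p : ℝ) {g h : X → ℝ} (hg : Continuous g) (hh : Continuous h) :
    Continuous fun z => s.diss p (g z) (h z) := by
  unfold diss
  fun_prop (disch := simp)

@[fun_prop]
theorem continuous_src (p : ℝ) {g h : X → ℝ} (hg : Continuous g) (hh : Continuous h) :
    Continuous fun z => s.src p (g z) (h z) := by
  unfold src
  fun_prop (disch := simp)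

@[fun_prop]
theorem continuous_ent (p : ℝ) {g h : X → ℝ} (hg : Continuous g) (hh : Continuous h) :
    Continuous fun z => s.ent p (g z) (h z) := by
  unfold ent
  fun_prop (disch := simp)

theorem diss_nonneg (hα : 0 ≤ α) {p : ℝ} (hp : 0 ≤ p) (x t : ℝ) : 0 ≤ s.diss p x t := by
  have := s.v_pos x t
  have := kap_pos hα this
  have := Real.rpow_pos_of_pos (s.θ_pos x t) (-p)
  have := Real.rpow_pos_of_pos (s.θ_pos x t) (β - 1 - p)
  unfold diss
  positivity

theorem kinetic_le_en {H : ℝ → ℝ} (hH : ∀ z, 0 < z → 0 ≤ H z) (x t : ℝ) :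
    (s.u.f x t ^ 2 + s.w₁.f x t ^ 2 + s.w₂.f x t ^ 2) / 2 ≤ s.en H x t := by
  have := s.v_pos x t
  have := hH _ (s.θ_pos x t)
  have : 0 ≤ s.v x t * (s.b₁.f x t ^ 2 + s.b₂.f x t ^ 2) / 2 := by positivity
  unfold en
  linarith

theorem exists_grad_le_diss (hα : 0 ≤ α) {p : ℝ} (hp : 0 < p) : ∃ L, 1 ≤ L ∧ ∀ x, ∀ t ∈ Icc 0 T,
    s.u.x x t ^ 2 + s.w₁.x x t ^ 2 + s.w₂.x x t ^ 2 + s.b₁.x x t ^ 2 + s.b₂.x x t ^ 2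
      + s.θ.x x t ^ 2 ≤ L * s.diss p x t := by
  obtain ⟨L, hL⟩ := s.exists_box
  have l1 := hL.one_le
  obtain ⟨Q1, q1, h1⟩ := exists_rpow_bound l1 (β - 1 - p)
  obtain ⟨Q2, q2, h2⟩ := exists_rpow_bound l1 (-p)
  have hL0 : 0 < L := by linarith
  have hQ1 : 0 < Q1 := by linarith
  have hQ2 : 0 < Q2 := by linarith
  refine ⟨L * Q1 / p + L * Q2, ?_, fun x t ht => ?_⟩
  · have : 0 ≤ L * Q1 / p := by positivity
    nlinarith
  have hv0 := s.v_pos x t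
  have a1 := (h1 _ (hL.θ_ge x t ht) (hL.θ_le x t ht)).2
  have a2 := (h2 _ (hL.θ_ge x t ht) (hL.θ_le x t ht)).2
  have hv : 1 / L ≤ (s.v x t)⁻¹ := by
    rw [one_div]; exact inv_anti₀ hv0 (hL.v_le x t ht)
  have hk := hv.trans (inv_le_kap hα hv0)
  have r1 := Real.rpow_nonneg (s.θ_pos x t).le (β - 1 - p)
  have t1 : (1 / Q1 * (1 / L)) * (p * s.θ.x x t ^ 2)
      ≤ p * s.θ.f x t ^ (β - 1 - p) * s.θ.x x t ^ 2 / s.v x t := by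
    have : 1 / Q1 * (1 / L) ≤ s.θ.f x t ^ (β - 1 - p) * (s.v x t)⁻¹ := by gcongr
    calc _ ≤ (s.θ.f x t ^ (β - 1 - p) * (s.v x t)⁻¹) * (p * s.θ.x x t ^ 2) := by gcongr
      _ = _ := by ring
  have t2 : (1 / L * (s.u.x x t ^ 2 + s.w₁.x x t ^ 2 + s.w₂.x x t ^ 2 + s.b₁.x x t ^ 2
      + s.b₂.x x t ^ 2)) * (1 / Q2) ≤ (kap α (s.v x t) * s.u.x x t ^ 2
      + (s.w₁.x x t ^ 2 + s.w₂.x x t ^ 2 + s.b₁.x x t ^ 2 + s.b₂.x x t ^ 2) / s.v x t)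
      * s.θ.f x t ^ (-p) := by
    have : 1 / L * (s.u.x x t ^ 2 + s.w₁.x x t ^ 2 + s.w₂.x x t ^ 2 + s.b₁.x x t ^ 2
      + s.b₂.x x t ^ 2) ≤ kap α (s.v x t) * s.u.x x t ^ 2
      + (s.w₁.x x t ^ 2 + s.w₂.x x t ^ 2 + s.b₁.x x t ^ 2 + s.b₂.x x t ^ 2) / s.v x t := by
      have k1 := mul_le_mul_of_nonneg_right hk (sq_nonneg (s.u.x x t))
      have k2 := mul_le_mul_of_nonneg_right hv (by positivity : 0 ≤ s.w₁.x x t ^ 2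
        + s.w₂.x x t ^ 2 + s.b₁.x x t ^ 2 + s.b₂.x x t ^ 2)
      rw [← div_eq_inv_mul] at k2
      linarith
    gcongr
    exact le_trans (by positivity) this
  unfold diss
  set A := p * s.θ.f x t ^ (β - 1 - p) * s.θ.x x t ^ 2 / s.v x t
  set E := (kap α (s.v x t) * s.u.x x t ^ 2
      + (s.w₁.x x t ^ 2 + s.w₂.x x t ^ 2 + s.b₁.x x t ^ 2 + s.b₂.x x t ^ 2) / s.v x t)
      * s.θ.f x t ^ (-p)
  have t1' : s.θ.x x t ^ 2 ≤ L * Q1 / p * A := by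
    calc _ = L * Q1 / p * ((1 / Q1 * (1 / L)) * (p * s.θ.x x t ^ 2)) := by field_simp
      _ ≤ _ := by gcongr
  have t2' : s.u.x x t ^ 2 + s.w₁.x x t ^ 2 + s.w₂.x x t ^ 2 + s.b₁.x x t ^ 2 + s.b₂.x x t ^ 2
      ≤ L * Q2 * E := by
    calc _ = L * Q2 * ((1 / L * (s.u.x x t ^ 2 + s.w₁.x x t ^ 2 + s.w₂.x x t ^ 2
      + s.b₁.x x t ^ 2 + s.b₂.x x t ^ 2)) * (1 / Q2)) := by field_simp
      _ ≤ _ := by gcongr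
  have A0 : 0 ≤ A := le_trans (by positivity) t1
  have E0 : 0 ≤ E := le_trans (by positivity) t2
  have m1 : 0 ≤ L * Q1 / p * E := by positivity
  have m2 : 0 ≤ L * Q2 * A := by positivity
  nlinarith

theorem exists_flux_sq_le (hα : 0 ≤ α) {p : ℝ} (hp : 0 < p) {H : ℝ → ℝ}
    (hH : ∀ z, 0 < z → 0 ≤ H z) : ∃ L, 0 < L ∧ ∀ x, ∀ t ∈ Icc 0 T,
      s.flux p x t ^ 2 ≤ L * (s.diss p x t / 2 + s.en H x t) := by
  obtain ⟨M, m1, hM⟩ := s.exists_grad_le_diss hα hp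
  obtain ⟨L, hL⟩ := s.exists_box
  have l1 := hL.one_le
  obtain ⟨Q1, q1, h1⟩ := exists_rpow_bound l1 β
  obtain ⟨Q2, q2, h2⟩ := exists_rpow_bound l1 (-p)
  obtain ⟨Q3, q3, h3⟩ := exists_kap_bound hα l1
  have hL0 : 0 < L := by linarith
  have hQ2 : 0 < Q2 := by linarith
  have hQ1 : 0 < Q1 := by linarith
  obtain ⟨C, pL, pL2, pA, pB⟩ : ∃ C, L ≤ C ∧ 2 * L ^ 2 + 1 ≤ C ∧ Q3 * L ≤ C ∧
      (1 + Q2) * Q1 * L ≤ C := by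
    have pA : 0 ≤ Q3 * L := by positivity
    have pB : 0 ≤ (1 + Q2) * Q1 * L := by positivity
    refine ⟨2 * L ^ 2 + 1 + Q3 * L + (1 + Q2) * Q1 * L, ?_, ?_, ?_, ?_⟩ <;> nlinarith
  have C0 : 0 < C := by linarith
  refine ⟨9 * C ^ 2 * (2 * M + 2), by positivity, fun x t ht => ?_⟩
  have hv0 := s.v_pos x t
  have hθ0 := s.θ_pos x t
  have hvi : (s.v x t)⁻¹ ≤ L :=
    inv_le_of_inv_le₀ hL0 (by rw [← one_div]; exact hL.v_ge x t ht)
  have hvi0 : 0 < (s.v x t)⁻¹ := inv_pos.2 hv0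
  obtain ⟨k1, k2, -⟩ := h3 _ (hL.v_ge x t ht) (hL.v_le x t ht)
  have a1 := (h1 _ (hL.θ_ge x t ht) (hL.θ_le x t ht)).1
  have a2 := (h2 _ (hL.θ_ge x t ht) (hL.θ_le x t ht)).1
  have p1 := Real.rpow_pos_of_pos hθ0 β
  have p2 := Real.rpow_pos_of_pos hθ0 (-p)
  have hk := kap_pos hα hv0
  have hdiv : ∀ {z : ℝ}, |z| ≤ L → |z / s.v x t| ≤ C := fun {z} hz => by
    rw [div_eq_mul_inv, abs_mul, abs_of_pos hvi0]
    have : |z| * (s.v x t)⁻¹ ≤ L * L := by gcongr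
    nlinarith only [this, pL2, sq_nonneg L]
  have hb : ∀ {z : ℝ}, |z| ≤ L → |z| ≤ C := fun hz => by linarith
  have hb1 := hL.b₁_le x t ht
  have hb2 := hL.b₂_le x t ht
  have c1 : |-(s.θ.f x t / s.v x t + (s.b₁.f x t ^ 2 + s.b₂.f x t ^ 2) / 2 - 1)| ≤ C := by
    have e1 : s.θ.f x t / s.v x t ≤ L * L := by
      rw [div_eq_mul_inv]; gcongr; exact hL.θ_le x t ht
    have e0 : 0 < s.θ.f x t / s.v x t := by positivity
    have e2 : s.b₁.f x t ^ 2 ≤ L ^ 2 := sq_le_sq' (abs_le.1 hb1).1 (abs_le.1 hb1).2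
    have e3 : s.b₂.f x t ^ 2 ≤ L ^ 2 := sq_le_sq' (abs_le.1 hb2).1 (abs_le.1 hb2).2
    rw [abs_neg, abs_le]
    constructor <;>
      nlinarith only [sq_nonneg (s.b₁.f x t), sq_nonneg (s.b₂.f x t), e1, e0, e2, e3, pL2]
  have c4 : |kap α (s.v x t) * s.u.f x t| ≤ C := by
    rw [abs_mul, abs_of_pos hk]
    have : kap α (s.v x t) * |s.u.f x t| ≤ Q3 * L := by gcongr; exact hL.u_le x t ht
    linarith
  have c9 : |(1 - s.θ.f x t ^ (-p)) * s.θ.f x t ^ β / s.v x t| ≤ C := by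
    rw [div_eq_mul_inv, abs_mul, abs_mul, abs_of_pos hvi0, abs_of_pos p1]
    have : |1 - s.θ.f x t ^ (-p)| ≤ 1 + Q2 := by
      rw [abs_le]; constructor <;> linarith
    have : |1 - s.θ.f x t ^ (-p)| * s.θ.f x t ^ β * (s.v x t)⁻¹ ≤ (1 + Q2) * Q1 * L := by gcongr
    linarith
  have key := sum_nine_sq_le c1 (hb hb1) (hb hb2) c4 (hdiv (hL.w₁_le x t ht))
    (hdiv (hL.w₂_le x t ht)) (hdiv hb1) (hdiv hb2) c9 (s.u.f x t) (s.w₁.f x t) (s.w₂.f x t)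
    (s.u.x x t) (s.w₁.x x t) (s.w₂.x x t) (s.b₁.x x t) (s.b₂.x x t) (s.θ.x x t)
  refine key.trans ?_
  rw [mul_assoc (9 * C ^ 2)]
  refine mul_le_mul_of_nonneg_left ?_ (by positivity)
  have g1 := hM x t ht
  have g2 := s.kinetic_le_en hH x t
  have g3 := s.diss_nonneg hα hp.le x t
  have g4 : 0 ≤ s.en H x t := le_trans (by positivity) g2
  have g5 : 0 ≤ M * s.en H x t := by positivity
  nlinarith only [g1, g2, g3, g4, g5]

/-- Localised energy inequality. -/
theorem energy_ineq (hα : 0 ≤ α) {p : ℝ} (hp : 0 < p) {H : ℝ → ℝ}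
    (hH : ∀ z, 0 < z → HasDerivAt H (1 - z ^ (-p)) z) (hH0 : ∀ z, 0 < z → 0 ≤ H z) :
    ∀ᶠ a in atTop, ∀ t ∈ Ioo 0 T,
      HasDerivAt (fun t => cint a fun x => s.en H x t) (cint a fun x => s.ent p x t) t ∧
      (cint a fun x => s.ent p x t) + (cint a fun x => s.diss p x t) / 2
        ≤ (cint a fun x => s.en H x t) + 1 + cint a fun x => s.src p x t := by
  obtain ⟨L, hL0, hL⟩ := s.exists_flux_sq_le hα hp hH0
  have ce := s.continuous_en hH
  filter_upwards [eventually_ge_atTop (max 1 (8 * L))] with a ha t ht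
  have ha1 : 1 ≤ a := (le_max_left _ _).trans ha
  have ha0 : 0 < a := by linarith
  have ht' := Ioo_subset_Icc_self ht
  have hce : Continuous fun x => s.en H x t := ce.comp (by fun_prop : Continuous fun x => (x, t))
  refine ⟨hasDerivAt_cint ce (by fun_prop) (fun x t ht => s.hasDerivAt_en hH x ht) ht, ?_⟩
  have h := cint_deriv_le ha0 hL0 (F := fun x => s.flux p x t)
    (G := fun x => 1 / 2 * s.diss p x t + s.en H x t)
    (fun x => s.hasDerivAt_flux p x t) (by fun_prop) (by fun_prop)
    (fun x => by have := hL x t ht'; simp only [one_div]; linarith)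
  rw [cint_add (f := fun x => 1 / 2 * s.diss p x t) (by fun_prop) hce, cint_const_mul,
    cint_add (f := fun x => s.ent p x t - s.src p x t) (by fun_prop) (by fun_prop),
    cint_sub (by fun_prop) (by fun_prop)] at h
  have : 8 * L / a ≤ 1 := by
    rw [div_le_one ha0]; exact (le_max_right _ _).trans ha
  linarith

end Sol

/-- The relative entropy density `z - 1 - log z`. -/
def gd (z : ℝ) : ℝ := z - 1 - Real.log z

theorem gd_nonneg {z : ℝ} (hz : 0 < z) : 0 ≤ gd z := by
  have := Real.log_le_sub_one_of_pos hz
  unfold gd; linarith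

theorem hasDerivAt_gd {z : ℝ} (hz : 0 < z) : HasDerivAt gd (1 - z ^ (-(1:ℝ))) z := by
  have h := ((hasDerivAt_id z).sub_const 1).sub (Real.hasDerivAt_log hz.ne')
  refine h.congr_deriv ?_
  rw [Real.rpow_neg_one]

theorem sqrt_sub_one_sq_le_gd {z : ℝ} (hz : 0 < z) : (√z - 1) ^ 2 ≤ gd z := by
  have h1 := Real.log_le_sub_one_of_pos (Real.sqrt_pos.2 hz)
  rw [Real.log_sqrt hz.le] at h1
  have h2 := Real.sq_sqrt hz.le
  unfold gd; nlinarith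

theorem sq_sub_one_le_gd {z : ℝ} (hz : 0 < z) : (z - 1) ^ 2 ≤ 2 * (z + 1) * gd z := by
  have h1 := sqrt_sub_one_sq_le_gd hz
  have h2 := Real.sq_sqrt hz.le
  have h3 : (√z + 1) ^ 2 ≤ 2 * (z + 1) := by nlinarith [sq_nonneg (√z - 1)]
  calc (z - 1) ^ 2 = (√z + 1) ^ 2 * (√z - 1) ^ 2 := by
        rw [← mul_pow]; congr 1; linear_combination -h2
    _ ≤ _ := mul_le_mul h3 h1 (sq_nonneg _) (by positivity)

theorem le_two_mul_gd {z : ℝ} (hz : 0 < z) : z ≤ 2 * gd z + 2 := by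
  have h1 := sqrt_sub_one_sq_le_gd hz
  have h2 := Real.sq_sqrt hz.le
  nlinarith [sq_nonneg (√z - 2)]

theorem gd_le {δ z : ℝ} (hδ : 0 < δ) (hz : δ ≤ z) : gd z ≤ (z - 1) ^ 2 / δ := by
  have hz0 : 0 < z := by linarith
  have h1 := Real.one_sub_inv_le_log_of_pos hz0
  calc gd z ≤ (z - 1) ^ 2 / z := by
        have : (z - 1) ^ 2 / z = z - 2 + z⁻¹ := by field_simp; ring
        rw [this]; unfold gd; linarith
    _ ≤ _ := by gcongr

namespace Sol
variable {α β T : ℝ} (s : Sol α β T)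

theorem cont_slice {f : ℝ → ℝ → ℝ} (hf : Continuous fun p : ℝ × ℝ => f p.1 p.2) (t : ℝ) :
    Continuous fun x => f x t := hf.comp (by fun_prop : Continuous fun x : ℝ => (x, t))

theorem continuous_initDensity : Continuous s.initDensity := by
  unfold initDensity; fun_prop

theorem initDensity_nonneg (x : ℝ) : 0 ≤ s.initDensity x := by unfold initDensity; positivity

variable {s} {K δ : ℝ}

theorem Init.cell_le (h : s.Init K δ) (x : ℝ) : ∫ y in x..(x + 1), s.initDensity y ≤ K ^ 2 := by
  refine le_trans ?_ (h.bound (|x| + 1) (by positivity))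
  exact integral_le_of_subset s.continuous_initDensity (by have := neg_abs_le x; linarith)
    (by linarith) (by have := le_abs_self x; linarith) fun y _ => s.initDensity_nonneg y

theorem Init.sq_le (h : s.Init K δ) {g gx : ℝ → ℝ} (hg : ∀ x, HasDerivAt g (gx x) x)
    (cgx : Continuous gx) (hle : ∀ x, g x ^ 2 + gx x ^ 2 ≤ s.initDensity x) (x : ℝ) :
    g x ^ 2 ≤ 2 * K ^ 2 := by
  have cg : Continuous g := continuous_iff_continuousAt.2 fun x => (hg x).continuousAt
  obtain ⟨y, hy, hy'⟩ := exists_le_integral_cell (f := fun x => g x ^ 2) (by fun_prop) x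
  have h1 := sub_le_integral_cell (g := fun x => g x ^ 2) (gx := fun x => 2 * g x * gx x)
    (m := s.initDensity) (z := x) (x := x) (y := y)
    (fun x => ((hg x).pow 2).congr_deriv (by simp)) (by fun_prop) s.continuous_initDensity
    ⟨le_rfl, by linarith⟩ hy (fun z _ => by
      have := hle z
      rw [abs_le]; constructor <;> nlinarith [sq_nonneg (g z - gx z), sq_nonneg (g z + gx z)])
  have h2 : ∫ y in x..(x + 1), g y ^ 2 ≤ ∫ y in x..(x + 1), s.initDensity y :=
    integral_le_of_le (by linarith) (by fun_prop) s.continuous_initDensity fun z _ => by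
      have := hle z; nlinarith [sq_nonneg (gx z)]
  have := h.cell_le x
  linarith

theorem Init.v_le (h : s.Init K δ) (x : ℝ) : s.v x 0 ≤ 2 + 2 * K ^ 2 := by
  have := h.sq_le (g := fun x => s.v x 0 - 1) (fun x => (s.hvx x 0).sub_const 1) (by fun_prop)
    (fun x => by
      have : 0 ≤ s.u.f x 0 ^ 2 + (s.θ.f x 0 - 1) ^ 2
        + (s.b₁.f x 0 ^ 2 + s.b₂.f x 0 ^ 2) + (s.w₁.f x 0 ^ 2 + s.w₂.f x 0 ^ 2)
        + s.u.x x 0 ^ 2 + s.θ.x x 0 ^ 2 + (s.b₁.x x 0 ^ 2 + s.b₂.x x 0 ^ 2)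
        + (s.w₁.x x 0 ^ 2 + s.w₂.x x 0 ^ 2) := by positivity
      unfold initDensity
      linarith) x
  nlinarith [sq_nonneg (s.v x 0 - 2)]

theorem Init.θ_le (h : s.Init K δ) (x : ℝ) : s.θ.f x 0 ≤ 2 + 2 * K ^ 2 := by
  have := h.sq_le (g := fun x => s.θ.f x 0 - 1) (fun x => (s.θ.hx x 0).sub_const 1) (by fun_prop)
    (fun x => by
      have : 0 ≤ (s.v x 0 - 1) ^ 2 + s.u.f x 0 ^ 2
        + (s.b₁.f x 0 ^ 2 + s.b₂.f x 0 ^ 2) + (s.w₁.f x 0 ^ 2 + s.w₂.f x 0 ^ 2)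
        + s.vx x 0 ^ 2 + s.u.x x 0 ^ 2 + (s.b₁.x x 0 ^ 2 + s.b₂.x x 0 ^ 2)
        + (s.w₁.x x 0 ^ 2 + s.w₂.x x 0 ^ 2) := by positivity
      unfold initDensity
      linarith) x
  nlinarith [sq_nonneg (s.θ.f x 0 - 2)]

theorem Init.cint_le (h : s.Init K δ) {a : ℝ} (ha : 0 < a) {f : ℝ → ℝ} (cf : Continuous f) {C : ℝ}
    (hC : 0 ≤ C) (hf : ∀ x, f x ≤ C * s.initDensity x) : cint a f ≤ C * K ^ 2 := by
  have ci := s.continuous_initDensity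
  calc cint a f ≤ cint a (fun x => C * s.initDensity x) := cint_mono ha cf (by fun_prop) hf
    _ = C * cint a s.initDensity := cint_const_mul C
    _ ≤ C * ∫ x in -a..a, s.initDensity x :=
      mul_le_mul_of_nonneg_left (cint_le_integral ha ci s.initDensity_nonneg) hC
    _ ≤ _ := mul_le_mul_of_nonneg_left (h.bound a ha) hC

variable (s)

/-- Full relative energy density. -/
def enG (x t : ℝ) : ℝ := s.en gd x t + gd (s.v x t)

variable {X : Type*} [TopologicalSpace X]

@[fun_prop]
theorem continuous_gd_v {g h : X → ℝ} (hg : Continuous g) (hh : Continuous h) :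
    Continuous fun z => gd (s.v (g z) (h z)) :=
  continuous_iff_continuousAt.2 fun _ =>
    ContinuousAt.comp (g := gd) (hasDerivAt_gd (s.v_pos _ _)).continuousAt
      (s.continuous_v hg hh).continuousAt

@[fun_prop]
theorem continuous_enG {g h : X → ℝ} (hg : Continuous g) (hh : Continuous h) :
    Continuous fun z => s.enG (g z) (h z) := by
  unfold enG
  exact ((s.continuous_en fun z hz => hasDerivAt_gd hz).comp (hg.prodMk hh)).add
    (s.continuous_gd_v hg hh)

theorem parts_le_enG (x t : ℝ) : s.u.f x t ^ 2 / 2 ≤ s.enG x t ∧ s.w₁.f x t ^ 2 / 2 ≤ s.enG x t ∧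
    s.w₂.f x t ^ 2 / 2 ≤ s.enG x t ∧
    s.v x t * (s.b₁.f x t ^ 2 + s.b₂.f x t ^ 2) / 2 ≤ s.enG x t ∧ gd (s.θ.f x t) ≤ s.enG x t ∧
    gd (s.v x t) ≤ s.enG x t := by
  have h1 := gd_nonneg (s.v_pos x t)
  have h2 := gd_nonneg (s.θ_pos x t)
  have h3 : 0 ≤ s.v x t * (s.b₁.f x t ^ 2 + s.b₂.f x t ^ 2) / 2 := by
    have := s.v_pos x t; positivity
  have h4 := sq_nonneg (s.u.f x t)
  have h5 := sq_nonneg (s.w₁.f x t)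
  have h6 := sq_nonneg (s.w₂.f x t)
  unfold enG en
  refine ⟨?_, ?_, ?_, ?_, ?_, ?_⟩ <;> linarith

theorem enG_nonneg (x t : ℝ) : 0 ≤ s.enG x t :=
  le_trans (by positivity) (s.parts_le_enG x t).1

theorem basic_energy (hα : 0 ≤ α) (hT : 0 < T) (hδ : 0 < δ) :
    ∃ C, 1 ≤ C ∧ ∀ s : Sol α β T, s.Init K δ → ∀ᶠ a in atTop, ∀ t ∈ Icc 0 T,
      cint a (fun x => s.enG x t) ≤ C := by
  set C₀ := 2 + 2 * K ^ 2 + 1 / δ with hC₀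
  have hC₀p : 0 ≤ C₀ := by positivity
  refine ⟨1 + (C₀ * K ^ 2 + T) * Real.exp T, by simp; positivity, fun s hs => ?_⟩
  filter_upwards [s.energy_ineq hα one_pos (fun z hz => hasDerivAt_gd hz) fun z => gd_nonneg,
    eventually_gt_atTop 0] with a ha ha0 t ht
  have ce := s.continuous_enG continuous_fst continuous_snd
  have cn := s.continuous_en fun z hz => hasDerivAt_gd hz
  have cg := s.continuous_gd_v continuous_fst continuous_snd
  have h0 : cint a (fun x => s.enG x 0) ≤ C₀ * K ^ 2 := by
    refine hs.cint_le ha0 (cont_slice ce 0) hC₀p fun x => ?_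
    have h1 := gd_le hδ (hs.v_ge x)
    have h2 := gd_le hδ (hs.θ_ge x)
    have h3 := hs.v_le x
    have h4 := s.v_pos x 0
    have hk : 0 ≤ K ^ 2 := sq_nonneg K
    have hd : 0 ≤ 1 / δ := by positivity
    rw [div_eq_mul_one_div] at h1 h2
    have h5 : s.v x 0 * (s.b₁.f x 0 ^ 2 + s.b₂.f x 0 ^ 2) / 2
        ≤ C₀ * (s.b₁.f x 0 ^ 2 + s.b₂.f x 0 ^ 2) := by
      have : s.v x 0 / 2 ≤ C₀ := by linarith
      have h6 : 0 ≤ s.b₁.f x 0 ^ 2 + s.b₂.f x 0 ^ 2 := by positivity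
      nlinarith
    have e1 : (s.v x 0 - 1) ^ 2 * (1 / δ) ≤ C₀ * (s.v x 0 - 1) ^ 2 := by
      nlinarith [sq_nonneg (s.v x 0 - 1)]
    have e2 : (s.θ.f x 0 - 1) ^ 2 * (1 / δ) ≤ C₀ * (s.θ.f x 0 - 1) ^ 2 := by
      nlinarith [sq_nonneg (s.θ.f x 0 - 1)]
    have e3 : (s.u.f x 0 ^ 2 + s.w₁.f x 0 ^ 2 + s.w₂.f x 0 ^ 2) / 2 ≤
        C₀ * (s.u.f x 0 ^ 2 + s.w₁.f x 0 ^ 2 + s.w₂.f x 0 ^ 2) := by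
      have : 1 / 2 ≤ C₀ := by linarith
      have h6 : 0 ≤ s.u.f x 0 ^ 2 + s.w₁.f x 0 ^ 2 + s.w₂.f x 0 ^ 2 := by positivity
      nlinarith
    have e4 : 0 ≤ C₀ * (s.vx x 0 ^ 2 + s.u.x x 0 ^ 2 + s.θ.x x 0 ^ 2
      + (s.b₁.x x 0 ^ 2 + s.b₂.x x 0 ^ 2) + (s.w₁.x x 0 ^ 2 + s.w₂.x x 0 ^ 2)) := by positivity
    unfold enG en initDensity
    clear_value C₀
    linarith
  have hsplit : ∀ t, cint a (fun x => s.enG x t) = cint a (fun x => s.en gd x t)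
      + cint a (fun x => gd (s.v x t)) := fun t =>
    
    cint_add (cont_slice cn t) (cont_slice (f := fun x t => gd (s.v x t)) cg t)
  have key := gronwall_dissipation (T := T) (y := fun t => cint a (fun x => s.enG x t))
    (y' := fun t => cint a (fun x => s.ent 1 x t)
      + cint a (fun x => (1 - s.v x t ^ (-(1:ℝ))) * s.u.x x t))
    (A := fun _ => 1) (c := fun _ => 1) (d := fun _ => 0)
    (continuous_cint ce).continuousOn continuous_const continuous_const continuous_const
    (by simp) (by simp) (by simp) (fun t ht => by
      simp only [hsplit]
      refine (ha t ht).1.add (hasDerivAt_cint (E := fun x t => gd (s.v x t))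
        (Et := fun x t => (1 - s.v x t ^ (-(1:ℝ))) * s.u.x x t) cg (by fun_prop)
        (fun x t ht => ?_) ht)
      exact HasDerivAt.comp (h₂ := gd) t (hasDerivAt_gd (s.v_pos x t)) (s.hvt x t ht))
    (fun t ht => by
      have h1 := (ha t ht).2
      have h2 : (fun x => (1 - s.v x t ^ (-(1:ℝ))) * s.u.x x t)
          = fun x => (-1) * s.src 1 x t := by
        funext x
        simp only [src, sub_self, Real.rpow_zero, Real.rpow_neg_one, one_div]; ring
      have h3 : 0 ≤ cint a (fun x => gd (s.v x t)) :=
        cint_nonneg ha0 fun x => gd_nonneg (s.v_pos x t)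
      have h4 : 0 ≤ cint a (fun x => s.diss 1 x t) :=
        cint_nonneg ha0 fun x => s.diss_nonneg hα zero_le_one x t
      rw [h2, cint_const_mul, hsplit]
      linarith) t ht
  simp only [intervalIntegral.integral_zero, add_zero, intervalIntegral.integral_const, sub_zero,
    smul_eq_mul, mul_one] at key
  have hE : Real.exp t ≤ Real.exp T := Real.exp_le_exp.2 ht.2
  calc _ ≤ _ := key
    _ ≤ (C₀ * K ^ 2 + T) * Real.exp T := by
      have := ht.1; have := ht.2
      gcongr
    _ ≤ _ := by linarith

variable {s}

theorem cell_le_of_cint {f : ℝ → ℝ} (cf : Continuous f) (h0 : ∀ x, 0 ≤ f x) {C a x : ℝ}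
    (ha : 2 * |x| + 2 ≤ a) (h : cint a f ≤ C) : ∫ y in x..(x + 1), f y ≤ 2 * C := by
  have ha0 : 0 < a := by have := abs_nonneg x; linarith
  have h1 := le_abs_self x
  have h2 := neg_abs_le x
  have := integral_le_two_mul_cut ha0 (c := x) (d := x + 1) (by linarith) (by linarith)
    (by linarith) cf h0
  unfold cint at h
  linarith

end Sol

namespace Sol
variable {α β T : ℝ} {K δ : ℝ}

/-- Zeroth order bounds. -/
structure Base (s : Sol α β T) (E : ℝ) : Prop where
  one_le : 1 ≤ E
  v₀_ge : ∀ x, 1 / E ≤ s.v x 0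
  v₀_le : ∀ x, s.v x 0 ≤ E
  θ₀_ge : ∀ x, 1 / E ≤ s.θ.f x 0
  θ₀_le : ∀ x, s.θ.f x 0 ≤ E
  cint_le : ∀ᶠ a in atTop, ∀ t ∈ Icc 0 T, cint a (fun x => s.enG x t) ≤ E
  cell : ∀ x, ∀ t ∈ Icc 0 T, ∫ y in x..(x + 1), s.enG y t ≤ E

theorem exists_base (hα : 0 ≤ α) (hT : 0 < T) (hδ : 0 < δ) :
    ∃ E, ∀ s : Sol α β T, s.Init K δ → s.Base E := by
  obtain ⟨C, c1, hC⟩ := basic_energy (α := α) (β := β) (K := K) hα hT hδ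
  have hd : 0 < 1 / δ := by positivity
  have hk := sq_nonneg K
  obtain ⟨E, e1, e2, e3⟩ : ∃ E, 2 * C ≤ E ∧ 2 + 2 * K ^ 2 ≤ E ∧ 1 / δ ≤ E :=
    ⟨2 * C + (2 + 2 * K ^ 2) + 1 / δ, by linarith, by linarith, by linarith⟩
  have e4 : 1 / E ≤ δ := by
    rw [one_div_le (by linarith) hδ]; exact e3
  refine ⟨E, fun s hs => ⟨by linarith, fun x => e4.trans (hs.v_ge x), fun x => (hs.v_le x).trans e2,
    fun x => e4.trans (hs.θ_ge x), fun x => (hs.θ_le x).trans e2, ?_, fun x t ht => ?_⟩⟩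
  · filter_upwards [hC s hs] with a ha t ht
    linarith [ha t ht]
  · obtain ⟨a, ha, ha'⟩ := ((hC s hs).and (eventually_ge_atTop (2 * |x| + 2))).exists
    exact (cell_le_of_cint (by fun_prop) (fun x => s.enG_nonneg x t) ha'
      (ha t ht)).trans e1

variable (s : Sol α β T)

variable {X : Type*} [TopologicalSpace X]

/-- Total pressure. -/
def P (x t : ℝ) : ℝ := s.θ.f x t / s.v x t + (s.b₁.f x t ^ 2 + s.b₂.f x t ^ 2) / 2

/-- Accumulated total pressure. -/
def N (x t : ℝ) : ℝ := ∫ τ in (0:ℝ)..t, s.P x τ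

@[fun_prop]
theorem continuous_P {g h : X → ℝ} (hg : Continuous g) (hh : Continuous h) :
    Continuous fun z => s.P (g z) (h z) := by
  unfold P; fun_prop (disch := simp)

theorem P_nonneg (x t : ℝ) : 0 ≤ s.P x t := by
  have := s.v_pos x t
  have := s.θ_pos x t
  unfold P; positivity

theorem N_nonneg (x : ℝ) {t : ℝ} (ht : 0 ≤ t) : 0 ≤ s.N x t :=
  intervalIntegral.integral_nonneg ht fun τ _ => s.P_nonneg x τ

theorem hasDerivAt_N (x t : ℝ) : HasDerivAt (fun t => s.N x t) (s.P x t) t := by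
  have : Continuous fun t => s.P x t :=
    by fun_prop
  exact (this.integral_hasStrictDerivAt 0 t).hasDerivAt

@[fun_prop]
theorem continuous_N {g h : X → ℝ} (hg : Continuous g) (hh : Continuous h) :
    Continuous fun z => s.N (g z) (h z) :=
  intervalIntegral.continuous_parametric_intervalIntegral_of_continuous
    (f := fun z τ => s.P (g z) τ) (by fun_prop) hh

theorem hasDerivAt_stress (x t : ℝ) :
    HasDerivAt (fun y => kap α (s.v y t) * s.u.x y t - s.P y t) (s.u.t x t) x := by
  have hv := s.hvx x t
  have hv0 := s.v_pos x t
  have h := ((hv.kap_comp α hv0).mul (s.u.hxx x t)).sub (((s.θ.hx x t).div hv hv0.ne').add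
    ((((s.b₁.hx x t).pow 2).add ((s.b₂.hx x t).pow 2)).div_const 2))
  refine h.congr_deriv ?_
  rw [s.mom x t]
  field_simp
  ring

theorem hasDerivAt_pot_v (x : ℝ) {t : ℝ} (ht : t ∈ Ioo 0 T) :
    HasDerivAt (fun t => pot α (s.v x t)) (kap α (s.v x t) * s.u.x x t) t :=
  (s.hvt x t ht).pot_comp α (s.v_pos x t)

@[fun_prop]
theorem continuous_pot_v {g h : X → ℝ} (hg : Continuous g) (hh : Continuous h) :
    Continuous fun z => pot α (s.v (g z) (h z)) :=
  continuous_iff_continuousAt.2 fun _ =>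
    ContinuousAt.comp (g := pot α) (hasDerivAt_pot α (s.v_pos _ _)).continuousAt
      (s.continuous_v hg hh).continuousAt

theorem pot_sub_N_sub (x y : ℝ) {t : ℝ} (ht : t ∈ Icc 0 T) :
    (pot α (s.v x t) - s.N x t) - (pot α (s.v y t) - s.N y t)
      = (∫ z in y..x, s.u.f z t) - (∫ z in y..x, s.u.f z 0)
        + (pot α (s.v x 0) - pot α (s.v y 0)) := by
  set Φ : ℝ → ℝ := fun t => (∫ z in y..x, s.u.f z t)
    - ((pot α (s.v x t) - s.N x t) - (pot α (s.v y t) - s.N y t)) with hΦ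
  have hd : ∀ r ∈ Ioo 0 T, HasDerivAt Φ 0 r := fun r hr => by
    have h1 := hasDerivAt_integral_of_continuous (a := y) (b := x) s.u.cf s.u.ct s.u.ht hr
    have h2 := (((s.hasDerivAt_pot_v x hr).sub (s.hasDerivAt_N x r)).sub
      ((s.hasDerivAt_pot_v y hr).sub (s.hasDerivAt_N y r)))
    refine (h1.sub h2).congr_deriv ?_
    rw [intervalIntegral.integral_eq_sub_of_hasDerivAt (fun z _ => s.hasDerivAt_stress z r)
      ((cont_slice s.u.ct r).intervalIntegrable _ _)]
    ring
  have hc : Continuous Φ := by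
    have h1 := continuous_integral_param (a := y) (b := x) s.u.cf
    have h2 := s.continuous_pot_v continuous_fst continuous_snd
    have h3 := s.continuous_N continuous_fst continuous_snd
    have k : ∀ x : ℝ, Continuous fun t : ℝ => (x, t) := fun x => by fun_prop
    exact h1.sub (((h2.comp (k x)).sub (h3.comp (k x))).sub ((h2.comp (k y)).sub (h3.comp (k y))))
  have e : Φ t = Φ 0 := by
    rcases ht.1.eq_or_lt with h | h
    · rw [← h]
    obtain ⟨c, hc1, hc2⟩ := exists_hasDerivAt_eq_slope Φ (fun _ => 0) h hc.continuousOn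
      fun r hr => hd r ⟨hr.1, hr.2.trans_le ht.2⟩
    have : t - 0 ≠ 0 := by simpa using h.ne'
    field_simp at hc2
    linarith
  simp only [hΦ, N, intervalIntegral.integral_same, sub_zero] at e
  unfold N
  linarith

theorem pot_le_log {z : ℝ} (hz : 0 < z) : pot α z ≤ Real.log z := by
  have := Real.rpow_pos_of_pos hz (-α)
  unfold pot; linarith

theorem exp_pot_le {z : ℝ} (hz : 0 < z) : Real.exp (pot α z) ≤ z :=
  (Real.exp_le_exp.2 (pot_le_log hz)).trans (Real.exp_log hz).le

theorem pot_mono (hα : 0 ≤ α) {y z : ℝ} (hy : 0 < y) (hyz : y ≤ z) : pot α y ≤ pot α z := by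
  have h1 := Real.log_le_log hy hyz
  have h2 := Real.rpow_le_rpow_of_nonpos hy hyz (neg_nonpos.2 hα)
  unfold pot; linarith

variable {s}

theorem Base.abs_integral_u_le {E : ℝ} (h : s.Base E) {z x y : ℝ} (hx : x ∈ Icc z (z + 1))
    (hy : y ∈ Icc z (z + 1)) {t : ℝ} (ht : t ∈ Icc 0 T) : |∫ r in y..x, s.u.f r t| ≤ E + 1 := by
  have aux : ∀ x ∈ Icc z (z + 1), ∀ y ∈ Icc z (z + 1), y ≤ x →
      |∫ r in y..x, s.u.f r t| ≤ E + 1 := by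
    intro x hx y hy hxy
    have c := cont_slice s.u.cf t
    have ce : Continuous fun y => s.enG y t := by fun_prop
    calc |∫ r in y..x, s.u.f r t| ≤ ∫ r in y..x, |s.u.f r t| :=
          intervalIntegral.abs_integral_le_integral_abs hxy
      _ ≤ ∫ r in z..(z + 1), |s.u.f r t| :=
          integral_le_of_subset (by fun_prop) hy.1 hxy hx.2 fun _ _ => abs_nonneg _
      _ ≤ ∫ r in z..(z + 1), (s.enG r t + 1) :=
          integral_le_of_le (by linarith) (by fun_prop) (by fun_prop) fun r _ => by
            have := (s.parts_le_enG r t).1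
            nlinarith [sq_nonneg (|s.u.f r t| - 1), sq_abs (s.u.f r t)]
      _ = (∫ r in z..(z + 1), s.enG r t) + 1 := by
          rw [intervalIntegral.integral_add (ce.intervalIntegrable _ _) (by simp)]; simp
      _ ≤ E + 1 := by linarith [h.cell z t ht]
  rcases le_total y x with hxy | hxy
  · exact aux x hx y hy hxy
  · rw [intervalIntegral.integral_symm, abs_neg]
    exact aux y hy x hx hxy

/-- The oscillation constant of `N - pot v` on unit cells. -/
def osc (α E : ℝ) : ℝ := 2 * (E + 1) + (pot α E - pot α (1 / E))

theorem Base.osc_le (hα : 0 ≤ α) {E : ℝ} (h : s.Base E) {z x y : ℝ} (hx : x ∈ Icc z (z + 1))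
    (hy : y ∈ Icc z (z + 1)) {t : ℝ} (ht : t ∈ Icc 0 T) :
    s.N x t - pot α (s.v x t) ≤ osc α E + (s.N y t - pot α (s.v y t)) := by
  have h0 : (0:ℝ) ∈ Icc 0 T := ⟨le_rfl, ht.1.trans ht.2⟩
  have e := s.pot_sub_N_sub x y ht
  have h1 := abs_le.1 (h.abs_integral_u_le hx hy ht)
  have h2 := abs_le.1 (h.abs_integral_u_le hx hy h0)
  have hE : 0 < 1 / E := by have := h.one_le; positivity
  have h3 := pot_mono hα (s.v_pos y 0) (h.v₀_le y)
  have h4 := pot_mono hα hE (h.v₀_ge x)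
  unfold osc
  linarith [h1.1, h2.2]

theorem exp_pot_ge (hα : 0 ≤ α) {E z : ℝ} (hE : 0 < E) (hz : 0 < z) :
    Real.exp (pot α (Real.exp (-1 - 2 * E))) * (1 - gd z / (2 * E)) ≤ Real.exp (pot α z) := by
  have k0 := Real.exp_pos (pot α (Real.exp (-1 - 2 * E)))
  rcases le_total (Real.exp (-1 - 2 * E)) z with h | h
  · have h1 := Real.exp_le_exp.2 (pot_mono hα (Real.exp_pos _) h)
    have h2 : 0 ≤ gd z / (2 * E) := div_nonneg (gd_nonneg hz) (by positivity)
    nlinarith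
  · have h1 : 2 * E ≤ gd z := by
      have := Real.log_le_log hz h
      rw [Real.log_exp] at this
      unfold gd; linarith
    have h2 : 1 ≤ gd z / (2 * E) := by rwa [one_le_div (by positivity)]
    have := Real.exp_pos (pot α z)
    nlinarith

theorem Base.v_lower (hα : 0 ≤ α) (E : ℝ) :
    ∃ c, 0 < c ∧ ∀ s : Sol α β T, s.Base E → ∀ x, ∀ t ∈ Icc 0 T, c ≤ s.v x t := by
  set κ := Real.exp (pot α (Real.exp (-1 - 2 * E))) with hκ
  have κ0 : 0 < κ := Real.exp_pos _
  set A := Real.exp (osc α E) with hA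
  have A0 : 0 < A := Real.exp_pos _
  set M := A * (3 * E + 2) * (2 * A / κ) with hM
  set H := 2 * A / κ * Real.exp (M * T) with hH
  have H0 : 0 < H := by positivity
  refine ⟨1 / H, by positivity, fun s h x t ht => ?_⟩
  have hE := h.one_le
  have E0 : 0 < E := by linarith
  have M0 : 0 ≤ M := by positivity
  set g : ℝ → ℝ → ℝ := fun x t => Real.exp (s.N x t - pot α (s.v x t)) with hg
  have cN := s.continuous_N continuous_fst continuous_snd
  have cp := s.continuous_pot_v continuous_fst continuous_snd
  have cg : Continuous fun q : ℝ × ℝ => g q.1 q.2 := by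
    simp only [hg]; exact (cN.sub cp).rexp
  have eN : ∀ x t, Real.exp (s.N x t) = Real.exp (pot α (s.v x t)) * g x t := fun x t => by
    simp only [hg]; rw [← Real.exp_add]; congr 1; ring
  have g0 : ∀ x t, 0 < g x t := fun x t => Real.exp_pos _
  have gle : ∀ y ∈ Icc x (x + 1), ∀ z ∈ Icc x (x + 1), ∀ t ∈ Icc 0 T, g z t ≤ A * g y t := by
    intro y hy z hz t ht
    simp only [hg, hA]; rw [← Real.exp_add]
    exact Real.exp_le_exp.2 (h.osc_le hα hz hy ht)
  have hxx : x ∈ Icc x (x + 1) := ⟨le_rfl, by linarith⟩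
  have hZ : ∀ t ∈ Icc 0 T, g x t ≤ 2 * A / κ * ∫ y in x..(x + 1), Real.exp (s.N y t) := by
    intro t ht
    have c1 : Continuous fun y => gd (s.v y t) := by fun_prop
    have cl : ∫ y in x..(x + 1), gd (s.v y t) ≤ E :=
      (integral_le_of_le (by linarith) c1 (by fun_prop)
        fun y _ => (s.parts_le_enG y t).2.2.2.2.2).trans (h.cell x t ht)
    have h1 : ∫ y in x..(x + 1), (g x t / A * κ) * (1 - gd (s.v y t) / (2 * E))
        ≤ ∫ y in x..(x + 1), Real.exp (s.N y t) := by
      refine integral_le_of_le (by linarith) (by fun_prop) (cont_slice cN t).rexp fun y hy => ?_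
      rw [eN]
      have e1 := exp_pot_ge hα E0 (s.v_pos y t)
      have e2 : g x t / A ≤ g y t := by
        rw [div_le_iff₀ A0, mul_comm]; exact gle y hy x hxx t ht
      have e3 := Real.exp_pos (pot α (s.v y t))
      have e4 : 0 < g x t / A := div_pos (g0 x t) A0
      calc g x t / A * κ * (1 - gd (s.v y t) / (2 * E))
          = κ * (1 - gd (s.v y t) / (2 * E)) * (g x t / A) := by ring
        _ ≤ Real.exp (pot α (s.v y t)) * (g x t / A) := by gcongr
        _ ≤ _ := by gcongr
    rw [intervalIntegral.integral_const_mul, intervalIntegral.integral_sub (by simp)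
      ((c1.div_const _).intervalIntegrable _ _), intervalIntegral.integral_div] at h1
    have h2 : (∫ y in x..(x + 1), gd (s.v y t)) / (2 * E) ≤ 1 / 2 := by
      rw [div_le_iff₀ (by positivity)]; linarith
    simp only [intervalIntegral.integral_const, add_sub_cancel_left, smul_eq_mul, one_mul] at h1
    have h3 : 0 < g x t / A * κ := by have := g0 x t; positivity
    have h4 : g x t / A * κ * (1 / 2) ≤ ∫ y in x..(x + 1), Real.exp (s.N y t) := by nlinarith
    calc g x t = 2 * A / κ * (g x t / A * κ * (1 / 2)) := by field_simp
      _ ≤ _ := by gcongr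
  have key := gronwall_dissipation (T := T) (y := fun t => ∫ y in x..(x + 1), Real.exp (s.N y t))
    (y' := fun t => ∫ y in x..(x + 1), Real.exp (s.N y t) * s.P y t)
    (A := fun _ => M) (c := fun _ => 0) (d := fun _ => 0)
    (continuous_integral_param (E := fun y t => Real.exp (s.N y t)) cN.rexp).continuousOn
    continuous_const continuous_const continuous_const (by simpa using fun _ _ _ => M0)
    (by simp) (by simp)
    (fun t ht => hasDerivAt_integral_of_continuous (E := fun y t => Real.exp (s.N y t))
      (Et := fun y t => Real.exp (s.N y t) * s.P y t) cN.rexp (by fun_prop)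
      (fun y r _ => (s.hasDerivAt_N y r).exp) ht)
    (fun t ht => by
      have ht := Ioo_subset_Icc_self ht
      have ce : Continuous fun y => s.enG y t := by fun_prop
      have h1 : ∫ y in x..(x + 1), Real.exp (s.N y t) * s.P y t
          ≤ ∫ y in x..(x + 1), (A * g x t) * (3 * s.enG y t + 2) := by
        refine integral_le_of_le (by linarith) (by fun_prop)
          (by fun_prop) fun y hy => ?_
        have hv := s.v_pos y t
        have e1 := exp_pot_le (α := α) hv
        have e2 := gle x hxx y hy t ht
        have e3 : s.v y t * s.P y t ≤ 3 * s.enG y t + 2 := by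
          obtain ⟨-, -, -, p1, p2, -⟩ := s.parts_le_enG y t
          have p3 := le_two_mul_gd (s.θ_pos y t)
          have : s.v y t * s.P y t
            = s.θ.f y t + s.v y t * (s.b₁.f y t ^ 2 + s.b₂.f y t ^ 2) / 2 := by
            unfold P; field_simp
          linarith
        have e4 := s.P_nonneg y t
        have e5 := g0 y t
        have e6 := g0 x t
        rw [eN]
        calc Real.exp (pot α (s.v y t)) * g y t * s.P y t
            ≤ s.v y t * (A * g x t) * s.P y t := by gcongr
          _ = (A * g x t) * (s.v y t * s.P y t) := by ring
          _ ≤ _ := by gcongr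
      rw [intervalIntegral.integral_const_mul, intervalIntegral.integral_add
        ((ce.const_mul 3).intervalIntegrable _ _) (by simp), intervalIntegral.integral_const_mul]
        at h1
      simp only [intervalIntegral.integral_const, add_sub_cancel_left, smul_eq_mul, one_mul] at h1
      have h2 := h.cell x t ht
      have h3 := g0 x t
      have h4 := hZ t ht
      rw [add_zero, add_zero]
      calc _ ≤ A * g x t * (3 * (∫ y in x..(x + 1), s.enG y t) + 2) := h1
        _ ≤ A * g x t * (3 * E + 2) := by gcongr
        _ = A * (3 * E + 2) * g x t := by ring
        _ ≤ A * (3 * E + 2) * (2 * A / κ * ∫ y in x..(x + 1), Real.exp (s.N y t)) := by gcongr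
        _ = _ := by rw [hM]; ring) t ht
  simp only [N, intervalIntegral.integral_same, Real.exp_zero, intervalIntegral.integral_const,
    add_sub_cancel_left, smul_eq_mul, mul_zero, add_zero, one_mul, sub_zero] at key
  have h1 := hZ t ht
  have h2 : g x t ≤ H := by
    refine h1.trans ?_
    rw [hH]
    gcongr
    refine key.trans (Real.exp_le_exp.2 ?_)
    rw [mul_comm]; exact mul_le_mul_of_nonneg_left ht.2 M0
  have h3 : Real.exp (-Real.log (s.v x t)) ≤ H := by
    refine le_trans (Real.exp_le_exp.2 ?_) h2
    have := s.N_nonneg x ht.1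
    have := pot_le_log (α := α) (s.v_pos x t)
    linarith
  rw [Real.exp_neg, Real.exp_log (s.v_pos x t)] at h3
  rw [one_div]
  exact inv_le_of_inv_le₀ (s.v_pos x t) h3

/-- A uniform bound on the accumulated pressure bounds the specific volume from above. -/
theorem Base.v_upper (hα : 0 ≤ α) {c : ℝ} (hc : 0 < c) (E D : ℝ) :
    ∃ C, ∀ s : Sol α β T, s.Base E → (∀ x, ∀ t ∈ Icc 0 T, c ≤ s.v x t) →
      (∀ x, ∀ t ∈ Icc 0 T, s.N x t ≤ D) → ∀ x, ∀ t ∈ Icc 0 T, s.v x t ≤ C := by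
  refine ⟨Real.exp (D + osc α E + Real.log (2 * E + 2) + c ^ (-α)), fun s h hv hN x t ht => ?_⟩
  have hE := h.one_le
  have cv := cont_slice s.cv t
  have ce : Continuous fun y => s.enG y t := by fun_prop
  obtain ⟨y, hy, hy'⟩ := exists_le_integral_cell cv x
  have h1 : s.v y t ≤ 2 * E + 2 := by
    refine hy'.trans ?_
    have : ∫ r in x..(x + 1), s.v r t ≤ ∫ r in x..(x + 1), (2 * s.enG r t + 2) :=
      integral_le_of_le (by linarith) cv (by fun_prop) fun r _ => by
        have := (s.parts_le_enG r t).2.2.2.2.2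
        have := le_two_mul_gd (s.v_pos r t)
        linarith
    rw [intervalIntegral.integral_add ((ce.const_mul 2).intervalIntegrable _ _) (by simp),
      intervalIntegral.integral_const_mul] at this
    simp only [intervalIntegral.integral_const, add_sub_cancel_left, smul_eq_mul, one_mul] at this
    linarith [h.cell x t ht]
  have h2 := h.osc_le hα hy ⟨le_rfl, by linarith⟩ ht (x := y) (y := x)
  have h3 := s.N_nonneg y ht.1
  have h4 := (pot_le_log (α := α) (s.v_pos y t)).trans (Real.log_le_log (s.v_pos y t) h1)
  have h5 := hN x t ht
  have h6 := Real.rpow_le_rpow_of_nonpos hc (hv x t ht) (neg_nonpos.2 hα)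
  rw [← Real.exp_log (s.v_pos x t)]
  refine Real.exp_le_exp.2 ?_
  unfold pot at h2 h4
  linarith

end Sol

theorem second_deriv_nonneg_of_isLocalMin {f f' : ℝ → ℝ} {f'' x : ℝ}
    (hf : ∀ y, HasDerivAt f (f' y) y) (hf' : HasDerivAt f' f'' x) (h : IsLocalMin f x) :
    0 ≤ f'' := by
  by_contra! hn
  have e : deriv f = f' := funext fun y => (hf y).deriv
  have h0 : f' x = 0 := h.hasDerivAt_eq_zero (hf x)
  have hmax : IsLocalMax f x := isLocalMax_of_deriv_deriv_neg (by rw [e, hf'.deriv]; exact hn)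
    (by rw [e]; exact h0) (hf x).continuousAt
  have hc : f =ᶠ[nhds x] fun _ => f x := by
    filter_upwards [h, hmax] with y h1 h2 using le_antisymm h2 h1
  have hc' : f' =ᶠ[nhds x] fun _ => 0 := by
    filter_upwards [hc.eventuallyEq_nhds] with y hy
    have := hy.deriv_eq
    rwa [(hf y).deriv, deriv_const] at this
  have := hf'.unique ((hasDerivAt_const x (0:ℝ)).congr_of_eventuallyEq hc')
  exact hn.ne this

theorem deriv_nonpos_of_left_min {f : ℝ → ℝ} {f' a t : ℝ} (hat : a < t) (hf : HasDerivAt f f' t)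
    (h : ∀ r ∈ Icc a t, f t ≤ f r) : f' ≤ 0 := by
  have h1 := (hasDerivWithinAt_iff_tendsto_slope' (s := Iio t) (by simp)).1 hf.hasDerivWithinAt
  refine le_of_tendsto h1 ?_
  filter_upwards [Ioo_mem_nhdsLT hat] with r hr
  rw [slope_def_field]
  exact div_nonpos_of_nonneg_of_nonpos (sub_nonneg.2 (h r ⟨hr.1.le, hr.2.le⟩))
    (by linarith [hr.2])

namespace Sol
variable {α β T : ℝ}

theorem θ_t_ge (hα : 0 ≤ α) (s : Sol α β T) {c x t : ℝ} (hc : 0 < c) (hv : c ≤ s.v x t)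
    (h1 : s.θ.x x t = 0) (h2 : 0 ≤ s.θ.xx x t) : -(s.θ.f x t ^ 2 / (4 * c)) ≤ s.θ.t x t := by
  have hv0 := s.v_pos x t
  have hk := inv_le_kap hα hv0
  have hp := Real.rpow_pos_of_pos (s.θ_pos x t) β
  have e1 : 0 ≤ s.θ.f x t ^ β * s.θ.xx x t / s.v x t := by positivity
  have e2 : 0 ≤ (s.w₁.x x t ^ 2 + s.w₂.x x t ^ 2 + s.b₁.x x t ^ 2 + s.b₂.x x t ^ 2) / s.v x t := by
    positivity
  have e3 : (s.v x t)⁻¹ * s.u.x x t ^ 2 ≤ kap α (s.v x t) * s.u.x x t ^ 2 := by gcongr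
  have e4 : s.θ.f x t ^ 2 / (4 * s.v x t) ≤ s.θ.f x t ^ 2 / (4 * c) := by gcongr
  have e5 : -(s.θ.f x t / s.v x t * s.u.x x t) + (s.v x t)⁻¹ * s.u.x x t ^ 2
      + s.θ.f x t ^ 2 / (4 * s.v x t)
      = (s.v x t)⁻¹ * (s.u.x x t - s.θ.f x t / 2) ^ 2 := by field_simp; ring
  have e6 : 0 ≤ (s.v x t)⁻¹ * (s.u.x x t - s.θ.f x t / 2) ^ 2 := by positivity
  rw [s.temp x t, h1]
  simp only [mul_zero, zero_mul, zero_div, sub_zero, add_zero, ne_eq, OfNat.ofNat_ne_zero,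
    not_false_eq_true, zero_pow]
  linarith

theorem Base.one_le_θ_mul (hα : 0 ≤ α) {s : Sol α β T} {E c : ℝ} (h : s.Base E) (hc : 0 < c)
    (hv : ∀ x, ∀ t ∈ Icc 0 T, c ≤ s.v x t) (x : ℝ) {t : ℝ} (ht0 : 0 ≤ t) (ht : t < T) :
    1 ≤ s.θ.f x t * (E + 2 + (1 / (4 * c) + 1) * t) := by
  obtain ⟨M, hM0, hM⟩ := s.exists_rad
  have hE := h.one_le
  set D := 1 / (4 * c) + 1 with hD
  have D0 : 0 < D := by positivity
  set R := max M |x| with hR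
  set F : ℝ × ℝ → ℝ := fun q => s.θ.f q.1 q.2 * (E + 2 + D * q.2) with hF
  have hR0 : 0 ≤ R := hM0.trans (le_max_left _ _)
  obtain ⟨⟨y, r⟩, ⟨hy, hr⟩, hmin⟩ := (isCompact_Icc.prod isCompact_Icc :
    IsCompact (Icc (-R) R ×ˢ Icc 0 t)).exists_isMinOn ⟨(0, 0), by simp [hR0, ht0]⟩
      (f := F) (by simp only [hF]; fun_prop)
  have hx : F (y, r) ≤ F (x, t) := hmin ⟨abs_le.1 (le_max_right _ _), ht0, le_rfl⟩
  refine le_trans ?_ hx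
  by_contra! hlt
  simp only at hy hr
  have hpos := s.θ_pos y r
  have hDr : 0 ≤ D * r := mul_nonneg D0.le hr.1
  have hr0 : 0 < r := by
    rcases hr.1.eq_or_lt with e | e
    · exfalso
      have h1 := h.θ₀_ge y
      simp only [hF, ← e, mul_zero, add_zero] at hlt
      have : 1 / E * (E + 2) ≤ s.θ.f y 0 * (E + 2) := by gcongr
      have : 1 / E * (E + 2) = 1 + 2 / E := by field_simp
      have : 0 < 2 / E := by positivity
      linarith
    · exact e
  have hyM : |y| < M := by
    by_contra! hcon
    have h1 := (abs_lt.1 (hM y r hcon).2.2.1).1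
    simp only [hF] at hlt
    nlinarith
  have hyR : y ∈ Ioo (-R) R := abs_lt.1 (hyM.trans_le (le_max_left _ _))
  have hg : 0 < E + 2 + D * r := by linarith
  have hloc : IsLocalMin (fun y => s.θ.f y r) y := by
    filter_upwards [Ioo_mem_nhds hyR.1 hyR.2] with z hz
    have : F (y, r) ≤ F (z, r) := hmin ⟨Ioo_subset_Icc_self hz, hr⟩
    simp only [hF] at this
    exact le_of_mul_le_mul_right this hg
  have hrT : r ∈ Ioo 0 T := ⟨hr0, hr.2.trans_lt ht⟩
  have e1 := θ_t_ge hα s hc (hv y r (Ioo_subset_Icc_self hrT))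
    (hloc.hasDerivAt_eq_zero (s.θ.hx y r))
    (second_deriv_nonneg_of_isLocalMin (fun z => s.θ.hx z r) (s.θ.hxx y r) hloc)
  have hd : HasDerivAt (fun τ => s.θ.f y τ * (E + 2 + D * τ))
      (s.θ.t y r * (E + 2 + D * r) + s.θ.f y r * D) r := by
    have := (s.θ.ht y r hrT).mul (((hasDerivAt_id r).const_mul D).const_add (E + 2))
    exact this.congr_deriv (by simp)
  have e2 := deriv_nonpos_of_left_min hr0 hd fun τ hτ =>
    (hmin ⟨hy, hτ.1, hτ.2.trans hr.2⟩ : F (y, r) ≤ F (y, τ))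
  simp only [hF] at hlt
  have e3 : -(s.θ.f y r ^ 2 / (4 * c)) * (E + 2 + D * r) ≤ s.θ.t y r * (E + 2 + D * r) := by gcongr
  have e4 : -(s.θ.f y r ^ 2 / (4 * c)) * (E + 2 + D * r) + s.θ.f y r * D
      = s.θ.f y r * (1 / (4 * c) * (1 - s.θ.f y r * (E + 2 + D * r)) + 1) := by
    rw [hD]; ring
  have e5 : 0 < s.θ.f y r * (1 / (4 * c) * (1 - s.θ.f y r * (E + 2 + D * r)) + 1) := by
    have : 0 < 1 - s.θ.f y r * (E + 2 + D * r) := by linarith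
    positivity
  linarith

theorem Base.θ_lower (hα : 0 ≤ α) (hT : 0 < T) {c : ℝ} (hc : 0 < c) (E : ℝ) :
    ∃ d, 0 < d ∧ ∀ s : Sol α β T, s.Base E → (∀ x, ∀ t ∈ Icc 0 T, c ≤ s.v x t) →
      ∀ x, ∀ t ∈ Icc 0 T, d ≤ s.θ.f x t := by
  set d := |E| + 2 + (1 / (4 * c) + 1) * T with hd
  have d0 : 0 < d := by positivity
  refine ⟨1 / d, by positivity, fun s h hv x => ?_⟩
  have hcl : IsClosed {t | 1 / d ≤ s.θ.f x t} := isClosed_le (by fun_prop) (by fun_prop)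
  rw [← closure_Ioo hT.ne]
  refine hcl.closure_subset_iff.2 fun t ht => ?_
  have h1 := h.one_le_θ_mul hα hc hv x ht.1.le ht.2
  have h2 : E + 2 + (1 / (4 * c) + 1) * t ≤ d := by
    rw [hd]; gcongr
    · exact le_abs_self E
    · exact ht.2.le
  have h3 := s.θ_pos x t
  change 1 / d ≤ _
  rw [div_le_iff₀ d0]
  exact h1.trans (by gcongr)

end Sol

/-- The thermal energy density with derivative `1 - z ^ (-p)`. -/
def hp (p z : ℝ) : ℝ := z - 1 - (z ^ (1 - p) - 1) / (1 - p)

theorem hasDerivAt_hp {p z : ℝ} (hp1 : p < 1) (hz : 0 < z) :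
    HasDerivAt (hp p) (1 - z ^ (-p)) z := by
  have h := ((hasDerivAt_id z).sub_const 1).sub
    (((Real.hasDerivAt_rpow_const (p := 1 - p) (Or.inl hz.ne')).sub_const 1).div_const (1 - p))
  refine h.congr_deriv ?_
  have : 1 - p ≠ 0 := by linarith
  rw [show 1 - p - 1 = -p by ring]
  field_simp

theorem hp_nonneg {p z : ℝ} (hp0 : 0 ≤ p) (hp1 : p < 1) (hz : 0 < z) : 0 ≤ hp p z := by
  have h := rpow_one_add_le_one_add_mul_self (s := z - 1) (by linarith) (p := 1 - p)
    (by linarith) (by linarith)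
  rw [add_sub_cancel] at h
  have : (z ^ (1 - p) - 1) / (1 - p) ≤ z - 1 := by
    rw [div_le_iff₀ (by linarith)]; linarith
  unfold hp; linarith

theorem hp_le_gd {p z : ℝ} (hp1 : p < 1) (hz : 0 < z) : hp p z ≤ gd z := by
  have h := Real.add_one_le_exp (Real.log z * (1 - p))
  rw [← Real.rpow_def_of_pos hz] at h
  have : Real.log z ≤ (z ^ (1 - p) - 1) / (1 - p) := by
    rw [le_div_iff₀ (by linarith)]; linarith
  unfold hp gd; linarith

theorem exists_rpow_le {r q η : ℝ} (hr : 0 ≤ r) (hrq : r < q) (hη : 0 < η) :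
    ∃ C, 0 ≤ C ∧ ∀ z, 0 < z → z ^ r ≤ η * z ^ q + C := by
  set Z := (1 / η) ^ (1 / (q - r)) with hZ
  have hqr : 0 < q - r := by linarith
  have Z0 : 0 < Z := Real.rpow_pos_of_pos (by positivity) _
  refine ⟨Z ^ r, Real.rpow_nonneg Z0.le _, fun z hz => ?_⟩
  have h1 := Real.rpow_pos_of_pos hz q
  rcases le_total z Z with h | h
  · have := Real.rpow_le_rpow hz.le h hr
    nlinarith
  · have h2 : 1 / η ≤ z ^ (q - r) := by
      calc 1 / η = Z ^ (q - r) := by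
            rw [hZ, ← Real.rpow_mul (by positivity), one_div_mul_cancel hqr.ne', Real.rpow_one]
        _ ≤ _ := Real.rpow_le_rpow Z0.le h hqr.le
    have h3 : z ^ q = z ^ (q - r) * z ^ r := by rw [← Real.rpow_add hz]; congr 1; ring
    have h4 := Real.rpow_pos_of_pos hz r
    have h5 : 1 ≤ η * z ^ (q - r) := by
      rw [div_le_iff₀ hη] at h2; linarith
    have h6 := Real.rpow_pos_of_pos Z0 r
    rw [h3]
    nlinarith

theorem abs_rpow_sub_one_le {p z : ℝ} (hp0 : 0 ≤ p) (hp1 : p ≤ 1) (hz : 0 < z) :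
    (z ^ (1 - p) - 1) ^ 2 ≤ (z - 1) ^ 2 := by
  rcases le_total 1 z with h | h
  · have h1 : z ^ (1 - p) ≤ z ^ (1:ℝ) := Real.rpow_le_rpow_of_exponent_le h (by linarith)
    have h2 : 1 ≤ z ^ (1 - p) := Real.one_le_rpow h (by linarith)
    rw [Real.rpow_one] at h1
    nlinarith
  · have h1 : z ^ (1:ℝ) ≤ z ^ (1 - p) := Real.rpow_le_rpow_of_exponent_ge hz h (by linarith)
    have h2 : z ^ (1 - p) ≤ 1 := Real.rpow_le_one hz.le h (by linarith)
    rw [Real.rpow_one] at h1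
    nlinarith

theorem integral_const_mul_add_le {f : ℝ → ℝ} (cf : Continuous f) {a b c D : ℝ} (ha : 0 ≤ a) (x : ℝ)
    (h : ∫ y in x..(x + 1), f y ≤ c) (hD : a * c + b ≤ D) :
    ∫ y in x..(x + 1), (a * f y + b) ≤ D := by
  rw [intervalIntegral.integral_add ((cf.const_mul a).intervalIntegrable _ _) (by simp),
    intervalIntegral.integral_const_mul]
  simp only [intervalIntegral.integral_const, add_sub_cancel_left, smul_eq_mul, one_mul]
  nlinarith

namespace Sol
variable {α β T : ℝ}

/-- Zeroth order bounds with positive lower bounds for `v` and `θ`. -/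
structure Low (s : Sol α β T) (c E : ℝ) : Prop extends s.Base E where
  c_pos : 0 < c
  v_ge : ∀ x, ∀ t ∈ Icc 0 T, c ≤ s.v x t
  θ_ge : ∀ x, ∀ t ∈ Icc 0 T, c ≤ s.θ.f x t

theorem exists_low (hα : 0 ≤ α) (hT : 0 < T) {K δ : ℝ} (hδ : 0 < δ) :
    ∃ c E, 0 < c ∧ 1 ≤ E ∧ ∀ s : Sol α β T, s.Init K δ → s.Low c E := by
  obtain ⟨E, hE⟩ := exists_base (α := α) (β := β) (K := K) hα hT hδ
  obtain ⟨c₁, p1, h1⟩ := Base.v_lower (β := β) (T := T) hα E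
  obtain ⟨c₂, p2, h2⟩ := Base.θ_lower (β := β) hα hT p1 E
  by_cases hex : ∃ s : Sol α β T, s.Init K δ
  · obtain ⟨s₀, hs₀⟩ := hex
    refine ⟨min c₁ c₂, E, lt_min p1 p2, (hE s₀ hs₀).one_le, fun s hs => ⟨hE s hs, lt_min p1 p2,
      fun x t ht => (min_le_left _ _).trans (h1 s (hE s hs) x t ht),
      fun x t ht => (min_le_right _ _).trans (h2 s (hE s hs) (h1 s (hE s hs)) x t ht)⟩⟩
  · push Not at hex
    exact ⟨1, 1, one_pos, le_rfl, fun s hs => absurd hs (hex s)⟩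

variable {s : Sol α β T} {c E : ℝ}

theorem Base.cell_v_le (h : s.Base E) (x : ℝ) {t : ℝ} (ht : t ∈ Icc 0 T) :
    ∫ y in x..(x + 1), s.v y t ≤ 2 * E + 2 := by
  refine (integral_le_of_le (by linarith) (by fun_prop) (g := fun y => 2 * s.enG y t + 2)
    (by fun_prop) fun y _ => ?_).trans
    (integral_const_mul_add_le (f := fun y => s.enG y t) (by fun_prop) (by norm_num) x
      (h.cell x t ht) le_rfl)
  have := (s.parts_le_enG y t).2.2.2.2.2
  have := le_two_mul_gd (s.v_pos y t)
  linarith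

theorem Base.cell_θ_le (h : s.Base E) (x : ℝ) {t : ℝ} (ht : t ∈ Icc 0 T) :
    ∫ y in x..(x + 1), s.θ.f y t ≤ 2 * E + 2 := by
  refine (integral_le_of_le (by linarith) (by fun_prop) (g := fun y => 2 * s.enG y t + 2)
    (by fun_prop) fun y _ => ?_).trans
    (integral_const_mul_add_le (f := fun y => s.enG y t) (by fun_prop) (by norm_num) x
      (h.cell x t ht) le_rfl)
  have := (s.parts_le_enG y t).2.2.2.2.1
  have := le_two_mul_gd (s.θ_pos y t)
  linarith

/-- Powers of the maximal temperature are controlled by their gradient on a bounded cell. -/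
theorem Base.S_rpow_le (h : s.Base E) {q : ℝ} (hq : 0 ≤ q) : ∃ M, ∀ t ∈ Icc 0 T, ∃ z, |z| ≤ M ∧
    s.S t ^ q ≤ (2 * E + 2) ^ q
      + ∫ y in z..(z + 1), |q * s.θ.f y t ^ (q - 1) * s.θ.x y t| := by
  obtain ⟨M, hM0, hM⟩ := s.exists_rad
  have hE := h.one_le
  refine ⟨M, fun t ht => ?_⟩
  have aux : ∀ z, 0 ≤ ∫ y in z..(z + 1), |q * s.θ.f y t ^ (q - 1) * s.θ.x y t| := fun z =>
    intervalIntegral.integral_nonneg (by linarith) fun _ _ => abs_nonneg _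
  rcases s.S_eq t with h2 | ⟨x, hx⟩
  · refine ⟨0, by simpa using hM0, ?_⟩
    have := Real.rpow_le_rpow (by norm_num) (by linarith : (2:ℝ) ≤ 2 * E + 2) hq
    have := aux 0
    rw [h2]; linarith
  · have hxM : |x| ≤ M := by
      by_contra! hcon
      have := (abs_lt.1 (hM x t hcon.le).2.2.1).2
      have := s.two_le_S t
      linarith
    refine ⟨x, hxM, ?_⟩
    obtain ⟨y, hy, hy'⟩ := exists_le_integral_cell (f := fun y => s.θ.f y t) (by fun_prop) x
    have h1 : s.θ.f y t ^ q ≤ (2 * E + 2) ^ q :=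
      Real.rpow_le_rpow (s.θ_pos y t).le (hy'.trans (h.cell_θ_le x ht)) hq
    have h2 := sub_le_integral_cell (g := fun y => s.θ.f y t ^ q)
      (gx := fun y => s.θ.x y t * q * s.θ.f y t ^ (q - 1))
      (m := fun y => |q * s.θ.f y t ^ (q - 1) * s.θ.x y t|) (x := x) (y := y) (z := x)
      (fun y => (s.θ.hx y t).rpow_const (Or.inl (s.θ_ne y t))) (by fun_prop) (by fun_prop)
      ⟨le_rfl, by linarith⟩ hy fun z _ => le_of_eq (by congr 1; ring)
    rw [hx]
    linarith

/-- The maximal temperature is controlled by the dissipation. -/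
theorem exists_S_rpow_le_diss (hα : 0 ≤ α) {p : ℝ} (hp : 0 < p) (hpβ : p ≤ β) (hE : 1 ≤ E) :
    ∃ C, 0 < C ∧ ∀ s : Sol α β T, s.Base E → ∀ᶠ a in atTop, ∀ t ∈ Icc 0 T,
      s.S t ^ (β + 1 - p) ≤ C * (1 + cint a fun x => s.diss p x t) := by
  set q := β + 1 - p with hq
  have q0 : 0 < q := by linarith
  set D := 2 * E + 2 with hD
  have D0 : 0 < D := by linarith
  set C := 2 * D ^ q + 2 * D * q ^ 2 / p with hC
  have Dq : 0 < D ^ q := Real.rpow_pos_of_pos D0 q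
  have hCD : 0 < 2 * D * q ^ 2 / p := by positivity
  refine ⟨2 * C, by positivity, fun s h => ?_⟩
  obtain ⟨M, hM⟩ := h.S_rpow_le q0.le
  filter_upwards [eventually_ge_atTop (2 * M + 2)] with a ha t ht
  obtain ⟨z, hz, hz'⟩ := hM t ht
  have hS := s.two_le_S t
  have hSq : 0 < s.S t ^ q := Real.rpow_pos_of_pos (by linarith) q
  have h1 : ∫ y in z..(z + 1), |q * s.θ.f y t ^ (q - 1) * s.θ.x y t|
      ≤ ∫ y in z..(z + 1), ((s.S t ^ q / (2 * D)) * s.v y t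
        + (D * q ^ 2 / (2 * p)) * s.diss p y t) := by
    refine integral_le_of_le (by linarith) (by fun_prop) (by fun_prop) fun y _ => ?_
    have hv := s.v_pos y t
    have hθ := s.θ_pos y t
    have e1 : p * s.θ.f y t ^ (β - 1 - p) * s.θ.x y t ^ 2 / s.v y t ≤ s.diss p y t := by
      have := kap_pos hα hv
      have : 0 ≤ (kap α (s.v y t) * s.u.x y t ^ 2
        + (s.w₁.x y t ^ 2 + s.w₂.x y t ^ 2 + s.b₁.x y t ^ 2 + s.b₂.x y t ^ 2) / s.v y t)
          * s.θ.f y t ^ (-p) := mul_nonneg (by positivity) (Real.rpow_nonneg hθ.le _)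
      unfold diss; linarith
    have e2 : s.θ.f y t ^ q ≤ s.S t ^ q := Real.rpow_le_rpow hθ.le (s.θ_le_S y t) q0.le
    have e3 : (s.θ.f y t ^ (q - 1)) ^ 2 = s.θ.f y t ^ q * s.θ.f y t ^ (β - 1 - p) := by
      rw [← Real.rpow_natCast, ← Real.rpow_mul hθ.le, ← Real.rpow_add hθ]
      congr 1; rw [hq]; push_cast; ring
    set R := s.θ.f y t ^ (β - 1 - p)
    have hR : 0 < R := Real.rpow_pos_of_pos hθ _
    refine abs_le_of_sq_le_sq ?_ ?_
    · have e4 : (D * q ^ 2 / (2 * p)) * (p * R * s.θ.x y t ^ 2 / s.v y t)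
          ≤ (D * q ^ 2 / (2 * p)) * s.diss p y t := by gcongr
      have e5 : (D * q ^ 2 / (2 * p)) * (p * R * s.θ.x y t ^ 2 / s.v y t)
          = D * q ^ 2 / 2 * R * s.θ.x y t ^ 2 / s.v y t := by field_simp
      set X := s.S t ^ q / (2 * D) * s.v y t
      set Y := D * q ^ 2 / (2 * p) * s.diss p y t
      have X0 : 0 < X := by positivity
      have Y0 : 0 ≤ D * q ^ 2 / 2 * R * s.θ.x y t ^ 2 / s.v y t := by positivity
      have e6 : 4 * X * (D * q ^ 2 / 2 * R * s.θ.x y t ^ 2 / s.v y t)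
          = q ^ 2 * (s.S t ^ q * R) * s.θ.x y t ^ 2 := by
        simp only [X]; field_simp; ring
      calc (q * s.θ.f y t ^ (q - 1) * s.θ.x y t) ^ 2
          = q ^ 2 * (s.θ.f y t ^ q * R) * s.θ.x y t ^ 2 := by rw [← e3]; ring
        _ ≤ q ^ 2 * (s.S t ^ q * R) * s.θ.x y t ^ 2 := by gcongr
        _ ≤ 4 * X * Y := by rw [← e6]; gcongr; linarith
        _ ≤ (X + Y) ^ 2 := by nlinarith [sq_nonneg (X - Y)]
    · have := s.diss_nonneg hα hp.le y t
      positivity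
  have h2 := h.cell_v_le z ht
  have h3 := cell_le_of_cint (f := fun x => s.diss p x t) (by fun_prop)
    (fun x => s.diss_nonneg hα hp.le x t) (a := a) (x := z) (by linarith) le_rfl
  have cv : Continuous fun y => s.v y t := by fun_prop
  have cd : Continuous fun y => s.diss p y t := by fun_prop
  rw [intervalIntegral.integral_add ((cv.const_mul _).intervalIntegrable _ _)
    ((cd.const_mul _).intervalIntegrable _ _), intervalIntegral.integral_const_mul,
    intervalIntegral.integral_const_mul] at h1
  set I := cint a fun x => s.diss p x t
  have I0 : 0 ≤ I := cint_nonneg (by have := abs_nonneg z; linarith) fun x =>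
    s.diss_nonneg hα hp.le x t
  have h4 : s.S t ^ q / (2 * D) * (∫ y in z..(z + 1), s.v y t) ≤ s.S t ^ q / 2 := by
    calc _ ≤ s.S t ^ q / (2 * D) * D := by gcongr
      _ = _ := by field_simp
  have h5 : D * q ^ 2 / (2 * p) * (∫ y in z..(z + 1), s.diss p y t) ≤ D * q ^ 2 / p * I := by
    calc _ ≤ D * q ^ 2 / (2 * p) * (2 * I) := by gcongr
      _ = _ := by field_simp
  have h6 : s.S t ^ q ≤ 2 * D ^ q + 2 * (D * q ^ 2 / p * I) := by linarith
  refine h6.trans ?_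
  have h7 : 2 * (D * q ^ 2 / p * I) = 2 * D * q ^ 2 / p * I := by ring
  rw [h7, hC]
  nlinarith [mul_nonneg Dq.le I0, mul_nonneg hCD.le I0]

end Sol

namespace Sol
variable {α β T : ℝ} {s : Sol α β T} {c E : ℝ}

theorem Low.src_le (h : s.Low c E) (hα : 0 ≤ α) {p : ℝ} (hp0 : 0 < p) (hp1 : p ≤ 1) (x : ℝ)
    {t : ℝ} (ht : t ∈ Icc 0 T) :
    s.src p x t ≤ 1 / 4 * s.diss p x t + (16 / c + 8) * s.S t ^ (1 + p) * s.enG x t := by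
  have hv := s.v_pos x t
  have hθ := s.θ_pos x t
  have hc := h.c_pos
  have hvc := h.v_ge x t ht
  have hS := s.two_le_S t
  have hθS := s.θ_le_S x t
  have hk := inv_le_kap hα hv
  have e1 : (s.v x t)⁻¹ * s.u.x x t ^ 2 * s.θ.f x t ^ (-p) ≤ s.diss p x t := by
    have h1 : 0 ≤ p * s.θ.f x t ^ (β - 1 - p) * s.θ.x x t ^ 2 / s.v x t := by positivity
    have h2 : (s.v x t)⁻¹ * s.u.x x t ^ 2 * s.θ.f x t ^ (-p) ≤ (kap α (s.v x t) * s.u.x x t ^ 2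
      + (s.w₁.x x t ^ 2 + s.w₂.x x t ^ 2 + s.b₁.x x t ^ 2 + s.b₂.x x t ^ 2) / s.v x t)
      * s.θ.f x t ^ (-p) := by
      refine mul_le_mul_of_nonneg_right ?_ (Real.rpow_nonneg hθ.le _)
      have : 0 ≤ (s.w₁.x x t ^ 2 + s.w₂.x x t ^ 2 + s.b₁.x x t ^ 2 + s.b₂.x x t ^ 2) / s.v x t := by
        positivity
      have := mul_le_mul_of_nonneg_right hk (sq_nonneg (s.u.x x t))
      linarith
    unfold diss; linarith
  obtain ⟨-, -, -, -, g1, g2⟩ := s.parts_le_enG x t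
  have q1 := sq_sub_one_le_gd hθ
  have q2 := sq_sub_one_le_gd hv
  have q3 := abs_rpow_sub_one_le hp0.le hp1 hθ
  have g3 := gd_nonneg hθ
  have g4 := gd_nonneg hv
  have hθp : s.θ.f x t ^ p ≤ s.S t ^ p := Real.rpow_le_rpow hθ.le hθS hp0.le
  have hS1 : s.S t ^ (1 + p) = s.S t * s.S t ^ p := by
    rw [Real.rpow_add (by linarith), Real.rpow_one]
  have hSp : 0 < s.S t ^ p := Real.rpow_pos_of_pos (by linarith) _
  have hinv : s.θ.f x t ^ (-p) = (s.θ.f x t ^ p)⁻¹ := Real.rpow_neg hθ.le _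
  have hθpp : 0 < s.θ.f x t ^ p := Real.rpow_pos_of_pos hθ _
  set V := s.v x t
  set Q := s.θ.f x t ^ p
  set R := s.θ.f x t ^ (1 - p)
  set U := s.u.x x t
  have e2 : U * (R / V - 1) ≤ 1 / 4 * (V⁻¹ * U ^ 2 * Q⁻¹) + Q * ((R - V) ^ 2 / V) := by
    have : 1 / 4 * (V⁻¹ * U ^ 2 * Q⁻¹) + Q * ((R - V) ^ 2 / V) - U * (R / V - 1)
      = (U / 2 - Q * (R - V)) ^ 2 / (V * Q) := by field_simp; ring
    have h3 : 0 ≤ (U / 2 - Q * (R - V)) ^ 2 / (V * Q) := by positivity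
    linarith
  have e3 : (R - V) ^ 2 / V ≤ (16 / c + 8) * s.S t * s.enG x t := by
    have h1 : (R - V) ^ 2 ≤ 2 * (R - 1) ^ 2 + 2 * (V - 1) ^ 2 := by
      nlinarith [sq_nonneg (R + V - 2)]
    have h2 : (s.θ.f x t + 1) * gd (s.θ.f x t) ≤ 2 * s.S t * s.enG x t := by
      apply mul_le_mul <;> linarith
    have h3 : (V + 1) * gd V ≤ (V + 1) * s.enG x t := by gcongr
    rw [div_le_iff₀ hv]
    have h4 : 1 ≤ V / c := by rw [le_div_iff₀ hc]; linarith
    have h5 : 0 ≤ s.enG x t := s.enG_nonneg x t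
    have h6 : 0 ≤ s.S t * s.enG x t := by positivity
    have h7 : s.S t * s.enG x t ≤ V / c * (s.S t * s.enG x t) := le_mul_of_one_le_left h6 h4
    have h8 : (V + 1) * s.enG x t ≤ (V + V / c) * s.enG x t := by gcongr
    have h9 : (V + V / c) * s.enG x t ≤ (V + V / c) * (s.S t * s.enG x t) := by
      gcongr; nlinarith
    calc (R - V) ^ 2 ≤ 8 * (s.S t * s.enG x t) + 4 * ((V + 1) * s.enG x t) := by linarith
      _ ≤ 8 * (V / c * (s.S t * s.enG x t)) + 4 * ((V + V / c) * (s.S t * s.enG x t)) := by linarith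
      _ ≤ (16 / c + 8) * s.S t * s.enG x t * V := by
        have : 0 ≤ V * (s.S t * s.enG x t) := by positivity
        have h10 : 0 ≤ V / c * (s.S t * s.enG x t) := by positivity
        have : (16 / c + 8) * s.S t * s.enG x t * V
          = 16 * (V / c * (s.S t * s.enG x t)) + 8 * (V * (s.S t * s.enG x t)) := by field_simp
        nlinarith
  have e4 : Q * ((R - V) ^ 2 / V) ≤ s.S t ^ p * ((16 / c + 8) * s.S t * s.enG x t) := by
    gcongr
  unfold src
  rw [hinv] at e1
  calc _ ≤ 1 / 4 * (V⁻¹ * U ^ 2 * Q⁻¹) + Q * ((R - V) ^ 2 / V) := e2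
    _ ≤ 1 / 4 * s.diss p x t + s.S t ^ p * ((16 / c + 8) * s.S t * s.enG x t) := by linarith
    _ = _ := by rw [hS1]; ring

theorem hp_le_enG {p : ℝ} (hp1 : p < 1) (x t : ℝ) : s.en (hp p) x t ≤ s.enG x t := by
  have h1 := hp_le_gd hp1 (s.θ_pos x t)
  have h2 := gd_nonneg (s.v_pos x t)
  unfold enG en
  linarith

theorem exists_int_diss (hα : 0 ≤ α) (hT : 0 < T) {p : ℝ} (hp0 : 0 < p) (hp1 : p < 1)
    (hpβ : 2 * p < β) (hc : 0 < c) (hE : 1 ≤ E) :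
    ∃ D, 0 < D ∧ ∀ s : Sol α β T, s.Low c E → ∀ᶠ a in atTop,
      ∫ t in (0:ℝ)..T, (cint a fun x => s.diss p x t) ≤ D := by
  obtain ⟨C₁, hC₁, h1⟩ := exists_S_rpow_le_diss (T := T) (β := β) hα hp0 (by linarith) hE
  set C₂ := (16 / c + 8) * E with hC₂
  have hC₂p : 0 < C₂ := by positivity
  obtain ⟨C₃, hC₃, h3⟩ := exists_rpow_le (r := 1 + p) (q := β + 1 - p) (η := 1 / (8 * C₁ * C₂))
    (by linarith) (by linarith) (by positivity)
  set C₄ := E + 1 + 1 / 8 + C₂ * C₃ with hC₄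
  have hC₄p : 0 < C₄ := by positivity
  refine ⟨8 * (E + C₄ * T), by positivity, fun s h => ?_⟩
  filter_upwards [s.energy_ineq hα hp0 (fun z hz => hasDerivAt_hp hp1 hz)
    fun z => hp_nonneg hp0.le hp1, h1 s h.toBase, h.cint_le, eventually_gt_atTop 0]
    with a ha hS hG ha0
  have cn := s.continuous_en fun z hz => hasDerivAt_hp hp1 hz
  have cd : Continuous fun t => cint a fun x => s.diss p x t := continuous_cint (by fun_prop)
  have hd0 : ∀ t, 0 ≤ cint a fun x => s.diss p x t := fun t =>
    cint_nonneg ha0 fun x => s.diss_nonneg hα hp0.le x t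
  have hle : ∀ t ∈ Icc 0 T, cint a (fun x => s.en (hp p) x t) ≤ E := fun t ht =>
    (cint_mono ha0 (cont_slice cn t) (by fun_prop) fun x => hp_le_enG hp1 x t).trans (hG t ht)
  have hn0 : ∀ t, 0 ≤ cint a fun x => s.en (hp p) x t := fun t => cint_nonneg ha0 fun x =>
    le_trans (by positivity) (s.kinetic_le_en (fun z => hp_nonneg hp0.le hp1) x t)
  have key := gronwall_dissipation (T := T) (y := fun t => cint a (fun x => s.en (hp p) x t))
    (y' := fun t => cint a (fun x => s.ent p x t)) (A := fun _ => 0) (c := fun _ => C₄)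
    (d := fun t => 1 / 8 * cint a fun x => s.diss p x t)
    (continuous_cint cn).continuousOn continuous_const continuous_const (cd.const_mul _)
    (by simp) (fun _ _ => hC₄p.le) (fun t _ => by have := hd0 t; positivity)
    (fun t ht => (ha t ht).1)
    (fun t ht => by
      have ht' := Ioo_subset_Icc_self ht
      have k1 := (ha t ht).2
      have k2 : cint a (fun x => s.src p x t) ≤ cint a fun x => (1 / 4 * s.diss p x t
          + (16 / c + 8) * s.S t ^ (1 + p) * s.enG x t) :=
        cint_mono ha0 (by fun_prop) (by fun_prop) fun x => h.src_le hα hp0 hp1.le x ht'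
      rw [cint_add (by fun_prop) (by fun_prop), cint_const_mul, cint_const_mul] at k2
      have hSp : 0 < s.S t := by have := s.two_le_S t; linarith
      have k3 := hG t ht'
      have k4 := hle t ht'
      have k5 := h3 (s.S t) hSp
      have k6 := hS t ht'
      have hSq := Real.rpow_pos_of_pos hSp (1 + p)
      have k7 : (16 / c + 8) * s.S t ^ (1 + p) * cint a (fun x => s.enG x t)
          ≤ C₂ * s.S t ^ (1 + p) := by
        calc _ ≤ (16 / c + 8) * s.S t ^ (1 + p) * E := by gcongr
          _ = _ := by rw [hC₂]; ring
      have k8 : C₂ * s.S t ^ (1 + p)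
          ≤ 1 / 8 * (1 + cint a fun x => s.diss p x t) + C₂ * C₃ := by
        calc C₂ * s.S t ^ (1 + p) ≤ C₂ * (1 / (8 * C₁ * C₂) * s.S t ^ (β + 1 - p) + C₃) := by gcongr
          _ = s.S t ^ (β + 1 - p) / (8 * C₁) + C₂ * C₃ := by field_simp
          _ ≤ C₁ * (1 + cint a fun x => s.diss p x t) / (8 * C₁) + C₂ * C₃ := by gcongr
          _ = _ := by field_simp
      linarith) T ⟨hT.le, le_rfl⟩
  simp only [intervalIntegral.integral_zero, Real.exp_zero, mul_one,
    intervalIntegral.integral_const, sub_zero, smul_eq_mul, intervalIntegral.integral_const_mul]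
    at key
  have := hle 0 ⟨le_rfl, hT.le⟩
  have := hn0 T
  nlinarith

variable (s) in
theorem abs_S_mul_le (hα : 0 ≤ α) {p : ℝ} (hp0 : 0 ≤ p) (z t : ℝ) :
    |s.S t ^ p * (2 * (s.b₁.f z t * s.b₁.x z t) + 2 * (s.b₂.f z t * s.b₂.x z t))|
      ≤ 2 * s.S t ^ (3 * p) * s.enG z t + s.diss p z t := by
  have hS := s.two_le_S t
  have hSp : 0 < s.S t ^ p := Real.rpow_pos_of_pos (by linarith) _
  have hv := s.v_pos z t
  have hθ := s.θ_pos z t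
  have e1 : (s.b₁.x z t ^ 2 + s.b₂.x z t ^ 2) / s.v z t * s.θ.f z t ^ (-p) ≤ s.diss p z t := by
    have h1 : 0 ≤ p * s.θ.f z t ^ (β - 1 - p) * s.θ.x z t ^ 2 / s.v z t := by positivity
    have := kap_pos hα hv
    have h2 : (s.b₁.x z t ^ 2 + s.b₂.x z t ^ 2) / s.v z t * s.θ.f z t ^ (-p)
      ≤ (kap α (s.v z t) * s.u.x z t ^ 2
      + (s.w₁.x z t ^ 2 + s.w₂.x z t ^ 2 + s.b₁.x z t ^ 2 + s.b₂.x z t ^ 2) / s.v z t)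
      * s.θ.f z t ^ (-p) := by
      refine mul_le_mul_of_nonneg_right ?_ (Real.rpow_nonneg hθ.le _)
      refine le_add_of_nonneg_of_le (by positivity) ?_
      gcongr
      linarith [sq_nonneg (s.w₁.x z t), sq_nonneg (s.w₂.x z t)]
    unfold diss; linarith
  have e2 : 1 ≤ s.S t ^ p * s.θ.f z t ^ (-p) := by
    rw [Real.rpow_neg hθ.le, ← div_eq_mul_inv, one_le_div (Real.rpow_pos_of_pos hθ _)]
    exact Real.rpow_le_rpow hθ.le (s.θ_le_S z t) hp0
  obtain ⟨-, -, -, g, -⟩ := s.parts_le_enG z t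
  have e3 : s.S t ^ (3 * p) = s.S t ^ p * s.S t ^ p * s.S t ^ p := by
    rw [← Real.rpow_add (by linarith), ← Real.rpow_add (by linarith)]; congr 1; ring
  set b1 := s.b₁.f z t
  set b2 := s.b₂.f z t
  set c1 := s.b₁.x z t
  set c2 := s.b₂.x z t
  set Q := s.S t ^ p
  set R := s.θ.f z t ^ (-p)
  have hR : 0 < R := Real.rpow_pos_of_pos hθ _
  set V := s.v z t
  have e4 : |Q * (2 * (b1 * c1) + 2 * (b2 * c2))|
      ≤ Q * Q * Q * (V * (b1 ^ 2 + b2 ^ 2)) + (c1 ^ 2 + c2 ^ 2) / V * R := by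
    refine abs_le_of_sq_le_sq ?_ (by positivity)
    have f1 : (b1 * c1 + b2 * c2) ^ 2 ≤ (b1 ^ 2 + b2 ^ 2) * (c1 ^ 2 + c2 ^ 2) := by
      nlinarith [sq_nonneg (b1 * c2 - b2 * c1)]
    calc (Q * (2 * (b1 * c1) + 2 * (b2 * c2))) ^ 2 = 4 * (Q * Q) * (b1 * c1 + b2 * c2) ^ 2 := by
          ring
      _ ≤ 4 * (Q * Q) * ((b1 ^ 2 + b2 ^ 2) * (c1 ^ 2 + c2 ^ 2)) := by gcongr
      _ ≤ 4 * (Q * Q) * ((b1 ^ 2 + b2 ^ 2) * (c1 ^ 2 + c2 ^ 2)) * (Q * R) :=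
          le_mul_of_one_le_right (by positivity) e2
      _ = 4 * (Q * Q * Q * (V * (b1 ^ 2 + b2 ^ 2))) * ((c1 ^ 2 + c2 ^ 2) / V * R) := by
          field_simp
      _ ≤ _ := by
          nlinarith [sq_nonneg (Q * Q * Q * (V * (b1 ^ 2 + b2 ^ 2)) - (c1 ^ 2 + c2 ^ 2) / V * R)]
  rw [e3]
  have e5 : Q * Q * Q * (V * (b1 ^ 2 + b2 ^ 2)) ≤ Q * Q * Q * (2 * s.enG z t) :=
    mul_le_mul_of_nonneg_left (by linarith) (by positivity)
  linarith

/-- The maximal magnetic energy is controlled by the dissipation. -/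
theorem Low.B_mul_S_rpow_le (h : s.Low c E) (hα : 0 ≤ α) {p : ℝ} (hp0 : 0 < p) (hp1 : 3 * p ≤ 1) :
    ∀ᶠ a in atTop, ∀ t ∈ Icc 0 T, s.B t * s.S t ^ p
      ≤ (1 + 2 * E / c + 2 * E) * s.S t + 2 * cint a fun x => s.diss p x t := by
  obtain ⟨M, hM0, hM⟩ := s.exists_rad
  have hc := h.c_pos
  have hE := h.one_le
  filter_upwards [eventually_ge_atTop (2 * M + 2)] with a ha t ht
  have hS := s.two_le_S t
  have ha0 : 0 < a := by linarith
  have hd0 : 0 ≤ cint a fun x => s.diss p x t := cint_nonneg ha0 fun x =>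
    s.diss_nonneg hα hp0.le x t
  have hSp : 0 < s.S t ^ p := Real.rpow_pos_of_pos (by linarith) _
  have hSp1 : s.S t ^ p ≤ s.S t := by
    simpa using Real.rpow_le_rpow_of_exponent_le (by linarith : 1 ≤ s.S t) (by linarith : p ≤ 1)
  have hS3 : s.S t ^ (3 * p) ≤ s.S t := by
    simpa using Real.rpow_le_rpow_of_exponent_le (by linarith : 1 ≤ s.S t) hp1
  have hS3p : 0 < s.S t ^ (3 * p) := Real.rpow_pos_of_pos (by linarith) _
  have hEc : 0 ≤ 2 * E / c := by positivity
  rcases s.B_eq t with h1 | ⟨x, hx⟩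
  · rw [h1]; nlinarith [mul_nonneg hEc (by linarith : 0 ≤ s.S t)]
  have hxM : |x| ≤ M := by
    by_contra! hcon
    obtain ⟨-, -, -, k1, k2, -⟩ := hM x t hcon.le
    have := s.one_le_B t
    have := sq_lt_sq' (abs_lt.1 k1).1 (abs_lt.1 k1).2
    have := sq_lt_sq' (abs_lt.1 k2).1 (abs_lt.1 k2).2
    linarith
  obtain ⟨y, hy, hy'⟩ := exists_le_integral_cell
    (f := fun y => s.b₁.f y t ^ 2 + s.b₂.f y t ^ 2) (by fun_prop) x
  have k1 : ∫ y in x..(x + 1), (s.b₁.f y t ^ 2 + s.b₂.f y t ^ 2) ≤ 2 * E / c := by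
    refine (integral_le_of_le (by linarith) (by fun_prop) (g := fun y => 2 / c * s.enG y t + 0)
      (by fun_prop) fun y _ => ?_).trans
      (integral_const_mul_add_le (f := fun y => s.enG y t) (by fun_prop) (by positivity) x
        (h.cell x t ht) (by rw [add_zero]; exact le_of_eq (by ring)))
    obtain ⟨-, -, -, g, -⟩ := s.parts_le_enG y t
    have := h.v_ge y t ht
    rw [add_zero, div_mul_eq_mul_div, le_div_iff₀ hc]
    nlinarith [sq_nonneg (s.b₁.f y t), sq_nonneg (s.b₂.f y t)]
  have k2 := sub_le_integral_cell (g := fun y => s.S t ^ p * (s.b₁.f y t ^ 2 + s.b₂.f y t ^ 2))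
    (gx := fun y => s.S t ^ p * (2 * (s.b₁.f y t * s.b₁.x y t) + 2 * (s.b₂.f y t * s.b₂.x y t)))
    (m := fun y => 2 * s.S t ^ (3 * p) * s.enG y t + s.diss p y t) (x := x) (y := y) (z := x)
    (fun y => (((s.b₁.hx y t).pow 2).add ((s.b₂.hx y t).pow 2)).const_mul _ |>.congr_deriv (by
      simp; left; ring)) (by fun_prop) (by fun_prop) ⟨le_rfl, by linarith⟩ hy
    fun z _ => s.abs_S_mul_le hα hp0.le z t
  have ce : Continuous fun y => s.enG y t := by fun_prop
  have cd : Continuous fun y => s.diss p y t := by fun_prop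
  rw [intervalIntegral.integral_add ((ce.const_mul _).intervalIntegrable _ _)
    (cd.intervalIntegrable _ _), intervalIntegral.integral_const_mul] at k2
  have k3 := h.cell x t ht
  have k4 := cell_le_of_cint (f := fun x => s.diss p x t) (by fun_prop)
    (fun x => s.diss_nonneg hα hp0.le x t) (a := a) (x := x) (by linarith) le_rfl
  have k5 : s.S t ^ p * (s.b₁.f y t ^ 2 + s.b₂.f y t ^ 2) ≤ s.S t * (2 * E / c) := by
    have := hy'.trans k1
    gcongr
  have k6 : 2 * s.S t ^ (3 * p) * (∫ y in x..(x + 1), s.enG y t) ≤ 2 * s.S t * E := by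
    have : 0 ≤ ∫ y in x..(x + 1), s.enG y t :=
      intervalIntegral.integral_nonneg (by linarith) fun y _ => s.enG_nonneg y t
    gcongr
  rw [hx, mul_comm (_ + _) (s.S t ^ p)]
  linarith

/-- Integrated bounds obtained from the weighted energy inequality. -/
structure Mid (s : Sol α β T) (p D : ℝ) : Prop where
  one_le : 1 ≤ D
  diss_le : ∀ᶠ a in atTop, ∫ t in (0:ℝ)..T, (cint a fun x => s.diss p x t) ≤ D
  S_le : ∫ t in (0:ℝ)..T, s.S t ≤ D
  BS_le : ∫ t in (0:ℝ)..T, s.B t * s.S t ^ p ≤ D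
  B_le : ∫ t in (0:ℝ)..T, s.B t ≤ D

theorem exists_mid (hα : 0 ≤ α) (hT : 0 < T) {p : ℝ} (hp0 : 0 < p) (hp1 : 3 * p ≤ 1)
    (hpβ : 2 * p < β) (hc : 0 < c) (hE : 1 ≤ E) :
    ∃ D, 0 ≤ D ∧ ∀ s : Sol α β T, s.Low c E → s.Mid p D := by
  obtain ⟨D, hD, h1⟩ := exists_int_diss (T := T) (β := β) hα hT hp0 (by linarith) hpβ hc hE
  obtain ⟨C₁, hC₁, h2⟩ := exists_S_rpow_le_diss (T := T) (β := β) hα hp0 (by linarith) hE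
  set C₂ := 1 + 2 * E / c + 2 * E with hC₂
  have hC₂p : 0 < C₂ := by positivity
  set D₁ := C₁ * (T + D) with hD₁
  have hD₁p : 0 < D₁ := by positivity
  refine ⟨1 + D + D₁ + (C₂ * D₁ + 2 * D), by positivity, fun s h => ?_⟩
  obtain ⟨a, ha1, ha2, ha3, ha0⟩ := ((h1 s h).and ((h2 s h.toBase).and
    ((h.B_mul_S_rpow_le hα hp0 hp1).and (eventually_gt_atTop 0)))).exists
  have cd : Continuous fun t => cint a fun x => s.diss p x t := continuous_cint (by fun_prop)
  have cB : Continuous s.B := s.continuous_B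
  have cS : Continuous s.S := s.continuous_S
  have cBS : Continuous fun t => s.B t * s.S t ^ p := cB.mul
    (cS.rpow_const fun t => Or.inl (by have := s.two_le_S t; linarith))
  have kS : ∫ t in (0:ℝ)..T, s.S t ≤ D₁ := by
    calc ∫ t in (0:ℝ)..T, s.S t ≤ ∫ t in (0:ℝ)..T, C₁ * (1 + cint a fun x => s.diss p x t) := by
          refine integral_le_of_le hT.le cS (by fun_prop) fun t ht => ?_
          have hS := s.two_le_S t
          refine le_trans ?_ (ha2 t ht)
          simpa using Real.rpow_le_rpow_of_exponent_le (by linarith : 1 ≤ s.S t)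
            (by linarith : 1 ≤ β + 1 - p)
      _ = C₁ * (T + ∫ t in (0:ℝ)..T, cint a fun x => s.diss p x t) := by
          rw [intervalIntegral.integral_const_mul, intervalIntegral.integral_add (by simp)
            (cd.intervalIntegrable _ _)]
          simp
      _ ≤ D₁ := by rw [hD₁]; gcongr
  have kBS : ∫ t in (0:ℝ)..T, s.B t * s.S t ^ p ≤ C₂ * D₁ + 2 * D := by
    calc _ ≤ ∫ t in (0:ℝ)..T, (C₂ * s.S t + 2 * cint a fun x => s.diss p x t) :=
          integral_le_of_le hT.le cBS (by fun_prop) fun t ht => ha3 t ht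
      _ = C₂ * (∫ t in (0:ℝ)..T, s.S t) + 2 * ∫ t in (0:ℝ)..T, cint a fun x => s.diss p x t := by
          rw [intervalIntegral.integral_add ((cS.const_mul _).intervalIntegrable _ _)
            ((cd.const_mul _).intervalIntegrable _ _), intervalIntegral.integral_const_mul,
            intervalIntegral.integral_const_mul]
      _ ≤ _ := by gcongr
  have kB : ∫ t in (0:ℝ)..T, s.B t ≤ ∫ t in (0:ℝ)..T, s.B t * s.S t ^ p :=
    integral_le_of_le hT.le cB cBS fun t _ => by
      have hS := s.two_le_S t
      have := s.one_le_B t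
      exact le_mul_of_one_le_right (by linarith) (Real.one_le_rpow (by linarith) hp0.le)
  have q1 : 0 < C₂ * D₁ := by positivity
  refine ⟨by linarith, ?_, by linarith, by linarith, by linarith⟩
  filter_upwards [h1 s h] with a ha
  linarith

end Sol

theorem integral_add_mul {f g : ℝ → ℝ} (cf : Continuous f) (cg : Continuous g) (a b x y : ℝ) :
    ∫ t in x..y, (a * f t + b * g t) = a * (∫ t in x..y, f t) + b * ∫ t in x..y, g t := by
  rw [intervalIntegral.integral_add ((cf.const_mul _).intervalIntegrable _ _)
    ((cg.const_mul _).intervalIntegrable _ _), intervalIntegral.integral_const_mul,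
    intervalIntegral.integral_const_mul]

namespace Sol
variable {α β T : ℝ} {s : Sol α β T} {p c E D V : ℝ}

theorem exists_v_le (hα : 0 ≤ α) (hT : 0 < T) (hc : 0 < c) :
    ∃ V, 1 ≤ V ∧ ∀ s : Sol α β T, s.Low c E → s.Mid p D → ∀ x, ∀ t ∈ Icc 0 T, s.v x t ≤ V := by
  obtain ⟨V, hV⟩ := Base.v_upper (β := β) (T := T) hα hc E (1 / c * D + 1 / 2 * D)
  refine ⟨max 1 V, le_max_left _ _, fun s h m x t ht =>
    (hV s h.toBase h.v_ge (fun x t ht => ?_) x t ht).trans (le_max_right _ _)⟩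
  have cP : Continuous fun t => s.P x t := by fun_prop
  have cB : Continuous s.B := s.continuous_B
  have cS : Continuous s.S := s.continuous_S
  calc s.N x t ≤ ∫ τ in (0:ℝ)..T, s.P x τ :=
        integral_le_of_subset cP le_rfl ht.1 ht.2 (fun τ _ => s.P_nonneg x τ)
    _ ≤ ∫ τ in (0:ℝ)..T, (1 / c * s.S τ + 1 / 2 * s.B τ) := by
        refine integral_le_of_le hT.le cP (by fun_prop) fun τ hτ => ?_
        have h1 := s.θ_le_S x τ
        have h2 := s.b_le_B x τ
        have h3 := h.v_ge x τ hτ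
        have h4 := s.θ_pos x τ
        have h5 : 0 ≤ s.S τ := h4.le.trans h1
        have : s.θ.f x τ / s.v x τ ≤ s.S τ / c := by gcongr
        unfold P
        rw [one_div_mul_eq_div]
        linarith
    _ = 1 / c * (∫ τ in (0:ℝ)..T, s.S τ) + 1 / 2 * ∫ τ in (0:ℝ)..T, s.B τ := by
        rw [intervalIntegral.integral_add ((cS.const_mul _).intervalIntegrable _ _)
          ((cB.const_mul _).intervalIntegrable _ _), intervalIntegral.integral_const_mul,
          intervalIntegral.integral_const_mul]
    _ ≤ 1 / c * D + 1 / 2 * D := by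
        have := m.S_le
        have := m.B_le
        gcongr

variable (s)

/-- Spatial derivative of the total pressure. -/
def Px (x t : ℝ) : ℝ := s.θ.x x t / s.v x t - s.θ.f x t * s.vx x t / s.v x t ^ 2
  + s.b₁.f x t * s.b₁.x x t + s.b₂.f x t * s.b₂.x x t

theorem hasDerivAt_P (x t : ℝ) : HasDerivAt (fun y => s.P y t) (s.Px x t) x := by
  have h := ((s.θ.hx x t).div (s.hvx x t) (s.v_ne x t)).add
    ((((s.b₁.hx x t).pow 2).add ((s.b₂.hx x t).pow 2)).div_const 2)
  refine h.congr_deriv ?_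
  have := s.v_ne x t
  unfold Px
  simp
  field_simp
  ring

@[fun_prop]
theorem continuous_Px {X : Type*} [TopologicalSpace X] {g h : X → ℝ} (hg : Continuous g)
    (hh : Continuous h) : Continuous fun z => s.Px (g z) (h z) := by
  unfold Px; fun_prop (disch := simp)

theorem hasDerivAt_N_x (x t : ℝ) :
    HasDerivAt (fun y => s.N y t) (∫ τ in (0:ℝ)..t, s.Px x τ) x := by
  have h := hasDerivAt_integral_of_continuous (T := 2) (a := 0) (b := t)
    (E := fun τ y => s.P (y + (x - 1)) τ) (Et := fun τ y => s.Px (y + (x - 1)) τ)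
    (by fun_prop) (by fun_prop) (fun τ y _ => (s.hasDerivAt_P _ τ).comp_add_const y (x - 1))
    (t := 1) (by simp)
  rw [show (1:ℝ) + (x - 1) = x by ring] at h
  have h2 := HasDerivAt.comp_sub_const (f := fun y => ∫ τ in (0:ℝ)..t, s.P (y + (x - 1)) τ)
    x (x - 1)
    (by rw [sub_sub_cancel]; exact h)
  simpa [N] using h2

/-- Effective momentum `κ(v) v_x - u`, written through its evolution in time. -/
def R (x t : ℝ) : ℝ :=
  kap α (s.v x 0) * s.vx x 0 - s.u.f x 0 + ∫ τ in (0:ℝ)..t, s.Px x τ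

theorem R_eq (x : ℝ) {t : ℝ} (ht : t ∈ Icc 0 T) :
    s.R x t = kap α (s.v x t) * s.vx x t - s.u.f x t := by
  have hi : ∀ τ, HasDerivAt (fun y => ∫ z in (0:ℝ)..y, s.u.f z τ) (s.u.f x τ) x := fun τ =>
    intervalIntegral.integral_hasDerivAt_right
      ((by fun_prop : Continuous fun z => s.u.f z τ).intervalIntegrable _ _)
      ((by fun_prop : Continuous fun z => s.u.f z τ).stronglyMeasurableAtFilter _ _)
      (by fun_prop : Continuous fun z => s.u.f z τ).continuousAt
  have hp : ∀ τ, HasDerivAt (fun y => pot α (s.v y τ)) (kap α (s.v x τ) * s.vx x τ) x := fun τ =>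
    (s.hvx x τ).pot_comp α (s.v_pos x τ)
  have h1 := ((hp t).sub (s.hasDerivAt_N_x x t)).sub_const (pot α (s.v 0 t) - s.N 0 t)
  have h2 := ((hi t).sub (hi 0)).add ((hp 0).sub_const (pot α (s.v 0 0)))
  have h3 := h1.unique (h2.congr_of_eventuallyEq (Eventually.of_forall fun y =>
    s.pot_sub_N_sub y 0 ht))
  unfold R
  linarith

theorem hasDerivAt_R (x t : ℝ) : HasDerivAt (fun t => s.R x t) (s.Px x t) t := by
  have c : Continuous fun τ => s.Px x τ := by fun_prop
  exact (intervalIntegral.integral_hasDerivAt_right (c.intervalIntegrable _ _)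
    (c.stronglyMeasurableAtFilter _ _) c.continuousAt).const_add _

@[fun_prop]
theorem continuous_R {X : Type*} [TopologicalSpace X] {g h : X → ℝ} (hg : Continuous g)
    (hh : Continuous h) : Continuous fun z => s.R (g z) (h z) := by
  have hN : Continuous fun z => ∫ τ in (0:ℝ)..h z, s.Px (g z) τ :=
    intervalIntegral.continuous_parametric_intervalIntegral_of_continuous (by fun_prop) (by fun_prop)
  unfold R
  fun_prop

variable {s}

theorem Low.R_mul_Px_le (h : s.Low c E) (hα : 0 ≤ α) (hp0 : 0 < p) (hpβ : p ≤ β)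
    (hV : ∀ x, ∀ t ∈ Icc 0 T, s.v x t ≤ V) (x : ℝ) {t : ℝ} (ht : t ∈ Icc 0 T) :
    2 * s.R x t * s.Px x t ≤ (1 / c + c ^ (p - β) / (p * c)) * s.S t * s.R x t ^ 2
      + V * (s.B t * s.S t ^ p) * s.R x t ^ 2 + 1 / c * s.S t * s.u.f x t ^ 2
      + s.diss p x t := by
  have hv := s.v_pos x t
  have hθ := s.θ_pos x t
  have hc := h.c_pos
  have hvc := h.v_ge x t ht
  have hθc := h.θ_ge x t ht
  have hvV := hV x t ht
  have hS := s.two_le_S t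
  have hθS := s.θ_le_S x t
  have hB := s.b_le_B x t
  have hk := inv_le_kap hα hv
  have hkp := kap_pos hα hv
  have hR := s.R_eq x ht
  have hSp : s.θ.f x t ^ p ≤ s.S t ^ p := Real.rpow_le_rpow hθ.le hθS hp0.le
  have e1 : p * s.θ.f x t ^ (β - 1 - p) * s.θ.x x t ^ 2 / s.v x t
      + (s.b₁.x x t ^ 2 + s.b₂.x x t ^ 2) / s.v x t * s.θ.f x t ^ (-p) ≤ s.diss p x t := by
    unfold diss
    gcongr
    refine le_add_of_nonneg_of_le (by positivity) ?_
    gcongr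
    linarith [sq_nonneg (s.w₁.x x t), sq_nonneg (s.w₂.x x t)]
  have e2 : s.θ.f x t ^ (β - 1 - p) * (s.θ.f x t * s.θ.f x t ^ (p - β)) = 1 := by
    calc _ = s.θ.f x t ^ (β - 1 - p) * (s.θ.f x t ^ (1:ℝ) * s.θ.f x t ^ (p - β)) := by
          rw [Real.rpow_one]
      _ = 1 := by
          rw [← Real.rpow_add hθ, ← Real.rpow_add hθ]
          ring_nf
          simp
  have e3 : s.θ.f x t ^ (-p) * s.θ.f x t ^ p = 1 := by
    rw [← Real.rpow_add hθ]; simp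
  have e4 : s.θ.f x t * s.θ.f x t ^ (p - β) ≤ s.S t * c ^ (p - β) := by
    have : s.θ.f x t ^ (p - β) ≤ c ^ (p - β) :=
      Real.rpow_le_rpow_of_nonpos hc hθc (by linarith)
    gcongr
  have hX := Real.rpow_pos_of_pos hθ (β - 1 - p)
  have hY := Real.rpow_pos_of_pos hθ (p - β)
  have hZ := Real.rpow_pos_of_pos hθ (-p)
  have hW := Real.rpow_pos_of_pos hθ p
  have hcY := Real.rpow_pos_of_pos hc (p - β)
  set X := s.θ.f x t ^ (β - 1 - p)
  set Y := s.θ.f x t ^ (p - β)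
  set Z := s.θ.f x t ^ (-p)
  set W := s.θ.f x t ^ p
  set r := s.R x t
  set v := s.v x t
  set b1 := s.b₁.f x t
  set b2 := s.b₂.f x t
  set c1 := s.b₁.x x t
  set c2 := s.b₂.x x t
  have t1 : 2 * r * (s.θ.x x t / v) ≤ c ^ (p - β) / (p * c) * s.S t * r ^ 2
      + p * X * s.θ.x x t ^ 2 / v := by
    have f1 : 2 * r * (s.θ.x x t / v) ≤ (s.θ.f x t * Y) / (p * v) * r ^ 2
        + p * X * s.θ.x x t ^ 2 / v := by
      have : (s.θ.f x t * Y) / (p * v) * r ^ 2 + p * X * s.θ.x x t ^ 2 / v - 2 * r * (s.θ.x x t / v)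
        = ((s.θ.f x t * Y) * r - p * (X * (s.θ.f x t * Y)) * s.θ.x x t) ^ 2
          / (p * v * (s.θ.f x t * Y)) := by
        have hX2 : X = (s.θ.f x t * Y)⁻¹ := eq_inv_of_mul_eq_one_left e2
        rw [e2, hX2]
        field_simp
        ring
      have h0 : 0 ≤ ((s.θ.f x t * Y) * r - p * (X * (s.θ.f x t * Y)) * s.θ.x x t) ^ 2
          / (p * v * (s.θ.f x t * Y)) := by positivity
      linarith
    have f2 : (s.θ.f x t * Y) / (p * v) * r ^ 2 ≤ (s.S t * c ^ (p - β)) / (p * c) * r ^ 2 := by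
      gcongr
    have f3 : (s.S t * c ^ (p - β)) / (p * c) * r ^ 2 = c ^ (p - β) / (p * c) * s.S t * r ^ 2 := by
      ring
    linarith
  have t2 : 2 * r * (b1 * c1 + b2 * c2) ≤ V * (s.B t * s.S t ^ p) * r ^ 2
      + (c1 ^ 2 + c2 ^ 2) / v * Z := by
    have hZ2 : Z = W⁻¹ := eq_inv_of_mul_eq_one_left e3
    have f1 : 2 * r * (b1 * c1 + b2 * c2) ≤ v * ((b1 ^ 2 + b2 ^ 2) * W) * r ^ 2
      + (c1 ^ 2 + c2 ^ 2) / v * Z := by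
      have : v * ((b1 ^ 2 + b2 ^ 2) * W) * r ^ 2 + (c1 ^ 2 + c2 ^ 2) / v * Z
          - 2 * r * (b1 * c1 + b2 * c2)
        = ((v * W * r * b1 - c1) ^ 2 + (v * W * r * b2 - c2) ^ 2) / (v * W) := by
        rw [hZ2]; field_simp; ring
      have h0 : 0 ≤ ((v * W * r * b1 - c1) ^ 2 + (v * W * r * b2 - c2) ^ 2) / (v * W) := by
        positivity
      linarith
    have : v * ((b1 ^ 2 + b2 ^ 2) * W) * r ^ 2 ≤ V * (s.B t * s.S t ^ p) * r ^ 2 := by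
      have : 0 ≤ s.B t := (by positivity : (0:ℝ) ≤ b1 ^ 2 + b2 ^ 2).trans hB
      have : 0 ≤ V := by linarith
      gcongr
    linarith
  have t3 : 2 * r * (-(s.θ.f x t * s.vx x t / v ^ 2))
      ≤ 1 / c * s.S t * r ^ 2 + 1 / c * s.S t * s.u.f x t ^ 2 := by
    have f1 : s.vx x t = (r + s.u.f x t) / kap α v := by
      rw [eq_div_iff hkp.ne']; linarith
    have f2 : 2 * r * (-(s.θ.f x t * s.vx x t / v ^ 2))
        ≤ s.θ.f x t / (kap α v * v ^ 2) * (r ^ 2 + s.u.f x t ^ 2) := by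
      have : s.θ.f x t / (kap α v * v ^ 2) * (r ^ 2 + s.u.f x t ^ 2)
        - 2 * r * (-(s.θ.f x t * s.vx x t / v ^ 2))
        = s.θ.f x t / (kap α v * v ^ 2) * (2 * r ^ 2 + (r + s.u.f x t) ^ 2) := by
        rw [f1]; field_simp; ring
      have h0 : 0 ≤ s.θ.f x t / (kap α v * v ^ 2) * (2 * r ^ 2 + (r + s.u.f x t) ^ 2) := by
        positivity
      linarith
    have f3 : c ≤ kap α v * v ^ 2 := by
      have : v⁻¹ * v ^ 2 ≤ kap α v * v ^ 2 := by gcongr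
      have h2 : v⁻¹ * v ^ 2 = v := by field_simp
      linarith
    have f4 : s.θ.f x t / (kap α v * v ^ 2) * (r ^ 2 + s.u.f x t ^ 2)
      ≤ s.S t / c * (r ^ 2 + s.u.f x t ^ 2) := by gcongr
    have : s.S t / c * (r ^ 2 + s.u.f x t ^ 2)
      = 1 / c * s.S t * r ^ 2 + 1 / c * s.S t * s.u.f x t ^ 2 := by ring
    linarith
  have : 2 * r * s.Px x t = 2 * r * (s.θ.x x t / v) + 2 * r * (-(s.θ.f x t * s.vx x t / v ^ 2))
    + 2 * r * (b1 * c1 + b2 * c2) := by unfold Px; ring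
  rw [this]
  linarith

/-- The squared gradient of the specific volume is bounded. -/
theorem exists_vx_le (hα : 0 ≤ α) (hp0 : 0 < p) (hpβ : p ≤ β) (hc : 0 < c)
    (hE : 1 ≤ E) (hV1 : 1 ≤ V) (K δ : ℝ) : ∃ C, 0 < C ∧ ∀ s : Sol α β T, s.Init K δ → s.Low c E →
      s.Mid p D → (∀ x, ∀ t ∈ Icc 0 T, s.v x t ≤ V) → ∀ᶠ a in atTop, ∀ t ∈ Icc 0 T,
        (cint a fun x => s.vx x t ^ 2) ≤ C := by
  obtain ⟨Q, hQ1, hQ⟩ := exists_kap_bound hα hE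
  set A₁ := 1 / c + c ^ (p - β) / (p * c) with hA₁
  have hA₁p : 0 < A₁ := by have := Real.rpow_pos_of_pos hc (p - β); positivity
  set C₁ := (2 * Q ^ 2 + 2) * K ^ 2 + (2 * E / c * D + D) with hC₁
  set C₂ := C₁ * Real.exp (A₁ * D + V * D) with hC₂
  refine ⟨2 * V ^ 2 * (|C₂| + 2 * E), by positivity, fun s hi h m hV => ?_⟩
  filter_upwards [h.cint_le, m.diss_le, eventually_gt_atTop 0] with a hG hd ha0 t ht
  have cd : Continuous fun t => cint a fun x => s.diss p x t := continuous_cint (by fun_prop)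
  have cB : Continuous s.B := s.continuous_B
  have cS : Continuous s.S := s.continuous_S
  have hS0 : ∀ t, 0 < s.S t := fun t => by have := s.two_le_S t; linarith
  have hB0 : ∀ t, 0 < s.B t := fun t => by have := s.one_le_B t; linarith
  have cSp : Continuous fun t => s.S t ^ p := cS.rpow_const fun t => Or.inl (hS0 t).ne'
  have hSp0 : ∀ t, 0 < s.S t ^ p := fun t => Real.rpow_pos_of_pos (hS0 t) p
  have hu : ∀ t ∈ Icc 0 T, cint a (fun x => s.u.f x t ^ 2) ≤ 2 * E := fun t ht => by
    calc _ ≤ cint a fun x => 2 * s.enG x t := cint_mono ha0 (by fun_prop) (by fun_prop) fun x => by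
          have := (s.parts_le_enG x t).1
          linarith
      _ ≤ _ := by rw [cint_const_mul]; have := hG t ht; linarith
  have h0 : cint a (fun x => s.R x 0 ^ 2) ≤ (2 * Q ^ 2 + 2) * K ^ 2 := by
    refine hi.cint_le ha0 (by fun_prop) (by positivity) fun x => ?_
    have h1 := hQ (s.v x 0) (h.v₀_ge x) (h.v₀_le x)
    have hk := kap_pos hα (s.v_pos x 0)
    have h2 : (kap α (s.v x 0)) ^ 2 ≤ Q ^ 2 := by gcongr; exact h1.1
    have h3 : s.vx x 0 ^ 2 + s.u.f x 0 ^ 2 ≤ s.initDensity x := by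
      have : s.initDensity x = (s.vx x 0 ^ 2 + s.u.f x 0 ^ 2) + ((s.v x 0 - 1) ^ 2
        + (s.θ.f x 0 - 1) ^ 2
        + (s.b₁.f x 0 ^ 2 + s.b₂.f x 0 ^ 2) + (s.w₁.f x 0 ^ 2 + s.w₂.f x 0 ^ 2)
        + s.u.x x 0 ^ 2 + s.θ.x x 0 ^ 2
        + (s.b₁.x x 0 ^ 2 + s.b₂.x x 0 ^ 2) + (s.w₁.x x 0 ^ 2 + s.w₂.x x 0 ^ 2)) := by
        unfold initDensity; ring
      rw [this]
      exact le_add_of_nonneg_right (by positivity)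
    have h4 : s.R x 0 = kap α (s.v x 0) * s.vx x 0 - s.u.f x 0 := by simp [R]
    rw [h4]
    calc (kap α (s.v x 0) * s.vx x 0 - s.u.f x 0) ^ 2
        ≤ 2 * ((kap α (s.v x 0)) ^ 2 * s.vx x 0 ^ 2) + 2 * s.u.f x 0 ^ 2 := by
          nlinarith [sq_nonneg (kap α (s.v x 0) * s.vx x 0 + s.u.f x 0)]
      _ ≤ 2 * (Q ^ 2 * s.vx x 0 ^ 2) + 2 * s.u.f x 0 ^ 2 := by gcongr
      _ ≤ (2 * Q ^ 2 + 2) * (s.vx x 0 ^ 2 + s.u.f x 0 ^ 2) := by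
          nlinarith [sq_nonneg (s.vx x 0), mul_nonneg (sq_nonneg Q) (sq_nonneg (s.u.f x 0))]
      _ ≤ _ := by gcongr
  have key := gronwall_dissipation (T := T) (y := fun t => cint a fun x => s.R x t ^ 2)
    (y' := fun t => cint a fun x => 2 * s.R x t * s.Px x t)
    (A := fun t => A₁ * s.S t + V * (s.B t * s.S t ^ p))
    (c := fun t => 2 * E / c * s.S t + cint a fun x => s.diss p x t) (d := fun _ => 0)
    (continuous_cint (by fun_prop)).continuousOn (by fun_prop) (by fun_prop) continuous_const
    (fun t _ => by have := hS0 t; have := hB0 t; have := hSp0 t; positivity)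
    (fun t _ => by
      have := hS0 t
      have := cint_nonneg ha0 fun x => s.diss_nonneg hα hp0.le x t
      positivity)
    (by simp)
    (fun t ht => hasDerivAt_cint (E := fun x t => s.R x t ^ 2)
      (Et := fun x t => 2 * s.R x t * s.Px x t) (by fun_prop) (by fun_prop)
      (fun x t _ => ((s.hasDerivAt_R x t).pow 2).congr_deriv (by simp)) ht)
    (fun t ht => by
      have ht' := Ioo_subset_Icc_self ht
      have k1 : cint a (fun x => 2 * s.R x t * s.Px x t) ≤ cint a fun x =>
          ((A₁ * s.S t + V * (s.B t * s.S t ^ p)) * s.R x t ^ 2 + 1 / c * s.S t * s.u.f x t ^ 2)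
            + s.diss p x t :=
        cint_mono ha0 (by fun_prop) (by fun_prop) fun x => by
          have := h.R_mul_Px_le hα hp0 hpβ hV x ht'
          linarith
      rw [cint_add (by fun_prop) (by fun_prop),
        cint_add (by fun_prop) (by fun_prop), cint_const_mul, cint_const_mul] at k1
      have k2 := hu t ht'
      have k3 : 1 / c * s.S t * cint a (fun x => s.u.f x t ^ 2) ≤ 1 / c * s.S t * (2 * E) := by
        have := hS0 t
        gcongr
      have k4 : 1 / c * s.S t * (2 * E) = 2 * E / c * s.S t := by ring
      linarith) t ht
  simp only [intervalIntegral.integral_zero, add_zero] at key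
  have cA : Continuous fun t => A₁ * s.S t + V * (s.B t * s.S t ^ p) := by fun_prop
  have cC : Continuous fun t => 2 * E / c * s.S t + cint a fun x => s.diss p x t := by fun_prop
  have i1 : ∫ t in (0:ℝ)..t, (A₁ * s.S t + V * (s.B t * s.S t ^ p)) ≤ A₁ * D + V * D := by
    calc _ ≤ ∫ t in (0:ℝ)..T, (A₁ * s.S t + V * (s.B t * s.S t ^ p)) :=
          integral_le_of_subset cA le_rfl ht.1 ht.2 fun t _ => by
            have := hS0 t; have := hB0 t; have := hSp0 t; positivity
      _ = A₁ * (∫ t in (0:ℝ)..T, s.S t) + V * ∫ t in (0:ℝ)..T, s.B t * s.S t ^ p := by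
          rw [integral_add_mul cS (g := fun t => s.B t * s.S t ^ p) (by fun_prop)]
      _ ≤ _ := by have := m.S_le; have := m.BS_le; gcongr
  have i2 : ∫ t in (0:ℝ)..t, (2 * E / c * s.S t + cint a fun x => s.diss p x t)
      ≤ 2 * E / c * D + D := by
    calc _ ≤ ∫ t in (0:ℝ)..T, (2 * E / c * s.S t + cint a fun x => s.diss p x t) :=
          integral_le_of_subset cC le_rfl ht.1 ht.2 fun t _ => by
            have := hS0 t
            have := cint_nonneg ha0 fun x => s.diss_nonneg hα hp0.le x t
            positivity
      _ = 2 * E / c * (∫ t in (0:ℝ)..T, s.S t) + ∫ t in (0:ℝ)..T, cint a fun x => s.diss p x t := by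
          rw [intervalIntegral.integral_add ((cS.const_mul _).intervalIntegrable _ _)
            (cd.intervalIntegrable _ _), intervalIntegral.integral_const_mul]
      _ ≤ _ := by have := m.S_le; gcongr
  have hD := m.one_le
  have hC₁p : 0 ≤ C₁ := by positivity
  have k5 : cint a (fun x => s.R x t ^ 2) ≤ C₂ := by
    refine key.trans ?_
    rw [hC₂, hC₁]
    have : 0 ≤ (2 * Q ^ 2 + 2) * K ^ 2 + (2 * E / c * D + D) := hC₁p
    gcongr
  have k6 := hu t ht
  calc cint a (fun x => s.vx x t ^ 2)
      ≤ cint a fun x => (2 * V ^ 2 * s.R x t ^ 2 + 2 * V ^ 2 * s.u.f x t ^ 2) :=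
        cint_mono ha0 (by fun_prop) (by fun_prop) fun x => by
          have hk := inv_le_kap hα (s.v_pos x t)
          have hv := s.v_pos x t
          have h1 : 1 ≤ V * kap α (s.v x t) := by
            calc 1 = s.v x t * (s.v x t)⁻¹ := by field_simp
              _ ≤ V * kap α (s.v x t) := by have := hV x t ht; gcongr
          have h2 : s.vx x t ^ 2 ≤ (V * kap α (s.v x t)) ^ 2 * s.vx x t ^ 2 :=
            le_mul_of_one_le_left (sq_nonneg _) (one_le_pow₀ h1)
          have h3 : kap α (s.v x t) * s.vx x t = s.R x t + s.u.f x t := by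
            rw [s.R_eq x ht]; ring
          have h4 : (V * kap α (s.v x t)) ^ 2 * s.vx x t ^ 2
            = V ^ 2 * (s.R x t + s.u.f x t) ^ 2 := by rw [← h3]; ring
          have h5 : (s.R x t + s.u.f x t) ^ 2 ≤ 2 * s.R x t ^ 2 + 2 * s.u.f x t ^ 2 := by
            nlinarith [sq_nonneg (s.R x t - s.u.f x t)]
          have : V ^ 2 * (s.R x t + s.u.f x t) ^ 2
            ≤ V ^ 2 * (2 * s.R x t ^ 2 + 2 * s.u.f x t ^ 2) := by gcongr
          linarith
    _ = 2 * V ^ 2 * (cint a (fun x => s.R x t ^ 2) + cint a fun x => s.u.f x t ^ 2) := by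
        rw [cint_add (by fun_prop) (by fun_prop), cint_const_mul, cint_const_mul]
        ring
    _ ≤ 2 * V ^ 2 * (|C₂| + 2 * E) := by
        have := le_abs_self C₂
        gcongr
        linarith

end Sol

/-- A continuous weight with bounded mass is controlled against squares by the cut-off
Sobolev inequality. -/
theorem cint_mul_sq_le {a ε N : ℝ} (ha : 0 < a) (hε : 0 < ε) {f g gx : ℝ → ℝ}
    (cf : Continuous f) (hf : ∀ x, 0 ≤ f x) (hg : ∀ x, HasDerivAt g (gx x) x)
    (cgx : Continuous gx) (hN : ∫ x in -a..a, f x ≤ N) :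
    cint a (fun x => f x * g x ^ 2) ≤ N * (ε * cint a (fun x => gx x ^ 2)
      + (1 / ε + 1) * cint a (fun x => g x ^ 2) + dint a fun x => g x ^ 2) := by
  have cg : Continuous g := continuous_iff_continuousAt.2 fun x => (hg x).continuousAt
  set R := ε * cint a (fun x => gx x ^ 2) + (1 / ε + 1) * cint a (fun x => g x ^ 2)
    + dint a fun x => g x ^ 2 with hR
  have R0 : 0 ≤ R := by
    have h1 := cint_nonneg ha fun x => sq_nonneg (gx x)
    have h2 := cint_nonneg ha fun x => sq_nonneg (g x)
    have h3 := dint_nonneg ha fun x => sq_nonneg (g x)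
    positivity
  calc cint a (fun x => f x * g x ^ 2) ≤ ∫ x in -a..a, R * f x := by
        refine integral_le_of_le (by linarith) (by fun_prop) (by fun_prop) fun x hx => ?_
        have := mul_le_mul_of_nonneg_left (cut_mul_sq_le ha hε hg cgx hx) (hf x)
        rw [mul_comm R]
        refine le_trans (le_of_eq ?_) this
        ring
    _ = R * ∫ x in -a..a, f x := intervalIntegral.integral_const_mul _ _
    _ ≤ R * N := by gcongr
    _ = N * R := mul_comm _ _

namespace Fld
variable {T : ℝ}

/-- Gradient energy inequality for a scalar equation `F_t = k F_xx + Q` with `k` bounded above and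
below and `Q² ≤ A r`. -/
theorem grad_energy (F : Fld T) {A a t : ℝ} (hA : 1 ≤ A) (ha : 0 < a) (ht : t ∈ Ioo 0 T)
    {r : ℝ → ℝ} (cr : Continuous r)
    (h : ∀ x, ∃ k, 1 / A ≤ k ∧ k ≤ A ∧ (F.t x t - k * F.xx x t) ^ 2 ≤ A * r x) :
    ∃ d, HasDerivAt (fun t => cint a fun x => F.x x t ^ 2) d t ∧
      d + 1 / A * cint a (fun x => F.xx x t ^ 2)
        ≤ (2 * A ^ 2 + 8 * A + 2) * (cint a r + dint a fun x => F.x x t ^ 2) := by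
  have hd := hasDerivAt_dirichlet_integral (T := T) (a := a) (ψ := fun x _ => cut a x ^ 2)
    (ψx := fun x _ => 2 * cut a x * dcut a x) (ψt := fun _ _ => 0) (g := F.f) (gx := F.x)
    (gxx := F.xx) (gt := F.t) (by fun_prop) (by fun_prop) (by fun_prop) F.cf F.cx F.cxx F.ct
    (fun x _ => hasDerivAt_cut_sq a x) (fun x t _ => hasDerivAt_const _ _) F.hx F.hxx F.ht
    (fun _ => by simp [cut_left ha.ne']) (fun _ => by simp [cut_right ha.ne']) ht
  refine ⟨_, hd, ?_⟩
  set A' := 2 * A ^ 2 + 8 * A + 2 with hA'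
  have A0 : 0 < A := by linarith
  rw [mul_add]
  unfold cint dint
  rw [← intervalIntegral.integral_const_mul, ← intervalIntegral.integral_const_mul,
    ← intervalIntegral.integral_const_mul,
    ← intervalIntegral.integral_add (Continuous.intervalIntegrable (by fun_prop) _ _)
      (Continuous.intervalIntegrable (by fun_prop) _ _),
    ← intervalIntegral.integral_add (Continuous.intervalIntegrable (by fun_prop) _ _)
      (Continuous.intervalIntegrable (by fun_prop) _ _)]
  refine integral_le_of_le (by linarith) (by fun_prop) (by fun_prop) fun x _ => ?_
  obtain ⟨k, k1, k2, hQ⟩ := h x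
  set Q := F.t x t - k * F.xx x t with hQd
  have e1 : F.t x t = k * F.xx x t + Q := by rw [hQd]; ring
  rw [e1]
  set g := F.xx x t
  set q := F.x x t
  set c := cut a x
  set d := dcut a x
  have kp : 0 < k := lt_of_lt_of_le (by positivity) k1
  have h1 : -2 * Q * g ≤ k / 2 * g ^ 2 + 2 * A * Q ^ 2 := by
    have h2 : 1 ≤ A * k := by
      have := mul_le_mul_of_nonneg_left k1 A0.le
      rwa [mul_one_div_cancel A0.ne'] at this
    have h6 : k / 2 * g ^ 2 + 2 * Q * g + 2 * A * Q ^ 2 = k / 2 * (g + 2 / k * Q) ^ 2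
      + 2 / k * (A * k - 1) * Q ^ 2 := by field_simp; ring
    have h7 : 0 ≤ k / 2 * (g + 2 / k * Q) ^ 2 + 2 / k * (A * k - 1) * Q ^ 2 := by
      have : 0 ≤ A * k - 1 := by linarith
      positivity
    linarith
  have h2 : 0 ≤ k / 2 * (c * g + 4 * (d * q)) ^ 2 := by positivity
  have h3 := sq_nonneg (c * Q + d * q)
  have h4 : (k - 1 / A) * (c * g) ^ 2 ≥ 0 := mul_nonneg (by linarith) (sq_nonneg _)
  have h5 : (A - k) * (d * q) ^ 2 ≥ 0 := mul_nonneg (by linarith) (sq_nonneg _)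
  have h6 : c ^ 2 * (-2 * Q * g) ≤ c ^ 2 * (k / 2 * g ^ 2 + 2 * A * Q ^ 2) := by gcongr
  have h7 : c ^ 2 * ((2 * A + 2) * Q ^ 2) ≤ c ^ 2 * ((2 * A + 2) * (A * r x)) := by gcongr
  have r0 : 0 ≤ r x := by
    have := (sq_nonneg Q).trans hQ
    exact nonneg_of_mul_nonneg_right this A0
  have h8 : c ^ 2 * ((2 * A + 2) * (A * r x)) ≤ A' * (c ^ 2 * r x) := by
    have : 0 ≤ (6 * A + 2) * (c ^ 2 * r x) := by positivity
    rw [hA']; linarith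
  have h9 : (8 * A + 2) * (d * q) ^ 2 ≤ A' * (d ^ 2 * q ^ 2) := by
    have : 0 ≤ 2 * A ^ 2 * (d * q) ^ 2 := by positivity
    rw [hA']; linarith
  linarith

end Fld

namespace Sol
variable {α β T : ℝ} (s : Sol α β T)

/-- The sum of the squared spatial derivatives of the velocity and magnetic fields. -/
def grad (x t : ℝ) : ℝ :=
  s.u.x x t ^ 2 + s.w₁.x x t ^ 2 + s.w₂.x x t ^ 2 + s.b₁.x x t ^ 2 + s.b₂.x x t ^ 2

/-- The sum of the squared second spatial derivatives of the velocity and magnetic fields. -/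
def hess (x t : ℝ) : ℝ :=
  s.u.xx x t ^ 2 + s.w₁.xx x t ^ 2 + s.w₂.xx x t ^ 2 + s.b₁.xx x t ^ 2 + s.b₂.xx x t ^ 2

/-- The viscous and resistive heating. -/
def heat (x t : ℝ) : ℝ :=
  kap α (s.v x t) * s.u.x x t ^ 2
    + (s.w₁.x x t ^ 2 + s.w₂.x x t ^ 2 + s.b₁.x x t ^ 2 + s.b₂.x x t ^ 2) / s.v x t

section
variable {X : Type*} [TopologicalSpace X]

@[fun_prop]
theorem continuous_grad {g h : X → ℝ} (hg : Continuous g) (hh : Continuous h) :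
    Continuous fun z => s.grad (g z) (h z) := by unfold grad; fun_prop

@[fun_prop]
theorem continuous_hess {g h : X → ℝ} (hg : Continuous g) (hh : Continuous h) :
    Continuous fun z => s.hess (g z) (h z) := by unfold hess; fun_prop

@[fun_prop]
theorem continuous_heat {g h : X → ℝ} (hg : Continuous g) (hh : Continuous h) :
    Continuous fun z => s.heat (g z) (h z) := by unfold heat; fun_prop (disch := simp)

end

theorem grad_nonneg (x t : ℝ) : 0 ≤ s.grad x t := by unfold grad; positivity
theorem hess_nonneg (x t : ℝ) : 0 ≤ s.hess x t := by unfold hess; positivity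

theorem heat_nonneg (hα : 0 ≤ α) (x t : ℝ) : 0 ≤ s.heat x t := by
  have := kap_pos hα (s.v_pos x t)
  have := s.v_pos x t
  unfold heat; positivity

/-- The list of velocity and magnetic fields. -/
def flds : Fin 5 → Fld T := ![s.u, s.w₁, s.w₂, s.b₁, s.b₂]

theorem grad_eq_sum (x t : ℝ) : s.grad x t = ∑ i, (s.flds i).x x t ^ 2 := by
  simp [Fin.sum_univ_five, flds, grad]

theorem hess_eq_sum (x t : ℝ) : s.hess x t = ∑ i, (s.flds i).xx x t ^ 2 := by
  simp [Fin.sum_univ_five, flds, hess]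

/-- The forcing in the gradient estimate for a field `F`. -/
def forcing (F : Fld T) (x t : ℝ) : ℝ :=
  s.vx x t ^ 2 * F.x x t ^ 2
    + (s.θ.x x t ^ 2 + s.S t ^ 2 * s.vx x t ^ 2 + s.B t * s.grad x t)

@[fun_prop]
theorem continuous_forcing (F : Fld T) {X : Type*} [TopologicalSpace X] {g h : X → ℝ}
    (hg : Continuous g) (hh : Continuous h) :
    Continuous fun z => s.forcing F (g z) (h z) := by unfold forcing; fun_prop

/-- The coefficient bounds of the equation `F_t = k F_xx + Q` for a field `F`. -/
def Para (F : Fld T) (A t : ℝ) : Prop :=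
  ∀ x, ∃ k, 1 / A ≤ k ∧ k ≤ A ∧ (F.t x t - k * F.xx x t) ^ 2 ≤ A * s.forcing F x t

variable {s} {c E V : ℝ}

theorem para_u_aux {A d vx ux θx v θ b₁ b₁x b₂ b₂x S B G L : ℝ} (hL : 1 ≤ L) (hd : |d| ≤ L)
    (hv : 1 / L ≤ v) (hθ : 0 ≤ θ) (hS : θ ≤ S) (hB : b₁ ^ 2 + b₂ ^ 2 ≤ B)
    (hG : b₁x ^ 2 + b₂x ^ 2 ≤ G) (hA : 5 * L ^ 4 ≤ A) :
    (d * vx * ux - (θx / v - θ * vx / v ^ 2 + b₁ * b₁x + b₂ * b₂x)) ^ 2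
      ≤ A * (vx ^ 2 * ux ^ 2 + (θx ^ 2 + S ^ 2 * vx ^ 2 + B * G)) := by
  have L0 : 0 < L := by linarith
  have v0 : 0 < v := lt_of_lt_of_le (by positivity) hv
  have hi : v⁻¹ ≤ L := by
    rw [inv_le_comm₀ v0 L0]; simpa using hv
  have i0 : 0 ≤ v⁻¹ := by positivity
  have h1 : (d * vx * ux) ^ 2 ≤ L ^ 4 * (vx ^ 2 * ux ^ 2) := by
    have e1 : d ^ 2 ≤ L ^ 2 := sq_le_sq' (by linarith [neg_le_of_abs_le hd]) (le_of_abs_le hd)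
    have e2 : L ^ 2 ≤ L ^ 4 := pow_le_pow_right₀ hL (by norm_num)
    calc (d * vx * ux) ^ 2 = d ^ 2 * (vx ^ 2 * ux ^ 2) := by ring
      _ ≤ L ^ 4 * (vx ^ 2 * ux ^ 2) := by have := e1.trans e2; gcongr
  have h2 : (θx / v) ^ 2 ≤ L ^ 4 * θx ^ 2 := by
    have e2 : L ^ 2 ≤ L ^ 4 := pow_le_pow_right₀ hL (by norm_num)
    calc (θx / v) ^ 2 = (v⁻¹) ^ 2 * θx ^ 2 := by rw [div_eq_mul_inv]; ring
      _ ≤ L ^ 2 * θx ^ 2 := by gcongr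
      _ ≤ L ^ 4 * θx ^ 2 := by gcongr
  have h3 : (θ * vx / v ^ 2) ^ 2 ≤ L ^ 4 * (S ^ 2 * vx ^ 2) := by
    calc (θ * vx / v ^ 2) ^ 2 = (v⁻¹) ^ 4 * (θ ^ 2 * vx ^ 2) := by
          rw [div_eq_mul_inv, inv_pow]; field_simp
      _ ≤ L ^ 4 * (S ^ 2 * vx ^ 2) := by gcongr
  have h4 : (b₁ * b₁x + b₂ * b₂x) ^ 2 ≤ L ^ 4 * (B * G) := by
    have B0 : 0 ≤ B := le_trans (by positivity) hB
    have G0 : 0 ≤ G := le_trans (by positivity) hG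
    calc (b₁ * b₁x + b₂ * b₂x) ^ 2 ≤ (b₁ ^ 2 + b₂ ^ 2) * (b₁x ^ 2 + b₂x ^ 2) := by
          nlinarith [sq_nonneg (b₁ * b₂x - b₂ * b₁x)]
      _ ≤ B * G := by gcongr
      _ ≤ L ^ 4 * (B * G) := le_mul_of_one_le_left (by positivity) (one_le_pow₀ hL)
  have B0 : 0 ≤ B := le_trans (by positivity) hB
  have G0 : 0 ≤ G := le_trans (by positivity) hG
  calc _ ≤ 4 * ((d * vx * ux) ^ 2 + (θx / v) ^ 2 + (θ * vx / v ^ 2) ^ 2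
        + (b₁ * b₁x + b₂ * b₂x) ^ 2) := by
        generalize d * vx * ux = x
        generalize θx / v = y
        generalize θ * vx / v ^ 2 = z
        rw [add_assoc (y - z)]
        generalize b₁ * b₁x + b₂ * b₂x = w
        nlinarith [sq_nonneg (x + y), sq_nonneg (x - z), sq_nonneg (x + w), sq_nonneg (y + z),
          sq_nonneg (y - w), sq_nonneg (z + w)]
    _ ≤ 4 * (L ^ 4 * (vx ^ 2 * ux ^ 2) + L ^ 4 * θx ^ 2 + L ^ 4 * (S ^ 2 * vx ^ 2)
        + L ^ 4 * (B * G)) := mul_le_mul_of_nonneg_left (by linarith) (by norm_num)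
    _ = 4 * L ^ 4 * (vx ^ 2 * ux ^ 2 + (θx ^ 2 + S ^ 2 * vx ^ 2 + B * G)) := by ring
    _ ≤ A * (vx ^ 2 * ux ^ 2 + (θx ^ 2 + S ^ 2 * vx ^ 2 + B * G)) := by
        have : 4 * L ^ 4 ≤ A := by have : 0 ≤ L ^ 4 := by positivity
                                   linarith
        gcongr

theorem para_w_aux {A vx wx bx v B G L r : ℝ} (hL : 1 ≤ L) (hr : 0 ≤ r)
    (hv : 1 / L ≤ v) (hB : 1 ≤ B) (hG : bx ^ 2 ≤ G) (hA : 5 * L ^ 4 ≤ A) :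
    (bx - wx * vx / v ^ 2) ^ 2 ≤ A * (vx ^ 2 * wx ^ 2 + (r + B * G)) := by
  have L0 : 0 < L := by linarith
  have v0 : 0 < v := lt_of_lt_of_le (by positivity) hv
  have hi : v⁻¹ ≤ L := by
    rw [inv_le_comm₀ v0 L0]; simpa using hv
  have h3 : (wx * vx / v ^ 2) ^ 2 ≤ L ^ 4 * (vx ^ 2 * wx ^ 2) := by
    calc (wx * vx / v ^ 2) ^ 2 = (v⁻¹) ^ 4 * (vx ^ 2 * wx ^ 2) := by
          rw [div_eq_mul_inv, inv_pow]; field_simp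
      _ ≤ L ^ 4 * (vx ^ 2 * wx ^ 2) := by gcongr
  have h1 : 1 ≤ L ^ 4 := one_le_pow₀ hL
  have G0 : 0 ≤ G := le_trans (by positivity) hG
  have h4 : bx ^ 2 ≤ L ^ 4 * (r + B * G) := by
    calc bx ^ 2 ≤ 1 * G := by linarith
      _ ≤ B * G := by gcongr
      _ ≤ r + B * G := by linarith
      _ ≤ L ^ 4 * (r + B * G) := le_mul_of_one_le_left (by positivity) h1
  calc _ ≤ 2 * (bx ^ 2 + (wx * vx / v ^ 2) ^ 2) := by
        nlinarith [sq_nonneg (bx + wx * vx / v ^ 2)]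
    _ ≤ 2 * L ^ 4 * (vx ^ 2 * wx ^ 2 + (r + B * G)) := by linarith
    _ ≤ _ := by
        have : 2 * L ^ 4 ≤ A := by linarith
        gcongr

theorem para_b_aux {A vx ux b wx bx v B G L r : ℝ} (hL : 1 ≤ L) (hr : 0 ≤ r)
    (hv : 1 / L ≤ v) (hB : 1 ≤ B) (hb : b ^ 2 ≤ B) (hG : wx ^ 2 + ux ^ 2 ≤ G)
    (hA : 5 * L ^ 6 ≤ A) :
    ((wx - bx * vx / v ^ 2 - ux * b) / v) ^ 2 ≤ A * (vx ^ 2 * bx ^ 2 + (r + B * G)) := by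
  have L0 : 0 < L := by linarith
  have v0 : 0 < v := lt_of_lt_of_le (by positivity) hv
  have hi : v⁻¹ ≤ L := by
    rw [inv_le_comm₀ v0 L0]; simpa using hv
  have h3 : (bx * vx / v ^ 2) ^ 2 ≤ L ^ 4 * (vx ^ 2 * bx ^ 2) := by
    calc (bx * vx / v ^ 2) ^ 2 = (v⁻¹) ^ 4 * (vx ^ 2 * bx ^ 2) := by
          rw [div_eq_mul_inv, inv_pow]; field_simp
      _ ≤ L ^ 4 * (vx ^ 2 * bx ^ 2) := by gcongr
  have h1 : 1 ≤ L ^ 4 := one_le_pow₀ hL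
  have G0 : 0 ≤ G := le_trans (by positivity) hG
  have h4 : wx ^ 2 + (ux * b) ^ 2 ≤ L ^ 4 * (r + B * G) := by
    calc wx ^ 2 + (ux * b) ^ 2 = 1 * wx ^ 2 + b ^ 2 * ux ^ 2 := by ring
      _ ≤ B * wx ^ 2 + B * ux ^ 2 := by gcongr
      _ = B * (wx ^ 2 + ux ^ 2) := by ring
      _ ≤ B * G := by gcongr
      _ ≤ r + B * G := by linarith
      _ ≤ L ^ 4 * (r + B * G) := le_mul_of_one_le_left (by positivity) h1
  have h5 : (wx - bx * vx / v ^ 2 - ux * b) ^ 2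
      ≤ 3 * L ^ 4 * (vx ^ 2 * bx ^ 2 + (r + B * G)) := by
    calc _ ≤ 3 * (wx ^ 2 + (ux * b) ^ 2 + (bx * vx / v ^ 2) ^ 2) := by
          generalize bx * vx / v ^ 2 = y
          generalize ux * b = z
          nlinarith [sq_nonneg (wx + y), sq_nonneg (wx + z), sq_nonneg (y - z)]
      _ ≤ _ := by linarith
  calc _ = (v⁻¹) ^ 2 * (wx - bx * vx / v ^ 2 - ux * b) ^ 2 := by rw [div_eq_mul_inv]; ring
    _ ≤ L ^ 2 * (3 * L ^ 4 * (vx ^ 2 * bx ^ 2 + (r + B * G))) := by gcongr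
    _ = 3 * L ^ 6 * (vx ^ 2 * bx ^ 2 + (r + B * G)) := by ring
    _ ≤ _ := by
        have : 3 * L ^ 6 ≤ A := by
          have : 0 ≤ L ^ 6 := by positivity
          linarith
        gcongr

/-- All velocity and magnetic fields satisfy uniformly parabolic equations. -/
theorem exists_para (hα : 0 ≤ α) (hc : 0 < c) (hV : 1 ≤ V) : ∃ A, 1 ≤ A ∧ ∀ s : Sol α β T,
    s.Low c E → (∀ x, ∀ t ∈ Icc 0 T, s.v x t ≤ V) → ∀ t ∈ Icc 0 T, ∀ i, s.Para (s.flds i) A t := by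
  have hL1 : 1 ≤ max V (1 / c) := le_max_of_le_left hV
  obtain ⟨Q, hQ1, hQ⟩ := exists_kap_bound hα hL1
  obtain ⟨L, hL⟩ : ∃ L, L = max (max V (1 / c)) Q := ⟨_, rfl⟩
  have l1 : 1 ≤ L := hL ▸ le_max_of_le_right hQ1
  have lQ : Q ≤ L := hL ▸ le_max_right _ _
  have lV : V ≤ L := hL ▸ le_max_of_le_left (le_max_left _ _)
  have lc : 1 / c ≤ L := hL ▸ le_max_of_le_left (le_max_right _ _)
  have L0 : 0 < L := by linarith
  have p4 : L ^ 4 ≤ L ^ 6 := pow_le_pow_right₀ l1 (by norm_num)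
  have p1 : L ^ 1 ≤ L ^ 6 := pow_le_pow_right₀ l1 (by norm_num)
  have p2 : L ^ 2 ≤ L ^ 6 := pow_le_pow_right₀ l1 (by norm_num)
  have p0 : 1 ≤ L ^ 6 := one_le_pow₀ l1
  obtain ⟨A, hA⟩ : ∃ A, A = 5 * L ^ 6 := ⟨_, rfl⟩
  have A1 : 1 ≤ A := by linarith
  have AL : L ≤ A := by linarith
  have AL2 : L ^ 2 ≤ A := by linarith
  have AL4 : 5 * L ^ 4 ≤ A := by linarith
  refine ⟨A, A1, fun s h hv t ht i => ?_⟩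
  have v1 : ∀ x, 1 / L ≤ s.v x t := fun x => by
    refine le_trans ?_ (h.v_ge x t ht)
    rw [one_div_le L0 hc]; exact lc
  have hi : ∀ x, 1 / A ≤ (s.v x t)⁻¹ := fun x => by
    rw [one_div, inv_le_inv₀ (by linarith) (s.v_pos x t)]
    linarith [hv x t ht]
  have hi' : ∀ x, (s.v x t)⁻¹ ≤ L := fun x => by
    rw [inv_le_comm₀ (s.v_pos x t) L0]; simpa using v1 x
  have hi2 : ∀ x, 1 / A ≤ (s.v x t)⁻¹ ^ 2 := fun x => by
    rw [one_div, inv_pow, inv_le_inv₀ (by linarith) (by have := s.v_pos x t; positivity)]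
    have : s.v x t ^ 2 ≤ L ^ 2 := by
      have := s.v_pos x t
      have := (hv x t ht).trans lV
      gcongr
    linarith
  have hi2' : ∀ x, (s.v x t)⁻¹ ^ 2 ≤ A := fun x => by
    have : (s.v x t)⁻¹ ^ 2 ≤ L ^ 2 := by
      have := s.v_pos x t
      have := hi' x
      gcongr
    linarith
  have hk : ∀ x, kap α (s.v x t) ≤ Q ∧ 1 / Q ≤ kap α (s.v x t) ∧ |dkap α (s.v x t)| ≤ Q :=
    fun x => hQ _ (by
      refine le_trans ?_ (h.v_ge x t ht)
      rw [one_div_le (by linarith) hc]; exact le_max_right _ _)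
      ((hv x t ht).trans (le_max_left _ _))
  have hB := s.one_le_B t
  have hb := fun x => s.b_le_B x t
  have hr : ∀ x, 0 ≤ s.θ.x x t ^ 2 + s.S t ^ 2 * s.vx x t ^ 2 := fun x => by positivity
  fin_cases i <;> intro x
  · change ∃ k, 1 / A ≤ k ∧ k ≤ A ∧
      (s.u.t x t - k * s.u.xx x t) ^ 2 ≤ A * s.forcing s.u x t
    refine ⟨kap α (s.v x t), le_trans ?_ (hk x).2.1, by linarith [(hk x).1], ?_⟩
    · exact one_div_le_one_div_of_le (by linarith) (by linarith)
    · rw [s.mom, add_sub_assoc, add_sub_cancel_left]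
      refine para_u_aux l1 ((hk x).2.2.trans lQ) (v1 x) (s.θ_pos x t).le (s.θ_le_S x t) (hb x) ?_
        AL4
      unfold grad; nlinarith [sq_nonneg (s.u.x x t), sq_nonneg (s.w₁.x x t), sq_nonneg (s.w₂.x x t)]
  · change ∃ k, 1 / A ≤ k ∧ k ≤ A ∧
      (s.w₁.t x t - k * s.w₁.xx x t) ^ 2 ≤ A * s.forcing s.w₁ x t
    refine ⟨(s.v x t)⁻¹, hi x, (hi' x).trans AL, ?_⟩
    rw [s.eqw₁, show s.b₁.x x t + (s.w₁.xx x t / s.v x t - s.w₁.x x t * s.vx x t / s.v x t ^ 2)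
      - (s.v x t)⁻¹ * s.w₁.xx x t = s.b₁.x x t - s.w₁.x x t * s.vx x t / s.v x t ^ 2 by ring]
    refine para_w_aux l1 (hr x) (v1 x) hB ?_ AL4
    unfold grad; nlinarith [sq_nonneg (s.u.x x t), sq_nonneg (s.w₁.x x t), sq_nonneg (s.w₂.x x t),
      sq_nonneg (s.b₂.x x t)]
  · change ∃ k, 1 / A ≤ k ∧ k ≤ A ∧
      (s.w₂.t x t - k * s.w₂.xx x t) ^ 2 ≤ A * s.forcing s.w₂ x t
    refine ⟨(s.v x t)⁻¹, hi x, (hi' x).trans AL, ?_⟩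
    rw [s.eqw₂, show s.b₂.x x t + (s.w₂.xx x t / s.v x t - s.w₂.x x t * s.vx x t / s.v x t ^ 2)
      - (s.v x t)⁻¹ * s.w₂.xx x t = s.b₂.x x t - s.w₂.x x t * s.vx x t / s.v x t ^ 2 by ring]
    refine para_w_aux l1 (hr x) (v1 x) hB ?_ AL4
    unfold grad; nlinarith [sq_nonneg (s.u.x x t), sq_nonneg (s.w₁.x x t), sq_nonneg (s.w₂.x x t),
      sq_nonneg (s.b₁.x x t)]
  · change ∃ k, 1 / A ≤ k ∧ k ≤ A ∧
      (s.b₁.t x t - k * s.b₁.xx x t) ^ 2 ≤ A * s.forcing s.b₁ x t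
    refine ⟨(s.v x t)⁻¹ ^ 2, hi2 x, hi2' x, ?_⟩
    have e := s.eqb₁ x t
    have hvp := s.v_ne x t
    rw [show s.b₁.t x t - (s.v x t)⁻¹ ^ 2 * s.b₁.xx x t = (s.w₁.x x t
      - s.b₁.x x t * s.vx x t / s.v x t ^ 2 - s.u.x x t * s.b₁.f x t) / s.v x t by
        rw [eq_div_iff hvp]; field_simp at e ⊢; linarith]
    refine para_b_aux l1 (hr x) (v1 x) hB ?_ ?_ hA.ge
    · linarith [hb x, sq_nonneg (s.b₂.f x t)]
    · unfold grad; nlinarith [sq_nonneg (s.b₂.x x t), sq_nonneg (s.b₁.x x t),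
        sq_nonneg (s.w₂.x x t)]
  · change ∃ k, 1 / A ≤ k ∧ k ≤ A ∧
      (s.b₂.t x t - k * s.b₂.xx x t) ^ 2 ≤ A * s.forcing s.b₂ x t
    refine ⟨(s.v x t)⁻¹ ^ 2, hi2 x, hi2' x, ?_⟩
    have e := s.eqb₂ x t
    have hvp := s.v_ne x t
    rw [show s.b₂.t x t - (s.v x t)⁻¹ ^ 2 * s.b₂.xx x t = (s.w₂.x x t
      - s.b₂.x x t * s.vx x t / s.v x t ^ 2 - s.u.x x t * s.b₂.f x t) / s.v x t by
        rw [eq_div_iff hvp]; field_simp at e ⊢; linarith]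
    refine para_b_aux l1 (hr x) (v1 x) hB ?_ ?_ hA.ge
    · linarith [hb x, sq_nonneg (s.b₁.f x t)]
    · unfold grad; nlinarith [sq_nonneg (s.b₂.x x t), sq_nonneg (s.b₁.x x t),
        sq_nonneg (s.w₁.x x t)]

end Sol

namespace Sol
variable {α β T : ℝ} (s : Sol α β T)

/-- The divergence of the heat flux `θ^β θ_x / v`. -/
def cond (x t : ℝ) : ℝ :=
  s.θ.f x t ^ β * s.θ.xx x t / s.v x t + β * s.θ.f x t ^ (β - 1) * s.θ.x x t ^ 2 / s.v x t
    - s.θ.f x t ^ β * s.θ.x x t * s.vx x t / s.v x t ^ 2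

@[fun_prop]
theorem continuous_cond {X : Type*} [TopologicalSpace X] {g h : X → ℝ} (hg : Continuous g)
    (hh : Continuous h) : Continuous fun z => s.cond (g z) (h z) := by
  unfold cond; fun_prop (disch := simp)

theorem hasDerivAt_heat_flux (x t : ℝ) :
    HasDerivAt (fun y => s.θ.f y t ^ β * s.θ.x y t / s.v y t) (s.cond x t) x := by
  have h1 := (s.θ.hx x t).rpow_const (p := β) (Or.inl (s.θ_ne x t))
  refine ((h1.mul (s.θ.hxx x t)).div (s.hvx x t) (s.v_ne x t)).congr_deriv ?_
  have := s.v_ne x t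
  simp only [Pi.mul_apply, cond]
  field_simp
  ring

theorem θ_t_eq (x t : ℝ) :
    s.θ.t x t = -(s.θ.f x t / s.v x t * s.u.x x t) + s.cond x t + s.heat x t := s.temp x t

variable {s} {c E V D p : ℝ}

theorem exists_heat_le (hα : 0 ≤ α) (hc : 0 < c) (hV : 1 ≤ V) : ∃ Q, 1 ≤ Q ∧
    ∀ s : Sol α β T, s.Low c E → (∀ x, ∀ t ∈ Icc 0 T, s.v x t ≤ V) →
      ∀ x, ∀ t ∈ Icc 0 T, s.heat x t ≤ Q * s.grad x t := by
  obtain ⟨Q, hQ1, hQ⟩ := exists_kap_bound hα (le_max_of_le_left hV : 1 ≤ max V (1 / c))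
  refine ⟨max Q (1 / c), le_max_of_le_left hQ1, fun s h hv x t ht => ?_⟩
  have h1 := (hQ (s.v x t) (by
      refine le_trans ?_ (h.v_ge x t ht)
      rw [one_div_le (lt_of_lt_of_le (by linarith) (le_max_left V (1 / c))) hc]
      exact le_max_right _ _)
      ((hv x t ht).trans (le_max_left _ _))).1.trans (le_max_left Q (1 / c))
  have hv0 := s.v_pos x t
  have h2 : (s.v x t)⁻¹ ≤ max Q (1 / c) := by
    refine le_trans ?_ (le_max_right _ _)
    rw [one_div, inv_le_inv₀ hv0 hc]
    exact h.v_ge x t ht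
  unfold heat grad
  generalize max Q (1 / c) = M at *
  have h3 : (s.w₁.x x t ^ 2 + s.w₂.x x t ^ 2 + s.b₁.x x t ^ 2 + s.b₂.x x t ^ 2) / s.v x t
      ≤ M * (s.w₁.x x t ^ 2 + s.w₂.x x t ^ 2 + s.b₁.x x t ^ 2 + s.b₂.x x t ^ 2) := by
    rw [div_eq_inv_mul]
    gcongr
  have h4 : kap α (s.v x t) * s.u.x x t ^ 2 ≤ M * s.u.x x t ^ 2 := by gcongr
  linarith

theorem Low.temp_mul_le (h : s.Low c E) {Q x t : ℝ} (hα : 0 ≤ α) (ht : t ∈ Icc 0 T)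
    (hQ0 : 0 ≤ Q) (hQ : s.heat x t ≤ Q * s.grad x t) :
    2 * (s.θ.f x t - 1) * s.θ.t x t
      ≤ 2 * (s.θ.x x t * (s.θ.f x t ^ β * s.θ.x x t / s.v x t)
          + (s.θ.f x t - 1) * s.cond x t)
        - 2 * (s.θ.f x t ^ β * s.θ.x x t ^ 2 / s.v x t)
        + (1 / c + 2 * Q) * s.S t * (s.grad x t + (s.θ.f x t - 1) ^ 2) := by
  have hc := h.c_pos
  have hv := s.v_pos x t
  have hθ := s.θ_pos x t
  have hS := s.θ_le_S x t
  have hS0 := s.two_le_S t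
  have hH := s.heat_nonneg hα x t
  have hG := s.grad_nonneg x t
  have hu : s.u.x x t ^ 2 ≤ s.grad x t := by
    unfold grad
    linarith [sq_nonneg (s.w₁.x x t), sq_nonneg (s.w₂.x x t), sq_nonneg (s.b₁.x x t),
      sq_nonneg (s.b₂.x x t)]
  have e1 : s.θ.f x t / s.v x t ≤ 1 / c * s.S t := by
    rw [div_le_iff₀ hv]
    have h1 : 1 ≤ 1 / c * s.v x t := by
      rw [one_div, inv_mul_eq_div, le_div_iff₀ hc]
      linarith [h.v_ge x t ht]
    nlinarith
  have e2 : -(2 * (s.θ.f x t - 1) * (s.θ.f x t / s.v x t * s.u.x x t))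
      ≤ 1 / c * s.S t * (s.grad x t + (s.θ.f x t - 1) ^ 2) := by
    calc _ = s.θ.f x t / s.v x t * (-(2 * (s.θ.f x t - 1) * s.u.x x t)) := by ring
      _ ≤ s.θ.f x t / s.v x t * (s.grad x t + (s.θ.f x t - 1) ^ 2) := by
          have : -(2 * (s.θ.f x t - 1) * s.u.x x t) ≤ s.grad x t + (s.θ.f x t - 1) ^ 2 := by
            nlinarith [sq_nonneg (s.θ.f x t - 1 + s.u.x x t)]
          gcongr
      _ ≤ _ := by gcongr
  have e3 : 2 * (s.θ.f x t - 1) * s.heat x t ≤ 2 * Q * s.S t * s.grad x t := by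
    have := mul_le_mul (by linarith : s.θ.f x t - 1 ≤ s.S t) hQ hH (by linarith)
    linarith
  have e4 : 0 ≤ 2 * Q * s.S t * (s.θ.f x t - 1) ^ 2 := by positivity
  have e5 : s.θ.x x t * (s.θ.f x t ^ β * s.θ.x x t / s.v x t)
    = s.θ.f x t ^ β * s.θ.x x t ^ 2 / s.v x t := by ring
  rw [s.θ_t_eq, e5]
  linarith

/-- The `L²` estimate for the temperature. -/
theorem exists_temp_energy (hα : 0 ≤ α) (hβ : 0 < β) (hc : 0 < c) (hV : 1 ≤ V) :
    ∃ A m, 0 ≤ A ∧ 0 < m ∧ ∀ s : Sol α β T, s.Low c E → (∀ x, ∀ t ∈ Icc 0 T, s.v x t ≤ V) →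
      ∃ L, 0 ≤ L ∧ ∀ a, 0 < a → ∀ t ∈ Ioo 0 T, ∃ d,
        HasDerivAt (fun t => cint a fun x => (s.θ.f x t - 1) ^ 2) d t ∧
        d + m * cint a (fun x => s.θ.x x t ^ 2)
          ≤ A * s.S t * (cint a (fun x => s.grad x t) + cint a fun x => (s.θ.f x t - 1) ^ 2)
            + L / a := by
  obtain ⟨Q, hQ1, hQ⟩ := exists_heat_le (E := E) (β := β) (T := T) hα hc hV
  refine ⟨1 / c + 2 * Q, c ^ β / V, by positivity, by positivity, fun s h hv => ?_⟩
  obtain ⟨L, hL⟩ := s.exists_box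
  have l1 := hL.one_le
  obtain ⟨M, hM1, hM⟩ := exists_rpow_bound l1 β
  have L0 : 0 < L := by linarith
  have N0 : 0 < 4 * (L + 1) ^ 2 * M * L := by positivity
  refine ⟨8 * (4 * (L + 1) ^ 2 * M * L), by positivity, fun a ha t ht => ?_⟩
  have ht' := Ioo_subset_Icc_self ht
  refine ⟨_, hasDerivAt_cint (E := fun x t => (s.θ.f x t - 1) ^ 2)
    (Et := fun x t => 2 * (s.θ.f x t - 1) * s.θ.t x t) (by fun_prop) (by fun_prop)
    (fun x t ht => (((s.θ.ht x t ht).sub_const 1).pow 2).congr_deriv (by simp)) ht, ?_⟩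
  have cg : Continuous fun x => s.θ.f x t ^ β * s.θ.x x t ^ 2 / s.v x t := by
    fun_prop (disch := simp)
  have cF : Continuous fun x => 2 * (s.θ.x x t * (s.θ.f x t ^ β * s.θ.x x t / s.v x t)
      + (s.θ.f x t - 1) * s.cond x t) := by fun_prop (disch := simp)
  have k1 := cint_mono ha (f := fun x => 2 * (s.θ.f x t - 1) * s.θ.t x t) (by fun_prop)
    (g := fun x => 2 * (s.θ.x x t * (s.θ.f x t ^ β * s.θ.x x t / s.v x t)
          + (s.θ.f x t - 1) * s.cond x t)
        - 2 * (s.θ.f x t ^ β * s.θ.x x t ^ 2 / s.v x t)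
        + (1 / c + 2 * Q) * s.S t * (s.grad x t + (s.θ.f x t - 1) ^ 2)) (by fun_prop)
    fun x => h.temp_mul_le hα ht' (by linarith) (hQ s h hv x t ht')
  rw [cint_add (by fun_prop) (by fun_prop), cint_sub cF (by fun_prop),
    cint_const_mul (f := fun x => s.θ.f x t ^ β * s.θ.x x t ^ 2 / s.v x t) 2,
    cint_const_mul ((1 / c + 2 * Q) * s.S t),
    cint_add (f := fun x => s.grad x t) (by fun_prop) (by fun_prop)] at k1
  have k2 := cint_deriv_le (F := fun x => 2 * ((s.θ.f x t - 1) *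
      (s.θ.f x t ^ β * s.θ.x x t / s.v x t)))
    (G := fun x => s.θ.f x t ^ β * s.θ.x x t ^ 2 / s.v x t) ha N0
    (fun x => (((s.θ.hx x t).sub_const 1).mul (s.hasDerivAt_heat_flux x t)).const_mul 2) cF cg
    (fun x => by
      have hv0 := s.v_pos x t
      have hθ0 := s.θ_pos x t
      have hp := Real.rpow_pos_of_pos hθ0 β
      have m1 := (hM _ (hL.θ_ge x t ht') (hL.θ_le x t ht')).1
      have m2 : (s.v x t)⁻¹ ≤ L := by
        rw [inv_le_comm₀ hv0 L0]; simpa using hL.v_ge x t ht'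
      have m3 : (s.θ.f x t - 1) ^ 2 ≤ (L + 1) ^ 2 :=
        sq_le_sq' (by linarith [hL.θ_le x t ht']) (by linarith [hL.θ_le x t ht'])
      calc _ = 4 * (s.θ.f x t - 1) ^ 2 * s.θ.f x t ^ β * (s.v x t)⁻¹
            * (s.θ.f x t ^ β * s.θ.x x t ^ 2 / s.v x t) := by field_simp; ring
        _ ≤ 4 * (L + 1) ^ 2 * M * L * (s.θ.f x t ^ β * s.θ.x x t ^ 2 / s.v x t) := by
            gcongr)
  have k3 : c ^ β / V * cint a (fun x => s.θ.x x t ^ 2)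
      ≤ cint a fun x => s.θ.f x t ^ β * s.θ.x x t ^ 2 / s.v x t := by
    rw [← cint_const_mul]
    refine cint_mono ha (by fun_prop) cg fun x => ?_
    have hv0 := s.v_pos x t
    have hθ0 := s.θ_pos x t
    have hp := Real.rpow_pos_of_pos hθ0 β
    have := Real.rpow_le_rpow hc.le (h.θ_ge x t ht') hβ.le
    have h2 := hv x t ht'
    calc _ = c ^ β * s.θ.x x t ^ 2 / V := by ring
      _ ≤ _ := by gcongr
  linarith

end Sol

namespace Sol
variable {α β T : ℝ} {s : Sol α β T} {c E V D p N : ℝ}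

/-- The squared maximal temperature is controlled by the temperature gradient. -/
theorem Base.S_sq_le (h : s.Base E) : ∀ᶠ a in atTop, ∀ t ∈ Icc 0 T,
    s.S t ^ 2 ≤ 2 * cint a (fun x => s.θ.x x t ^ 2) + ((2 * E + 2) ^ 2 + (2 * E + 2)) * s.S t := by
  obtain ⟨M, hM⟩ := h.S_rpow_le (q := 2) (by norm_num)
  have hE := h.one_le
  filter_upwards [eventually_ge_atTop (2 * M + 2), eventually_gt_atTop 0] with a ha ha0 t ht
  obtain ⟨z, hz, hS⟩ := hM t ht
  have hz' := abs_le.1 hz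
  have S2 := s.two_le_S t
  norm_num at hS
  have h1 : ∫ y in z..(z + 1), 2 * |s.θ.f y t| * |s.θ.x y t|
      ≤ ∫ y in z..(z + 1), (s.θ.x y t ^ 2 + s.S t * s.θ.f y t) := by
    refine integral_le_of_le (by linarith) (by fun_prop) (by fun_prop) fun y _ => ?_
    have h0 := s.θ_pos y t
    have h2 := s.θ_le_S y t
    rw [abs_of_pos h0]
    have h3 : s.θ.f y t * s.θ.f y t ≤ s.S t * s.θ.f y t := by gcongr
    nlinarith [sq_nonneg (s.θ.f y t - |s.θ.x y t|), sq_abs (s.θ.x y t)]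
  rw [intervalIntegral.integral_add (Continuous.intervalIntegrable (by fun_prop) _ _)
    (Continuous.intervalIntegrable (by fun_prop) _ _), intervalIntegral.integral_const_mul] at h1
  have h2 : ∫ y in z..(z + 1), s.θ.x y t ^ 2 ≤ 2 * cint a fun x => s.θ.x x t ^ 2 :=
    integral_le_two_mul_cut ha0 (by linarith) (by linarith) (by linarith) (by fun_prop)
      fun x => sq_nonneg _
  have h3 : s.S t * ∫ y in z..(z + 1), s.θ.f y t ≤ s.S t * (2 * E + 2) :=
    mul_le_mul_of_nonneg_left (h.cell_θ_le z ht) (by linarith)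
  have h4 : (2 * E + 2) ^ 2 * 1 ≤ (2 * E + 2) ^ 2 * s.S t := by gcongr; linarith
  linarith

/-- Gradient energy inequality for a single field. -/
theorem Para.grad_energy {F : Fld T} {A a t A₂ : ℝ} (hF : s.Para F A t) (hA : 1 ≤ A) (ha : 0 < a)
    (ht : t ∈ Ioo 0 T) (hN : 1 ≤ N) (hA₂ : 0 ≤ A₂)
    (hvN : ∫ x in -a..a, s.vx x t ^ 2 ≤ N) (hvN' : cint a (fun x => s.vx x t ^ 2) ≤ N)
    (hS : s.S t ^ 2 ≤ 2 * cint a (fun x => s.θ.x x t ^ 2) + A₂ * s.S t)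
    (hFG : ∀ x, F.x x t ^ 2 ≤ s.grad x t) :
    ∃ d, HasDerivAt (fun t => cint a fun x => F.x x t ^ 2) d t ∧
      d + 1 / (2 * A) * cint a (fun x => F.xx x t ^ 2)
        ≤ (2 * A ^ 2 + 8 * A + 2) * N * (2 * A * (2 * A ^ 2 + 8 * A + 2) * N + A₂ + 5)
          * (cint a (fun x => s.θ.x x t ^ 2) + s.S t + (1 + s.B t) * cint a (fun x => s.grad x t)
            + dint a fun x => F.x x t ^ 2) := by
  obtain ⟨d, hd, hd'⟩ := F.grad_energy (A := A) (a := a) hA ha ht (r := fun x => s.forcing F x t)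
    (by fun_prop) hF
  refine ⟨d, hd, ?_⟩
  obtain ⟨A₁, hA₁⟩ : ∃ A₁, A₁ = 2 * A ^ 2 + 8 * A + 2 := ⟨_, rfl⟩
  rw [← hA₁] at hd' ⊢
  have A0 : 0 < A := by linarith
  have A10 : 0 < A₁ := by rw [hA₁]; positivity
  have N0 : 0 < N := by linarith
  have hε : 0 < 1 / (2 * A * A₁ * N) := by positivity
  have k1 := cint_mul_sq_le (f := fun x => s.vx x t ^ 2) (g := fun x => F.x x t)
    (gx := fun x => F.xx x t) ha hε (by fun_prop) (fun x => sq_nonneg _) (fun x => F.hxx x t)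
    (by fun_prop) hvN
  have k2 : cint a (fun x => s.forcing F x t)
      = cint a (fun x => s.vx x t ^ 2 * F.x x t ^ 2) + (cint a (fun x => s.θ.x x t ^ 2)
        + s.S t ^ 2 * cint a (fun x => s.vx x t ^ 2) + s.B t * cint a (fun x => s.grad x t)) := by
    unfold forcing
    rw [cint_add (by fun_prop) (by fun_prop), cint_add (by fun_prop) (by fun_prop),
      cint_add (by fun_prop) (by fun_prop), cint_const_mul, cint_const_mul]
  have k3 : cint a (fun x => F.x x t ^ 2) ≤ cint a fun x => s.grad x t :=
    cint_mono ha (by fun_prop) (by fun_prop) hFG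
  have k4 := cint_nonneg ha fun x => sq_nonneg (F.xx x t)
  have k5 := cint_nonneg ha fun x => sq_nonneg (F.x x t)
  have k6 := dint_nonneg ha fun x => sq_nonneg (F.x x t)
  have k7 := cint_nonneg ha fun x => sq_nonneg (s.vx x t)
  have k8 := cint_nonneg ha fun x => sq_nonneg (s.θ.x x t)
  have hB := s.one_le_B t
  have hS2 := s.two_le_S t
  rw [k2] at hd'
  generalize cint a (fun x => s.vx x t ^ 2 * F.x x t ^ 2) = J at *
  generalize cint a (fun x => F.xx x t ^ 2) = Y at *
  generalize cint a (fun x => F.x x t ^ 2) = X' at *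
  generalize cint a (fun x => s.grad x t) = X at *
  generalize dint a (fun x => F.x x t ^ 2) = δ at *
  generalize cint a (fun x => s.vx x t ^ 2) = n at *
  generalize cint a (fun x => s.θ.x x t ^ 2) = Θ at *
  generalize s.B t = B at *
  generalize s.S t = S at *
  have m1 : A₁ * J ≤ 1 / (2 * A) * Y + A₁ * N * (2 * A * A₁ * N + 1) * X + A₁ * N * δ := by
    have e1 : A₁ * (N * (1 / (2 * A * A₁ * N) * Y + (1 / (1 / (2 * A * A₁ * N)) + 1) * X' + δ))
        = 1 / (2 * A) * Y + A₁ * N * (2 * A * A₁ * N + 1) * X' + A₁ * N * δ := by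
      field_simp
    have e2 := mul_le_mul_of_nonneg_left k1 A10.le
    have e3 : A₁ * N * (2 * A * A₁ * N + 1) * X' ≤ A₁ * N * (2 * A * A₁ * N + 1) * X := by gcongr
    linarith
  have m2 : S ^ 2 * n ≤ (2 * Θ + A₂ * S) * N := by
    have : 0 ≤ 2 * Θ + A₂ * S := le_trans (sq_nonneg _) hS
    gcongr
  have m2' := mul_le_mul_of_nonneg_left m2 A10.le
  have m3 : 1 / A * Y = 2 * (1 / (2 * A) * Y) := by field_simp
  have X0 : 0 ≤ X := k5.trans k3
  have m4 : A₁ * 1 * (Θ + B * X + δ) ≤ A₁ * N * (Θ + B * X + δ) := by gcongr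
  have P0 : 0 ≤ A₁ * N := by positivity
  have m5 : 0 ≤ 2 * A * A₁ * N := by positivity
  have m6 : A₁ * N * (2 * A * A₁ * N * X + X + 2 * δ + 3 * Θ + A₂ * S + B * X)
      ≤ A₁ * N * ((2 * A * A₁ * N + A₂ + 5) * (Θ + S + (1 + B) * X + δ)) := by
    refine mul_le_mul_of_nonneg_left ?_ P0
    generalize 2 * A * A₁ * N = Z at *
    have a1 : 0 ≤ Z * (Θ + S + B * X + δ) := by positivity
    have a2 : 0 ≤ A₂ * (Θ + (1 + B) * X + δ) := by positivity
    have a3 : 0 ≤ B * X := by positivity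
    linarith
  linarith

end Sol

theorem cint_sum {ι : Type*} (I : Finset ι) {a : ℝ} {f : ι → ℝ → ℝ} (cf : ∀ i, Continuous (f i)) :
    cint a (fun x => ∑ i ∈ I, f i x) = ∑ i ∈ I, cint a (f i) := by
  unfold cint
  simp only [Finset.mul_sum]
  exact intervalIntegral.integral_finsetSum fun i _ =>
    Continuous.intervalIntegrable (by have := cf i; fun_prop) _ _

theorem dint_sum {ι : Type*} (I : Finset ι) {a : ℝ} {f : ι → ℝ → ℝ} (cf : ∀ i, Continuous (f i)) :
    dint a (fun x => ∑ i ∈ I, f i x) = ∑ i ∈ I, dint a (f i) := by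
  unfold dint
  simp only [Finset.mul_sum]
  exact intervalIntegral.integral_finsetSum fun i _ =>
    Continuous.intervalIntegrable (by have := cf i; fun_prop) _ _

namespace Sol
variable {α β T : ℝ} {s : Sol α β T} {c E V D p N K δ : ℝ}

/-- Gradient energy inequality for all fields together. -/
theorem exists_grad_energy {A a t A₂ : ℝ} (hF : ∀ i, s.Para (s.flds i) A t) (hA : 1 ≤ A)
    (ha : 0 < a) (ht : t ∈ Ioo 0 T) (hN : 1 ≤ N) (hA₂ : 0 ≤ A₂)
    (hvN : ∫ x in -a..a, s.vx x t ^ 2 ≤ N) (hvN' : cint a (fun x => s.vx x t ^ 2) ≤ N)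
    (hS : s.S t ^ 2 ≤ 2 * cint a (fun x => s.θ.x x t ^ 2) + A₂ * s.S t) :
    ∃ d, HasDerivAt (fun t => cint a fun x => s.grad x t) d t ∧
      d + 1 / (2 * A) * cint a (fun x => s.hess x t)
        ≤ (2 * A ^ 2 + 8 * A + 2) * N * (2 * A * (2 * A ^ 2 + 8 * A + 2) * N + A₂ + 5)
          * (5 * (cint a (fun x => s.θ.x x t ^ 2) + s.S t
            + (1 + s.B t) * cint a (fun x => s.grad x t)) + dint a fun x => s.grad x t) := by
  have hle : ∀ i x, (s.flds i).x x t ^ 2 ≤ s.grad x t := fun i x => by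
    rw [s.grad_eq_sum]
    exact Finset.single_le_sum (f := fun i => (s.flds i).x x t ^ 2) (fun i _ => sq_nonneg _)
      (Finset.mem_univ i)
  choose d hd hd' using fun i => (hF i).grad_energy hA ha ht hN hA₂ hvN hvN' hS (hle i)
  have e1 : ∀ t, cint a (fun x => s.grad x t) = ∑ i, cint a fun x => (s.flds i).x x t ^ 2 :=
    fun t => by
      rw [← cint_sum _ fun i => by fun_prop]
      simp only [s.grad_eq_sum]
  have e2 : cint a (fun x => s.hess x t) = ∑ i, cint a fun x => (s.flds i).xx x t ^ 2 := by
    rw [← cint_sum _ fun i => by fun_prop]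
    simp only [s.hess_eq_sum]
  have e3 : dint a (fun x => s.grad x t) = ∑ i, dint a fun x => (s.flds i).x x t ^ 2 := by
    rw [← dint_sum _ fun i => by fun_prop]
    simp only [s.grad_eq_sum]
  refine ⟨∑ i, d i, ?_, ?_⟩
  · simp only [e1]
    exact HasDerivAt.fun_sum fun i _ => hd i
  · have := Finset.sum_le_sum fun i (_ : i ∈ Finset.univ) => hd' i
    rw [Finset.sum_add_distrib, ← Finset.mul_sum, ← Finset.mul_sum, Finset.sum_add_distrib, ← e2,
      ← e3, Finset.sum_const, Finset.card_univ, Fintype.card_fin, nsmul_eq_mul] at this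
    exact_mod_cast this

/-- Boundary errors integrated in time vanish as the cut-off is removed. -/
theorem Mid.int_dint_le (m : s.Mid p D) (hT : 0 < T) {f : ℝ → ℝ → ℝ}
    (cf : Continuous fun q : ℝ × ℝ => f q.1 q.2) {L : ℝ} (hL : 0 ≤ L) (h0 : ∀ x t, 0 ≤ f x t)
    (h : ∀ x, ∀ t ∈ Icc 0 T, f x t ≤ L * s.diss p x t) :
    ∀ᶠ a in atTop, ∫ t in (0:ℝ)..T, dint a (fun x => f x t) ≤ 1 := by
  have hD := m.one_le
  have h2 : Tendsto (fun a : ℝ => 2 * a) atTop atTop := tendsto_id.const_mul_atTop (by norm_num)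
  filter_upwards [h2.eventually m.diss_le, eventually_ge_atTop (8 * (L * D)),
    eventually_ge_atTop 1] with a hd haL ha1
  have ha0 : 0 < a := by linarith
  have cs : ∀ t, Continuous fun x => f x t := fun t => cont_slice cf t
  have hLD : 0 ≤ L * D := by positivity
  calc ∫ t in (0:ℝ)..T, dint a (fun x => f x t)
      ≤ ∫ t in (0:ℝ)..T, 8 / a ^ 2 * (L * cint (2 * a) fun x => s.diss p x t) := by
        refine integral_le_of_le hT.le (continuous_dint cf)
          ((continuous_cint (by fun_prop)).const_mul _ |>.const_mul _) fun t ht => ?_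
        refine (dint_le ha0 (cs t) fun x => h0 x t).trans ?_
        rw [← cint_const_mul (a := 2 * a) (f := fun x => s.diss p x t) L]
        have := cint_mono (by linarith : 0 < 2 * a) (cs t)
          (by fun_prop : Continuous fun x => L * s.diss p x t) fun x => h x t ht
        gcongr
    _ = 8 / a ^ 2 * (L * ∫ t in (0:ℝ)..T, cint (2 * a) fun x => s.diss p x t) := by
        rw [intervalIntegral.integral_const_mul, intervalIntegral.integral_const_mul]
    _ ≤ 8 / a ^ 2 * (L * D) := by gcongr
    _ ≤ 1 := by
        rw [div_mul_eq_mul_div, div_le_one (by positivity)]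
        nlinarith

end Sol

namespace Sol
variable {α β T : ℝ} {s : Sol α β T} {c E V D p N K δ : ℝ}

/-- Uniform bounds for the gradients and second derivatives of the velocity and magnetic fields. -/
structure High (s : Sol α β T) (C : ℝ) : Prop where
  one_le : 1 ≤ C
  grad_le : ∀ᶠ a in atTop, ∀ t ∈ Icc 0 T, cint a (fun x => s.grad x t) ≤ C
  hess_le : ∀ᶠ a in atTop, ∫ t in (0:ℝ)..T, cint a (fun x => s.hess x t) ≤ C

/-- The combined differential inequality for the gradients and the temperature. -/
theorem combined_ineq {X' Z' X Z Y Θ S B dl L A W A₄ m M : ℝ} (hW : 0 ≤ W)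
    (hA₄ : 0 ≤ A₄) (hm : 0 < m) (hM : M = 5 * W / m + 1) (hZ : 0 ≤ Z) (hS : 0 ≤ S)
    (hB : 0 ≤ B) (hΘ : 0 ≤ Θ)
    (h1 : X' + 1 / (2 * A) * Y ≤ W * (5 * (Θ + S + (1 + B) * X) + dl))
    (h2 : Z' + m * Θ ≤ A₄ * S * (X + Z) + L) :
    X' + M * Z' + 1 / (2 * A) * Y
      ≤ (5 * W * (1 + B) + M * A₄ * S) * (X + M * Z) + (5 * W * S + W * dl + M * L) := by
  have M1 : 1 ≤ M := by
    rw [hM]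
    have : 0 ≤ 5 * W / m := by positivity
    linarith
  have e1 := mul_le_mul_of_nonneg_left h2 (by linarith : 0 ≤ M)
  have e2 : M * m = 5 * W + m := by rw [hM]; field_simp
  have e3 : 5 * W * Θ ≤ M * m * Θ := by rw [e2]; nlinarith
  have e4 : M * A₄ * S * (X + 1 * Z) ≤ M * A₄ * S * (X + M * Z) := by gcongr
  have e5 : 0 ≤ 5 * W * (1 + B) * (M * Z) := by positivity
  linarith

theorem exists_high (hα : 0 ≤ α) (hβ : 0 < β) (hT : 0 < T) (hp0 : 0 < p) (hc : 0 < c)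
    (hE : 1 ≤ E) (hD : 0 ≤ D) (hV : 1 ≤ V) (N₀ K δ : ℝ) :
    ∃ C, 0 ≤ C ∧ ∀ s : Sol α β T, s.Init K δ → s.Low c E → s.Mid p D →
      (∀ x, ∀ t ∈ Icc 0 T, s.v x t ≤ V) →
      (∀ᶠ a in atTop, ∀ t ∈ Icc 0 T, cint a (fun x => s.vx x t ^ 2) ≤ N₀) → s.High C := by
  obtain ⟨A, hA1, hA⟩ := exists_para (E := E) (β := β) (T := T) hα hc hV
  obtain ⟨A₄, m, hA₄, hm, hZ⟩ := exists_temp_energy (E := E) (T := T) hα hβ hc hV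
  obtain ⟨N, hN⟩ : ∃ N, N = max 1 (2 * N₀) := ⟨_, rfl⟩
  have N1 : 1 ≤ N := hN ▸ le_max_left _ _
  have NN : 2 * N₀ ≤ N := hN ▸ le_max_right _ _
  obtain ⟨A₂, hA₂⟩ : ∃ A₂, A₂ = (2 * E + 2) ^ 2 + (2 * E + 2) := ⟨_, rfl⟩
  have A₂0 : 0 ≤ A₂ := by rw [hA₂]; positivity
  obtain ⟨W, hW⟩ : ∃ W, W = (2 * A ^ 2 + 8 * A + 2) * N
    * (2 * A * (2 * A ^ 2 + 8 * A + 2) * N + A₂ + 5) := ⟨_, rfl⟩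
  have A0 : 0 < A := by linarith
  have W0 : 0 ≤ W := by rw [hW]; positivity
  obtain ⟨M, hM⟩ : ∃ M, M = 5 * W / m + 1 := ⟨_, rfl⟩
  have M0 : 0 ≤ M := by rw [hM]; positivity
  obtain ⟨C₁, hC₁⟩ : ∃ C₁, C₁ = ((1 + M) * K ^ 2 + (5 * W * D + W + M))
    * Real.exp (5 * W * (T + D) + M * A₄ * D) := ⟨_, rfl⟩
  have C₁0 : 0 ≤ C₁ := by rw [hC₁]; positivity
  refine ⟨1 + C₁ + 2 * A * C₁, by positivity, fun s hi h md hv hvx => ?_⟩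
  obtain ⟨L, hL0, hL⟩ := hZ s h hv
  obtain ⟨L₂, hL₂1, hL₂⟩ := s.exists_grad_le_diss hα hp0
  have hdint := md.int_dint_le hT (f := fun x t => s.grad x t) (L := L₂) (by fun_prop)
    (by linarith) s.grad_nonneg fun x t ht => by
      have := hL₂ x t ht
      have := sq_nonneg (s.θ.x x t)
      unfold grad
      linarith
  have h2 : Tendsto (fun a : ℝ => 2 * a) atTop atTop := tendsto_id.const_mul_atTop (by norm_num)
  have hS0 : ∀ t, 0 ≤ s.S t := fun t => by linarith [s.two_le_S t]
  have hB0 : ∀ t, 0 ≤ s.B t := fun t => by linarith [s.one_le_B t]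
  have key : ∀ᶠ a in atTop, ∀ t ∈ Icc 0 T, cint a (fun x => s.grad x t)
      + 1 / (2 * A) * ∫ t in (0:ℝ)..t, cint a (fun x => s.hess x t) ≤ C₁ := by
    filter_upwards [hdint, hvx, h2.eventually hvx, h.toBase.S_sq_le, eventually_ge_atTop (L * T),
      eventually_gt_atTop 0] with a hdi hva hva2 hSa haL ha
    have G0 : ∀ t, 0 ≤ cint a fun x => s.grad x t := fun t => cint_nonneg ha fun x =>
      s.grad_nonneg x t
    have H0 : ∀ t, 0 ≤ cint a fun x => s.hess x t := fun t => cint_nonneg ha fun x =>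
      s.hess_nonneg x t
    have Z0 : ∀ t, 0 ≤ cint a fun x => (s.θ.f x t - 1) ^ 2 := fun t => cint_nonneg ha fun x =>
      sq_nonneg _
    have D0 : ∀ t, 0 ≤ dint a fun x => s.grad x t := fun t => dint_nonneg ha fun x =>
      s.grad_nonneg x t
    have cG : Continuous fun t => cint a fun x => s.grad x t := continuous_cint (by fun_prop)
    have cH : Continuous fun t => cint a fun x => s.hess x t := continuous_cint (by fun_prop)
    have cZ : Continuous fun t => cint a fun x => (s.θ.f x t - 1) ^ 2 :=
      continuous_cint (by fun_prop)
    have cD : Continuous fun t => dint a fun x => s.grad x t := continuous_dint (by fun_prop)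
    have hder : ∀ t ∈ Ioo 0 T, ∃ d, HasDerivAt (fun t => cint a (fun x => s.grad x t)
        + M * cint a fun x => (s.θ.f x t - 1) ^ 2) d t ∧
        d + 1 / (2 * A) * cint a (fun x => s.hess x t)
          ≤ (5 * W * (1 + s.B t) + M * A₄ * s.S t) * (cint a (fun x => s.grad x t)
              + M * cint a fun x => (s.θ.f x t - 1) ^ 2)
            + (5 * W * s.S t + W * dint a (fun x => s.grad x t) + M * (L / a)) := fun t ht => by
      have ht' := Ioo_subset_Icc_self ht
      have n1 : ∫ x in -a..a, s.vx x t ^ 2 ≤ N :=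
        (integral_le_cint_two ha (by fun_prop) fun x => sq_nonneg _).trans
          (by have := hva2 t ht'; linarith)
      have n2 : cint a (fun x => s.vx x t ^ 2) ≤ N :=
        (cint_le_integral ha (by fun_prop) fun x => sq_nonneg _).trans n1
      obtain ⟨d₁, k1, k2⟩ := exists_grad_energy (fun i => hA s h hv t ht' i) hA1 ha ht N1 A₂0
        n1 n2 (hA₂ ▸ hSa t ht')
      obtain ⟨d₂, k3, k4⟩ := hL a ha t ht
      rw [← hW] at k2
      exact ⟨_, k1.add (k3.const_mul M), combined_ineq W0 hA₄ hm hM (Z0 t) (hS0 t) (hB0 t)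
        (cint_nonneg ha fun x => sq_nonneg _) k2 k4⟩
    choose! y' hy1 hy2 using hder
    intro t ht
    have cS := s.continuous_S
    have cB := s.continuous_B
    have cA : Continuous fun t => 5 * W * (1 + s.B t) + M * A₄ * s.S t := by fun_prop
    have cC : Continuous fun t =>
        5 * W * s.S t + W * dint a (fun x => s.grad x t) + M * (L / a) := by fun_prop
    have g := gronwall_dissipation (T := T) (y' := y') (by fun_prop) cA cC (cH.const_mul _)
      (fun t _ => by have := hS0 t; have := hB0 t; positivity)
      (fun t _ => by have := hS0 t; have := D0 t; positivity)
      (fun t _ => by have := H0 t; positivity) hy1 hy2 t ht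
    rw [intervalIntegral.integral_const_mul] at g
    have i1 : ∫ t in (0:ℝ)..t, (5 * W * (1 + s.B t) + M * A₄ * s.S t)
        ≤ 5 * W * (T + D) + M * A₄ * D := by
      calc _ ≤ ∫ t in (0:ℝ)..T, (5 * W * (1 + s.B t) + M * A₄ * s.S t) :=
            integral_le_of_subset cA le_rfl ht.1 ht.2 fun t _ => by
              have := hS0 t; have := hB0 t; positivity
        _ = 5 * W * (T + ∫ t in (0:ℝ)..T, s.B t) + M * A₄ * ∫ t in (0:ℝ)..T, s.S t := by
            rw [integral_add_mul (f := fun t => 1 + s.B t) (by fun_prop) cS,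
              intervalIntegral.integral_add (by simp) (cB.intervalIntegrable _ _)]
            simp
        _ ≤ _ := by have := md.S_le; have := md.B_le; gcongr
    have i2 : ∫ t in (0:ℝ)..t, (5 * W * s.S t + W * dint a (fun x => s.grad x t) + M * (L / a))
        ≤ 5 * W * D + W + M := by
      calc _ ≤ ∫ t in (0:ℝ)..T,
            (5 * W * s.S t + W * dint a (fun x => s.grad x t) + M * (L / a)) :=
            integral_le_of_subset cC le_rfl ht.1 ht.2 fun t _ => by
              have := hS0 t; have := D0 t; positivity
        _ = 5 * W * (∫ t in (0:ℝ)..T, s.S t)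
            + W * (∫ t in (0:ℝ)..T, dint a fun x => s.grad x t) + M * (L * T / a) := by
            rw [intervalIntegral.integral_add (Continuous.intervalIntegrable (by fun_prop) _ _)
              (by simp), integral_add_mul cS cD, intervalIntegral.integral_const, smul_eq_mul,
              sub_zero]
            ring
        _ ≤ 5 * W * D + W * 1 + M * 1 := by
            have := md.S_le
            have : L * T / a ≤ 1 := by rw [div_le_one ha]; exact haL
            gcongr
        _ = _ := by ring
    have i3 : cint a (fun x => s.grad x 0) + M * cint a (fun x => (s.θ.f x 0 - 1) ^ 2)
        ≤ (1 + M) * K ^ 2 := by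
      have j1 := hi.cint_le ha (f := fun x => s.grad x 0) (by fun_prop) zero_le_one fun x => by
        unfold grad initDensity
        have := sq_nonneg (s.v x 0 - 1)
        have := sq_nonneg (s.vx x 0)
        have := sq_nonneg (s.θ.x x 0)
        have := sq_nonneg (s.θ.f x 0 - 1)
        have := sq_nonneg (s.u.f x 0)
        have := sq_nonneg (s.w₁.f x 0)
        have := sq_nonneg (s.w₂.f x 0)
        have := sq_nonneg (s.b₁.f x 0)
        have := sq_nonneg (s.b₂.f x 0)
        linarith
      have j2 := hi.cint_le ha (f := fun x => (s.θ.f x 0 - 1) ^ 2) (by fun_prop) zero_le_one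
        fun x => by
          unfold initDensity
          rw [one_mul]
          have : 0 ≤ (s.v x 0 - 1) ^ 2 + s.u.f x 0 ^ 2
            + (s.b₁.f x 0 ^ 2 + s.b₂.f x 0 ^ 2) + (s.w₁.f x 0 ^ 2 + s.w₂.f x 0 ^ 2)
            + s.vx x 0 ^ 2 + s.u.x x 0 ^ 2 + s.θ.x x 0 ^ 2
            + (s.b₁.x x 0 ^ 2 + s.b₂.x x 0 ^ 2) + (s.w₁.x x 0 ^ 2 + s.w₂.x x 0 ^ 2) := by
              positivity
          linarith
      have := mul_le_mul_of_nonneg_left j2 M0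
      linarith
    have i4 : ((cint a (fun x => s.grad x 0) + M * cint a (fun x => (s.θ.f x 0 - 1) ^ 2))
        + ∫ t in (0:ℝ)..t, (5 * W * s.S t + W * dint a (fun x => s.grad x t) + M * (L / a)))
        * Real.exp (∫ t in (0:ℝ)..t, (5 * W * (1 + s.B t) + M * A₄ * s.S t)) ≤ C₁ := by
      rw [hC₁]
      gcongr
    have i5 : 0 ≤ M * cint a fun x => (s.θ.f x t - 1) ^ 2 := mul_nonneg M0 (Z0 t)
    linarith [g.trans i4]
  refine ⟨by have : 0 ≤ 2 * A * C₁ := by positivity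
             linarith, ?_, ?_⟩
  · filter_upwards [key, eventually_gt_atTop 0] with a hk ha t ht
    have := hk t ht
    have h1 : 0 ≤ ∫ t in (0:ℝ)..t, cint a (fun x => s.hess x t) :=
      intervalIntegral.integral_nonneg ht.1 fun t _ => cint_nonneg ha fun x => s.hess_nonneg x t
    have h2 : 0 ≤ 1 / (2 * A) * ∫ t in (0:ℝ)..t, cint a (fun x => s.hess x t) := by positivity
    have h3 : 0 ≤ 2 * A * C₁ := by positivity
    linarith
  · filter_upwards [key, eventually_gt_atTop 0] with a hk ha
    have := hk T ⟨hT.le, le_rfl⟩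
    have h1 : 0 ≤ cint a fun x => s.grad x T := cint_nonneg ha fun x => s.grad_nonneg x T
    have h2 : 1 / (2 * A) * (∫ t in (0:ℝ)..T, cint a fun x => s.hess x t) ≤ C₁ := by linarith
    rw [one_div, inv_mul_le_iff₀ (by positivity)] at h2
    linarith

end Sol

namespace Sol
variable {α β T : ℝ} (s : Sol α β T)

/-- The heat flux in the absence of compression. -/
def tflux (x t : ℝ) : ℝ := s.θ.f x t ^ β * s.θ.x x t

/-- The derivative of `tflux`. -/
def tfluxx (x t : ℝ) : ℝ :=
  s.θ.f x t ^ β * s.θ.xx x t + β * s.θ.f x t ^ (β - 1) * s.θ.x x t ^ 2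

section
variable {X : Type*} [TopologicalSpace X]

@[fun_prop]
theorem continuous_tflux {g h : X → ℝ} (hg : Continuous g) (hh : Continuous h) :
    Continuous fun z => s.tflux (g z) (h z) := by unfold tflux; fun_prop (disch := simp)

@[fun_prop]
theorem continuous_tfluxx {g h : X → ℝ} (hg : Continuous g) (hh : Continuous h) :
    Continuous fun z => s.tfluxx (g z) (h z) := by unfold tfluxx; fun_prop (disch := simp)

end

theorem hasDerivAt_tflux (x t : ℝ) : HasDerivAt (fun y => s.tflux y t) (s.tfluxx x t) x := by
  have h1 := (s.θ.hx x t).rpow_const (p := β) (Or.inl (s.θ_ne x t))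
  refine (h1.mul (s.θ.hxx x t)).congr_deriv ?_
  simp only [tfluxx]
  ring

theorem cond_eq (x t : ℝ) :
    s.cond x t = s.tfluxx x t / s.v x t - s.tflux x t * s.vx x t / s.v x t ^ 2 := by
  unfold cond tfluxx tflux
  ring

/-- The weighted heat flux energy density rate. -/
def tfluxRate (a x t : ℝ) : ℝ :=
  -(cut a x ^ 2 * s.u.x x t / s.v x t ^ 2) * s.tflux x t ^ 2
    - 2 * (s.θ.f x t ^ β * s.θ.t x t)
      * ((2 * cut a x * dcut a x / s.v x t - cut a x ^ 2 * s.vx x t / s.v x t ^ 2) * s.tflux x t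
        + cut a x ^ 2 / s.v x t * s.tfluxx x t)

theorem hasDerivAt_cint_tflux (hβ : 0 < β) {a : ℝ} (ha : a ≠ 0) {t : ℝ} (ht : t ∈ Ioo 0 T) :
    HasDerivAt (fun t => cint a fun x => s.tflux x t ^ 2 / s.v x t)
      (∫ x in -a..a, s.tfluxRate a x t) t := by
  have hb : β + 1 ≠ 0 := by positivity
  have key := hasDerivAt_dirichlet_integral (T := T) (a := a)
    (ψ := fun x t => cut a x ^ 2 / s.v x t)
    (ψx := fun x t => 2 * cut a x * dcut a x / s.v x t - cut a x ^ 2 * s.vx x t / s.v x t ^ 2)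
    (ψt := fun x t => -(cut a x ^ 2 * s.u.x x t / s.v x t ^ 2))
    (g := fun x t => s.θ.f x t ^ (β + 1) / (β + 1)) (gx := s.tflux) (gxx := s.tfluxx)
    (gt := fun x t => s.θ.f x t ^ β * s.θ.t x t)
    (by fun_prop (disch := simp)) (by fun_prop (disch := simp)) (by fun_prop (disch := simp))
    (by fun_prop (disch := simp)) (by fun_prop) (by fun_prop) (by fun_prop (disch := simp))
    (fun x t => by
      refine ((hasDerivAt_cut_sq a x).div (s.hvx x t) (s.v_ne x t)).congr_deriv ?_
      have := s.v_ne x t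
      field_simp)
    (fun x t ht => by
      refine (((hasDerivAt_const t (cut a x ^ 2))).div (s.hvt x t ht)
        (s.v_ne x t)).congr_deriv ?_
      have := s.v_ne x t
      simp
      field_simp)
    (fun x t => by
      refine (((s.θ.hx x t).rpow_const (p := β + 1) (Or.inl (s.θ_ne x t))).div_const
        (β + 1)).congr_deriv ?_
      rw [add_sub_cancel_right, tflux]
      field_simp)
    s.hasDerivAt_tflux
    (fun x t ht => by
      refine (((s.θ.ht x t ht).rpow_const (p := β + 1) (Or.inl (s.θ_ne x t))).div_const
        (β + 1)).congr_deriv ?_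
      rw [add_sub_cancel_right]
      field_simp)
    (fun t => by simp [cut_left ha]) (fun t => by simp [cut_right ha]) ht
  refine (key.congr_of_eventuallyEq (Eventually.of_forall fun t => ?_)).congr_deriv rfl
  unfold cint
  congr 1
  funext x
  ring

variable {s} {c E V Q m : ℝ}

theorem tfluxRate_aux {k d z zt R h v u : ℝ} (hz : 0 ≤ z) (hu : 0 ≤ k ^ 2 * h ^ 2 / v ^ 2) :
    -(k ^ 2 * u / v ^ 2) * h ^ 2 - 2 * (z * zt) * (2 * k * d * h / v + k ^ 2 * (zt + R))
      ≤ -(k ^ 2 * (z * zt ^ 2))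
        + (k ^ 2 * ((1 + u ^ 2) * (h ^ 2 / v ^ 2) + 2 * (z * R ^ 2))
          + 8 * (d ^ 2 * (z * h ^ 2 / v ^ 2))) := by
  have e1 : 0 ≤ z * (k * zt + 4 * (d * h / v)) ^ 2 := by positivity
  have e2 : 0 ≤ z * (k * (zt + 2 * R)) ^ 2 := by positivity
  have e3 : 0 ≤ (k ^ 2 * h ^ 2 / v ^ 2) * (1 + u + u ^ 2) :=
    mul_nonneg hu (by nlinarith [sq_nonneg (u + 1)])
  ring_nf at *
  linarith

theorem tfluxRate_le (a x t : ℝ) :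
    s.tfluxRate a x t ≤ -(cut a x ^ 2 * (s.θ.f x t ^ β * s.θ.t x t ^ 2))
      + (cut a x ^ 2 * ((1 + s.u.x x t ^ 2) * (s.tflux x t ^ 2 / s.v x t ^ 2)
          + 2 * (s.θ.f x t ^ β * (s.θ.f x t / s.v x t * s.u.x x t - s.heat x t) ^ 2))
        + 8 * (dcut a x ^ 2 * (s.θ.f x t ^ β * s.tflux x t ^ 2 / s.v x t ^ 2))) := by
  have hv := s.v_pos x t
  refine le_trans (le_of_eq ?_) (tfluxRate_aux (Real.rpow_nonneg (s.θ_pos x t).le β)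
    (by positivity))
  have e : s.θ.t x t + (s.θ.f x t / s.v x t * s.u.x x t - s.heat x t)
      = s.tfluxx x t / s.v x t - s.tflux x t * s.vx x t / s.v x t ^ 2 := by
    rw [s.θ_t_eq, s.cond_eq]; ring
  rw [e, tfluxRate]
  ring

/-- The gradients are bounded by a localised `H²` norm. -/
theorem grad_le (s : Sol α β T) {a x : ℝ} (ha : 0 < a) (hx : x ∈ Icc (-a) a) (t : ℝ) :
    s.grad x t ≤ 2 * (cint (2 * a) (fun x => s.hess x t)
      + 2 * cint (2 * a) (fun x => s.grad x t) + dint (2 * a) fun x => s.grad x t) := by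
  have h2 : 0 < 2 * a := by positivity
  have hc : 1 / 2 ≤ cut (2 * a) x ^ 2 := half_le_cut_sq h2 (by
    constructor <;> linarith [hx.1, hx.2])
  have key : ∀ i, (s.flds i).x x t ^ 2 ≤ 2 * (cint (2 * a) (fun x => (s.flds i).xx x t ^ 2)
      + 2 * cint (2 * a) (fun x => (s.flds i).x x t ^ 2)
      + dint (2 * a) fun x => (s.flds i).x x t ^ 2) := fun i => by
    have h := cut_mul_sq_le h2 one_pos (g := fun x => (s.flds i).x x t)
      (fun x => (s.flds i).hxx x t) (by fun_prop) (x := x)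
      (by constructor <;> linarith [hx.1, hx.2])
    rw [mul_pow] at h
    have h' := mul_le_mul_of_nonneg_right hc (sq_nonneg ((s.flds i).x x t))
    unfold cint dint
    linarith
  simp_rw [hess_eq_sum, grad_eq_sum]
  rw [cint_sum Finset.univ (f := fun i x => (s.flds i).xx x t ^ 2) fun i => by fun_prop,
    cint_sum Finset.univ (f := fun i x => (s.flds i).x x t ^ 2) fun i => by fun_prop,
    dint_sum Finset.univ (f := fun i x => (s.flds i).x x t ^ 2) fun i => by fun_prop]
  calc _ ≤ _ := Finset.sum_le_sum fun i _ => key i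
    _ = _ := by rw [← Finset.mul_sum, Finset.sum_add_distrib, Finset.sum_add_distrib,
        ← Finset.mul_sum]

/-- Pointwise bound for the source in the heat flux estimate. -/
theorem Low.tflux_src_le (h : s.Low c E) (hβ : 0 < β) (hα : 0 ≤ α) {x t : ℝ} (ht : t ∈ Icc 0 T)
    (hQ : s.heat x t ≤ Q * s.grad x t) (hm : s.grad x t ≤ m) :
    (1 + s.u.x x t ^ 2) * (s.tflux x t ^ 2 / s.v x t ^ 2)
      + 2 * (s.θ.f x t ^ β * (s.θ.f x t / s.v x t * s.u.x x t - s.heat x t) ^ 2)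
      ≤ (1 + m) / c * (s.tflux x t ^ 2 / s.v x t)
        + 4 * s.S t ^ (β + 1) * (s.S t / c ^ 2 + Q ^ 2 * m) * s.grad x t := by
  have hc := h.c_pos
  have hv := s.v_pos x t
  have hvc := h.v_ge x t ht
  have hθ := s.θ_pos x t
  have hS := s.θ_le_S x t
  have hS2 := s.two_le_S t
  have hS0 : 0 < s.S t := by linarith
  have hH := s.heat_nonneg hα x t
  have hG := s.grad_nonneg x t
  have m0 := hG.trans hm
  have hu : s.u.x x t ^ 2 ≤ s.grad x t := by
    unfold grad
    linarith [sq_nonneg (s.w₁.x x t), sq_nonneg (s.w₂.x x t), sq_nonneg (s.b₁.x x t),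
      sq_nonneg (s.b₂.x x t)]
  have hθβ : 0 < s.θ.f x t ^ β := Real.rpow_pos_of_pos hθ β
  have hSβ : s.θ.f x t ^ β ≤ s.S t ^ (β + 1) :=
    (Real.rpow_le_rpow hθ.le hS hβ.le).trans
      (Real.rpow_le_rpow_of_exponent_le (by linarith) (by linarith))
  have hSβ1 : s.θ.f x t ^ β * s.θ.f x t ≤ s.S t ^ (β + 1) := by
    have := Real.rpow_le_rpow hθ.le hS (by linarith : 0 ≤ β + 1)
    rwa [Real.rpow_add_one hθ.ne'] at this
  have e1 : (1 + s.u.x x t ^ 2) * (s.tflux x t ^ 2 / s.v x t ^ 2)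
      ≤ (1 + m) / c * (s.tflux x t ^ 2 / s.v x t) := by
    calc _ = (1 + s.u.x x t ^ 2) / s.v x t * (s.tflux x t ^ 2 / s.v x t) := by ring
      _ ≤ _ := by
        have := hu.trans hm
        gcongr
  have e2 : s.θ.f x t ^ β * (s.θ.f x t / s.v x t * s.u.x x t) ^ 2
      ≤ s.S t ^ (β + 1) * (s.S t / c ^ 2) * s.grad x t := by
    calc _ = (s.θ.f x t ^ β * s.θ.f x t) * (s.θ.f x t / s.v x t ^ 2) * s.u.x x t ^ 2 := by ring
      _ ≤ _ := by gcongr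
  have e3 : s.θ.f x t ^ β * s.heat x t ^ 2 ≤ s.S t ^ (β + 1) * (Q ^ 2 * m) * s.grad x t := by
    calc _ ≤ s.S t ^ (β + 1) * (Q * s.grad x t) ^ 2 := by gcongr
      _ = s.S t ^ (β + 1) * (Q ^ 2 * s.grad x t) * s.grad x t := by ring
      _ ≤ _ := by gcongr
  have e4 : s.θ.f x t ^ β * (s.θ.f x t / s.v x t * s.u.x x t - s.heat x t) ^ 2
      ≤ 2 * (s.θ.f x t ^ β * (s.θ.f x t / s.v x t * s.u.x x t) ^ 2)
        + 2 * (s.θ.f x t ^ β * s.heat x t ^ 2) := by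
    generalize s.θ.f x t / s.v x t * s.u.x x t = y
    nlinarith [mul_nonneg hθβ.le (sq_nonneg (y + s.heat x t))]
  linarith

end Sol

namespace Sol
variable {α β T : ℝ} {s : Sol α β T} {c E V D p G K δ : ℝ}

theorem integral_cut_combination {a : ℝ} {X Y Z : ℝ → ℝ} (cX : Continuous X) (cY : Continuous Y)
    (cZ : Continuous Z) :
    ∫ x in -a..a, (-(cut a x ^ 2 * X x) + (cut a x ^ 2 * Y x + 8 * (dcut a x ^ 2 * Z x)))
      = -cint a X + (cint a Y + 8 * dint a Z) := by
  rw [intervalIntegral.integral_add (Continuous.intervalIntegrable (by fun_prop) _ _)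
    (Continuous.intervalIntegrable (by fun_prop) _ _),
    intervalIntegral.integral_add (Continuous.intervalIntegrable (by fun_prop) _ _)
    (Continuous.intervalIntegrable (by fun_prop) _ _), intervalIntegral.integral_neg,
    intervalIntegral.integral_const_mul]
  rfl

/-- The maximal temperature is controlled by the weighted heat flux energy. -/
theorem Low.S_rpow_le_tflux (h : s.Low c E) (hβ : 0 < β) (hv : ∀ x, ∀ t ∈ Icc 0 T, s.v x t ≤ V) :
    ∀ᶠ a in atTop, ∀ t ∈ Icc 0 T, s.S t ^ (β + 1) ≤ (2 * E + 2) ^ (β + 1) + (β + 1) ^ 2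
      + 2 * V * cint a fun x => s.tflux x t ^ 2 / s.v x t := by
  obtain ⟨M, hM⟩ := h.toBase.S_rpow_le (by linarith : 0 ≤ β + 1)
  filter_upwards [eventually_ge_atTop (2 * M + 2), eventually_gt_atTop 0] with a ha ha0 t ht
  obtain ⟨z, hz, hz'⟩ := hM t ht
  have hz1 := abs_le.1 hz
  have cf : Continuous fun y => s.tflux y t ^ 2 / s.v y t := by fun_prop (disch := simp)
  have V0 : 0 ≤ V := (s.v_pos 0 t).le.trans (hv 0 t ht)
  have h1 : ∫ y in z..(z + 1), |(β + 1) * s.θ.f y t ^ (β + 1 - 1) * s.θ.x y t|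
      ≤ ∫ y in z..(z + 1), ((β + 1) ^ 2 + V * (s.tflux y t ^ 2 / s.v y t)) := by
    rw [add_sub_cancel_right]
    refine integral_le_of_le (by linarith) (by fun_prop (disch := simp)) (by fun_prop) fun y _ => ?_
    have hv0 := s.v_pos y t
    have e1 : s.tflux y t ^ 2 ≤ V * (s.tflux y t ^ 2 / s.v y t) := by
      rw [mul_div_assoc', le_div_iff₀ hv0]
      nlinarith [hv y t ht, sq_nonneg (s.tflux y t)]
    rw [mul_assoc]
    change |(β + 1) * s.tflux y t| ≤ _
    rw [abs_le]
    constructor <;> nlinarith [sq_nonneg (β + 1 + s.tflux y t), sq_nonneg (β + 1 - s.tflux y t),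
      sq_nonneg (β + 1), sq_nonneg (s.tflux y t)]
  rw [intervalIntegral.integral_add (by simp) (Continuous.intervalIntegrable (by fun_prop) _ _),
    intervalIntegral.integral_const, intervalIntegral.integral_const_mul, add_sub_cancel_left,
    one_smul] at h1
  have h2 := integral_le_two_mul_cut ha0 (by linarith : z ≤ z + 1) (by linarith) (by linarith) cf
    fun y => div_nonneg (sq_nonneg _) (s.v_pos y t).le
  have h3 := mul_le_mul_of_nonneg_left h2 V0
  unfold cint
  linarith

theorem exists_tflux_le_diss (s : Sol α β T) (hα : 0 ≤ α) (hp0 : 0 < p) :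
    ∃ L, 0 ≤ L ∧ ∀ x, ∀ t ∈ Icc 0 T,
      s.θ.f x t ^ β * s.tflux x t ^ 2 / s.v x t ^ 2 ≤ L * s.diss p x t := by
  obtain ⟨L, hL⟩ := s.exists_box
  have l1 := hL.one_le
  have L0 : 0 < L := by linarith
  obtain ⟨M, hM1, hM⟩ := exists_rpow_bound l1 β
  obtain ⟨L₂, hL₂1, hL₂⟩ := s.exists_grad_le_diss hα hp0
  refine ⟨M ^ 3 * L ^ 2 * L₂, by positivity, fun x t ht => ?_⟩
  have hv0 := s.v_pos x t
  have hp := Real.rpow_pos_of_pos (s.θ_pos x t) β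
  have m1 := (hM _ (hL.θ_ge x t ht) (hL.θ_le x t ht)).1
  have m2 : (s.v x t)⁻¹ ≤ L := by
    rw [inv_le_comm₀ hv0 L0]; simpa using hL.v_ge x t ht
  have m3 : s.θ.x x t ^ 2 ≤ L₂ * s.diss p x t := by
    have := hL₂ x t ht
    have := sq_nonneg (s.u.x x t)
    have := sq_nonneg (s.w₁.x x t)
    have := sq_nonneg (s.w₂.x x t)
    have := sq_nonneg (s.b₁.x x t)
    have := sq_nonneg (s.b₂.x x t)
    linarith
  calc _ = (s.θ.f x t ^ β) ^ 3 * (s.v x t)⁻¹ ^ 2 * s.θ.x x t ^ 2 := by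
        unfold tflux; rw [div_eq_mul_inv, inv_pow]; ring
    _ ≤ M ^ 3 * L ^ 2 * (L₂ * s.diss p x t) := by gcongr
    _ = _ := by ring

theorem tflux_ineq {d X y c m Sb R g dZ P V G : ℝ} (hR : 0 ≤ R) (hg0 : 0 ≤ g)
    (hg : g ≤ G) (hSb0 : 0 ≤ Sb) (hSb : Sb ≤ P + 2 * V * y)
    (h : d ≤ -X + ((1 + m) / c * y + 4 * Sb * R * g + 8 * dZ)) :
    d + X ≤ ((1 + m) / c + 8 * V * G * R) * y + (4 * P * G * R + 8 * dZ) := by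
  have e0 := hSb0.trans hSb
  have e : Sb * R * g ≤ (P + 2 * V * y) * R * G := by gcongr
  linarith

/-- The differential inequality for the weighted heat flux energy. -/
theorem Low.tflux_deriv_le (h : s.Low c E) (hα : 0 ≤ α) (hβ : 0 < β) {Q P m a t : ℝ}
    (ht : t ∈ Icc 0 T) (ha : 0 < a) (hQ : ∀ x, s.heat x t ≤ Q * s.grad x t)
    (hgm : ∀ x ∈ Icc (-a) a, s.grad x t ≤ m) (hg : cint a (fun x => s.grad x t) ≤ G)
    (hSb : s.S t ^ (β + 1) ≤ P + 2 * V * cint a fun x => s.tflux x t ^ 2 / s.v x t) :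
    (∫ x in -a..a, s.tfluxRate a x t) + cint a (fun x => s.θ.f x t ^ β * s.θ.t x t ^ 2)
      ≤ ((1 + m) / c + 8 * V * G * (s.S t / c ^ 2 + Q ^ 2 * m))
          * cint a (fun x => s.tflux x t ^ 2 / s.v x t)
        + (4 * P * G * (s.S t / c ^ 2 + Q ^ 2 * m)
          + 8 * dint a fun x => s.θ.f x t ^ β * s.tflux x t ^ 2 / s.v x t ^ 2) := by
  have hS0 : 0 ≤ s.S t := by linarith [s.two_le_S t]
  have m0 : 0 ≤ m := (s.grad_nonneg 0 t).trans (hgm 0 ⟨by linarith, ha.le⟩)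
  have hc := h.c_pos
  have cY : Continuous fun x => (1 + s.u.x x t ^ 2) * (s.tflux x t ^ 2 / s.v x t ^ 2)
      + 2 * (s.θ.f x t ^ β * (s.θ.f x t / s.v x t * s.u.x x t - s.heat x t) ^ 2) := by
    fun_prop (disch := simp)
  have k1 : ∫ x in -a..a, s.tfluxRate a x t ≤ _ := integral_le_of_le (by linarith)
    (by unfold tfluxRate; fun_prop (disch := simp)) (by fun_prop (disch := simp))
    fun x _ => s.tfluxRate_le a x t
  rw [integral_cut_combination (X := fun x => s.θ.f x t ^ β * s.θ.t x t ^ 2)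
    (Z := fun x => s.θ.f x t ^ β * s.tflux x t ^ 2 / s.v x t ^ 2)
    (by fun_prop (disch := simp)) cY (by fun_prop (disch := simp))] at k1
  have k2 := cint_mono_on ha cY
    (g := fun x => (1 + m) / c * (s.tflux x t ^ 2 / s.v x t)
      + 4 * s.S t ^ (β + 1) * (s.S t / c ^ 2 + Q ^ 2 * m) * s.grad x t)
    (by fun_prop (disch := simp)) fun x hx => h.tflux_src_le hβ hα ht (hQ x) (hgm x hx)
  rw [cint_add (f := fun x => (1 + m) / c * (s.tflux x t ^ 2 / s.v x t))
      (g := fun x => 4 * s.S t ^ (β + 1) * (s.S t / c ^ 2 + Q ^ 2 * m) * s.grad x t)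
      (by fun_prop (disch := simp)) (by fun_prop),
    cint_const_mul (f := fun x => s.tflux x t ^ 2 / s.v x t) ((1 + m) / c),
    cint_const_mul (f := fun x => s.grad x t)
      (4 * s.S t ^ (β + 1) * (s.S t / c ^ 2 + Q ^ 2 * m))] at k2
  exact tflux_ineq (by positivity) (cint_nonneg ha fun x => s.grad_nonneg x t) hg
    (Real.rpow_nonneg hS0 _) hSb (k1.trans (by linarith))

theorem cint_tflux_init_le (hβ : 0 < β) (hT : 0 < T) (hi : s.Init K δ) (h : s.Low c E) {a : ℝ}
    (ha : 0 < a) : cint a (fun x => s.tflux x 0 ^ 2 / s.v x 0)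
      ≤ ((2 + 2 * K ^ 2) ^ β) ^ 2 / c * K ^ 2 := by
  have hc := h.c_pos
  refine hi.cint_le ha (by fun_prop (disch := simp)) (by positivity) fun x => ?_
  have hθ := s.θ_pos x 0
  have hv0 := s.v_pos x 0
  have e1 := Real.rpow_le_rpow hθ.le (hi.θ_le x) hβ.le
  have e2 := Real.rpow_pos_of_pos hθ β
  have e3 := h.v_ge x 0 ⟨le_rfl, hT.le⟩
  have e4 : s.θ.x x 0 ^ 2 ≤ s.initDensity x := by
    unfold initDensity
    have : 0 ≤ (s.v x 0 - 1) ^ 2 + s.u.f x 0 ^ 2 + (s.θ.f x 0 - 1) ^ 2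
      + (s.b₁.f x 0 ^ 2 + s.b₂.f x 0 ^ 2) + (s.w₁.f x 0 ^ 2 + s.w₂.f x 0 ^ 2)
      + s.vx x 0 ^ 2 + s.u.x x 0 ^ 2
      + (s.b₁.x x 0 ^ 2 + s.b₂.x x 0 ^ 2) + (s.w₁.x x 0 ^ 2 + s.w₂.x x 0 ^ 2) := by
        positivity
    linarith
  calc _ = (s.θ.f x 0 ^ β) ^ 2 / s.v x 0 * s.θ.x x 0 ^ 2 := by unfold tflux; ring
    _ ≤ _ := by gcongr

theorem exists_tflux (hα : 0 ≤ α) (hβ : 0 < β) (hT : 0 < T) (hp0 : 0 < p) (hc : 0 < c)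
    (hE : 1 ≤ E) (hV : 1 ≤ V) (hG : 0 ≤ G) (D K δ : ℝ) :
    ∃ C, ∀ s : Sol α β T, s.Init K δ → s.Low c E → s.Mid p D →
      (∀ x, ∀ t ∈ Icc 0 T, s.v x t ≤ V) → s.High G →
      ∀ᶠ a in atTop, ∀ t ∈ Icc 0 T, cint a (fun x => s.tflux x t ^ 2)
        + ∫ τ in (0:ℝ)..t, cint a (fun x => s.θ.f x τ ^ β * s.θ.t x τ ^ 2) ≤ C := by
  obtain ⟨Q, hQ1, hQ⟩ := exists_heat_le (E := E) (β := β) (T := T) hα hc hV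
  obtain ⟨P, hP⟩ : ∃ P, P = (2 * E + 2) ^ (β + 1) + (β + 1) ^ 2 := ⟨_, rfl⟩
  have P0 : 0 ≤ P := by rw [hP]; positivity
  obtain ⟨I, hI⟩ : ∃ I, I = 2 * (G + 2 * (G * T) + 1) := ⟨_, rfl⟩
  obtain ⟨J, hJ⟩ : ∃ J, J = D / c ^ 2 + Q ^ 2 * I := ⟨_, rfl⟩
  obtain ⟨Y, hY⟩ : ∃ Y, Y = ((2 + 2 * K ^ 2) ^ β) ^ 2 / c * K ^ 2 := ⟨_, rfl⟩
  refine ⟨V * ((Y + (4 * P * G * J + 8)) * Real.exp ((T + I) / c + 8 * V * G * J)),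
    fun s hi h md hv hh => ?_⟩
  have V0 : 0 < V := by linarith
  obtain ⟨L, hL0, hL⟩ := s.exists_tflux_le_diss hα hp0
  obtain ⟨L₂, hL₂1, hL₂⟩ := s.exists_grad_le_diss hα hp0
  have hd1 := md.int_dint_le hT (f := fun x t => s.grad x t) (L := L₂) (by fun_prop)
    (by linarith) s.grad_nonneg fun x t ht => by
      have := hL₂ x t ht
      have := sq_nonneg (s.θ.x x t)
      unfold grad
      linarith
  have Z0 : ∀ x t, 0 ≤ s.θ.f x t ^ β * s.tflux x t ^ 2 / s.v x t ^ 2 := fun x t => by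
    have := s.v_pos x t
    have := Real.rpow_nonneg (s.θ_pos x t).le β
    positivity
  have hd2 := md.int_dint_le hT (f := fun x t => s.θ.f x t ^ β * s.tflux x t ^ 2 / s.v x t ^ 2)
    (by fun_prop (disch := simp)) hL0 Z0 hL
  have h2 : Tendsto (fun a : ℝ => 2 * a) atTop atTop := tendsto_id.const_mul_atTop (by norm_num)
  filter_upwards [h2.eventually hd1, hd2, hh.grad_le, h2.eventually hh.grad_le,
    h2.eventually hh.hess_le, h.S_rpow_le_tflux hβ hv, eventually_gt_atTop 0]
    with a hda hdz hga hga2 hha hSa ha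
  have ha2 : 0 < 2 * a := by positivity
  obtain ⟨m, hm⟩ : ∃ m : ℝ → ℝ, m = fun t => 2 * (cint (2 * a) (fun x => s.hess x t)
      + 2 * cint (2 * a) (fun x => s.grad x t) + dint (2 * a) fun x => s.grad x t) := ⟨_, rfl⟩
  have cm : Continuous m := by
    rw [hm]
    have c1 : Continuous fun t => cint (2 * a) fun x => s.hess x t := continuous_cint (by fun_prop)
    have c2 : Continuous fun t => cint (2 * a) fun x => s.grad x t := continuous_cint (by fun_prop)
    have c3 : Continuous fun t => dint (2 * a) fun x => s.grad x t := continuous_dint (by fun_prop)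
    fun_prop
  have hgm : ∀ t, ∀ x ∈ Icc (-a) a, s.grad x t ≤ m t := fun t x hx => by
    rw [hm]; exact grad_le s ha hx t
  have m0 : ∀ t, 0 ≤ m t := fun t => (s.grad_nonneg 0 t).trans (hgm t 0 ⟨by linarith, ha.le⟩)
  have hmI : ∫ t in (0:ℝ)..T, m t ≤ I := by
    have c1 : Continuous fun t => cint (2 * a) fun x => s.hess x t := continuous_cint (by fun_prop)
    have c2 : Continuous fun t => cint (2 * a) fun x => s.grad x t := continuous_cint (by fun_prop)
    have c3 : Continuous fun t => dint (2 * a) fun x => s.grad x t := continuous_dint (by fun_prop)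
    have k := integral_le_of_le hT.le c2 continuous_const hga2
    rw [intervalIntegral.integral_const, sub_zero, smul_eq_mul] at k
    rw [hm, intervalIntegral.integral_const_mul, intervalIntegral.integral_add
      (Continuous.intervalIntegrable (by fun_prop) _ _) (c3.intervalIntegrable _ _),
      intervalIntegral.integral_add (c1.intervalIntegrable _ _)
      (Continuous.intervalIntegrable (by fun_prop) _ _), intervalIntegral.integral_const_mul, hI]
    linarith
  have cS := s.continuous_S
  have hS0 : ∀ t, 0 ≤ s.S t := fun t => by linarith [s.two_le_S t]
  obtain ⟨R, hR⟩ : ∃ R : ℝ → ℝ, R = fun t => s.S t / c ^ 2 + Q ^ 2 * m t := ⟨_, rfl⟩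
  have cR : Continuous R := by rw [hR]; fun_prop
  have R0 : ∀ t, 0 ≤ R t := fun t => by
    have := hS0 t; have := m0 t; rw [hR]; positivity
  have hRJ : ∫ t in (0:ℝ)..T, R t ≤ J := by
    rw [hR, intervalIntegral.integral_add (Continuous.intervalIntegrable (by fun_prop) _ _)
      (Continuous.intervalIntegrable (by fun_prop) _ _), intervalIntegral.integral_div,
      intervalIntegral.integral_const_mul, hJ]
    have := md.S_le
    gcongr
  have cX : Continuous fun q : ℝ × ℝ => s.θ.f q.1 q.2 ^ β * s.θ.t q.1 q.2 ^ 2 := by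
    fun_prop (disch := simp)
  have cZ : Continuous fun q : ℝ × ℝ =>
    s.θ.f q.1 q.2 ^ β * s.tflux q.1 q.2 ^ 2 / s.v q.1 q.2 ^ 2 := by fun_prop (disch := simp)
  have cy : Continuous fun q : ℝ × ℝ => s.tflux q.1 q.2 ^ 2 / s.v q.1 q.2 := by
    fun_prop (disch := simp)
  have y0 : ∀ x t, 0 ≤ s.tflux x t ^ 2 / s.v x t := fun x t =>
    div_nonneg (sq_nonneg _) (s.v_pos x t).le
  have X0 : ∀ x t, 0 ≤ s.θ.f x t ^ β * s.θ.t x t ^ 2 := fun x t =>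
    mul_nonneg (Real.rpow_nonneg (s.θ_pos x t).le β) (sq_nonneg _)
  have hdZ0 : ∀ t, 0 ≤ dint a fun x => s.θ.f x t ^ β * s.tflux x t ^ 2 / s.v x t ^ 2 :=
    fun t => dint_nonneg ha fun x => Z0 x t
  have hder : ∀ t ∈ Ioo 0 T,
      (∫ x in -a..a, s.tfluxRate a x t) + cint a (fun x => s.θ.f x t ^ β * s.θ.t x t ^ 2)
        ≤ ((1 + m t) / c + 8 * V * G * R t) * cint a (fun x => s.tflux x t ^ 2 / s.v x t)
          + (4 * P * G * R t
            + 8 * dint a fun x => s.θ.f x t ^ β * s.tflux x t ^ 2 / s.v x t ^ 2) := fun t ht => by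
    have ht' := Ioo_subset_Icc_self ht
    have := h.tflux_deriv_le hα hβ ht' ha (fun x => hQ s h hv x t ht') (hgm t) (hga t ht')
      (hP ▸ hSa t ht')
    rw [hR]
    exact this
  intro t ht
  have ccX : Continuous fun t => cint a fun x => s.θ.f x t ^ β * s.θ.t x t ^ 2 :=
    continuous_cint cX
  have ccy : Continuous fun t => cint a fun x => s.tflux x t ^ 2 / s.v x t := continuous_cint cy
  have ccZ : Continuous fun t => dint a fun x => s.θ.f x t ^ β * s.tflux x t ^ 2 / s.v x t ^ 2 :=
    continuous_dint cZ
  have cA : Continuous fun t => (1 + m t) / c + 8 * V * G * R t := by fun_prop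
  have cC : Continuous fun t => 4 * P * G * R t
      + 8 * dint a fun x => s.θ.f x t ^ β * s.tflux x t ^ 2 / s.v x t ^ 2 := by fun_prop
  have g := gronwall_dissipation (T := T) (y' := fun t => ∫ x in -a..a, s.tfluxRate a x t)
    ccy.continuousOn cA cC ccX
    (fun t _ => by have := m0 t; have := R0 t; positivity)
    (fun t _ => by have := hdZ0 t; have := R0 t; positivity)
    (fun t _ => cint_nonneg ha fun x => X0 x t)
    (fun t ht => s.hasDerivAt_cint_tflux hβ ha.ne' ht) hder t ht
  have i1 : ∫ t in (0:ℝ)..t, ((1 + m t) / c + 8 * V * G * R t) ≤ (T + I) / c + 8 * V * G * J := by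
    calc _ ≤ ∫ t in (0:ℝ)..T, ((1 + m t) / c + 8 * V * G * R t) :=
          integral_le_of_subset cA le_rfl ht.1 ht.2 fun t _ => by
            have := m0 t; have := R0 t; positivity
      _ = (T + ∫ t in (0:ℝ)..T, m t) / c + 8 * V * G * ∫ t in (0:ℝ)..T, R t := by
          rw [intervalIntegral.integral_add (Continuous.intervalIntegrable (by fun_prop) _ _)
            (Continuous.intervalIntegrable (by fun_prop) _ _), intervalIntegral.integral_div,
            intervalIntegral.integral_const_mul, intervalIntegral.integral_add (by simp)
            (cm.intervalIntegrable _ _)]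
          simp
      _ ≤ _ := by gcongr
  have i2 : ∫ t in (0:ℝ)..t, (4 * P * G * R t
        + 8 * dint a fun x => s.θ.f x t ^ β * s.tflux x t ^ 2 / s.v x t ^ 2)
      ≤ 4 * P * G * J + 8 := by
    calc _ ≤ ∫ t in (0:ℝ)..T, (4 * P * G * R t
            + 8 * dint a fun x => s.θ.f x t ^ β * s.tflux x t ^ 2 / s.v x t ^ 2) :=
          integral_le_of_subset cC le_rfl ht.1 ht.2 fun t _ => by
            have := hdZ0 t; have := R0 t; positivity
      _ = 4 * P * G * (∫ t in (0:ℝ)..T, R t)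
          + 8 * ∫ t in (0:ℝ)..T, dint a fun x =>
            s.θ.f x t ^ β * s.tflux x t ^ 2 / s.v x t ^ 2 := integral_add_mul cR ccZ _ _ _ _
      _ ≤ 4 * P * G * J + 8 * 1 := by gcongr
      _ = _ := by ring
  have i3 : cint a (fun x => s.tflux x 0 ^ 2 / s.v x 0) ≤ Y := by
    rw [hY]; exact cint_tflux_init_le hβ hT hi h ha
  have i4 := g.trans (mul_le_mul (add_le_add i3 i2) (Real.exp_le_exp.2 i1) (Real.exp_pos _).le
    (by
      have y1 := (cint_nonneg ha fun x => y0 x 0).trans i3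
      have := (intervalIntegral.integral_nonneg hT.le fun t _ => R0 t).trans hRJ
      positivity))
  have i5 : cint a (fun x => s.tflux x t ^ 2)
      ≤ V * cint a fun x => s.tflux x t ^ 2 / s.v x t := by
    rw [← cint_const_mul]
    refine cint_mono ha (by fun_prop) (by fun_prop (disch := simp)) fun x => ?_
    rw [mul_div_assoc', le_div_iff₀ (s.v_pos x t)]
    nlinarith [hv x t ht, sq_nonneg (s.tflux x t)]
  have i6 : 0 ≤ ∫ τ in (0:ℝ)..t, cint a fun x => s.θ.f x τ ^ β * s.θ.t x τ ^ 2 :=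
    intervalIntegral.integral_nonneg ht.1 fun τ _ => cint_nonneg ha fun x => X0 x τ
  have i7 := mul_le_mul_of_nonneg_left i4 V0.le
  nlinarith

end Sol

/-! ### Passage to the whole line -/

theorem integral_le_of_eventually_le {f : ℝ → ℝ} {C : ℝ} (hC : 0 ≤ C)
    (h : ∀ᶠ a in atTop, ∫ x in -a..a, f x ≤ C) : ∫ x, f x ≤ C := by
  by_cases hf : Integrable f
  · exact le_of_tendsto (intervalIntegral_tendsto_integral hf tendsto_neg_atTop_atBot tendsto_id) h
  · rwa [integral_undef hf]

theorem integral_integral_le_of_eventually_le {F : ℝ → ℝ → ℝ} {C T : ℝ} (hT : 0 ≤ T)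
    (cF : Continuous fun p : ℝ × ℝ => F p.1 p.2) (F0 : ∀ x t, 0 ≤ F x t)
    (hC : 0 ≤ C) (h : ∀ᶠ a in atTop, ∫ t in (0:ℝ)..T, ∫ x in -a..a, F x t ≤ C) :
    ∫ t in (0:ℝ)..T, ∫ x, F x t ≤ C := by
  have cI (n : ℕ) : Continuous fun t => ∫ x in (-(n:ℝ))..n, F x t := continuous_integral_param cF
  rw [intervalIntegral.integral_of_le hT]
  by_cases hi : IntegrableOn (fun t => ∫ x, F x t) (Ioc 0 T)
  swap
  · rwa [integral_undef hi]
  rw [← ENNReal.ofReal_le_ofReal_iff hC, ofReal_integral_eq_lintegral_ofReal hi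
    (Eventually.of_forall fun t => integral_nonneg fun x => F0 x t)]
  calc ∫⁻ t in Ioc 0 T, ENNReal.ofReal (∫ x, F x t)
      ≤ ∫⁻ t in Ioc 0 T,
          liminf (fun n : ℕ => ENNReal.ofReal (∫ x in (-(n:ℝ))..n, F x t)) atTop := by
        refine lintegral_mono fun t => ?_
        by_cases hf : Integrable fun x => F x t
        · refine (Tendsto.liminf_eq ?_).ge
          exact (ENNReal.continuous_ofReal.tendsto _).comp (intervalIntegral_tendsto_integral hf
            (tendsto_neg_atTop_atBot.comp tendsto_natCast_atTop_atTop) tendsto_natCast_atTop_atTop)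
        · simp [integral_undef hf]
    _ ≤ liminf (fun n : ℕ => ∫⁻ t in Ioc 0 T, ENNReal.ofReal (∫ x in (-(n:ℝ))..n, F x t)) atTop :=
        lintegral_liminf_le fun n => (cI n).measurable.ennreal_ofReal
    _ ≤ ENNReal.ofReal C := by
        refine liminf_le_of_frequently_le' (Eventually.frequently ?_)
        filter_upwards [tendsto_natCast_atTop_atTop.eventually h] with n hn
        rw [← ofReal_integral_eq_lintegral_ofReal
          ((cI n).integrableOn_Icc.mono_set Ioc_subset_Icc_self) (Eventually.of_forall fun t =>
            intervalIntegral.integral_nonneg (by simp) fun x _ => F0 x t),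
          ← intervalIntegral.integral_of_le hT]
        exact ENNReal.ofReal_le_ofReal hn

namespace Sol
variable {α β T : ℝ}

theorem exists_cint_le (hα : 0 ≤ α) (hβ : 0 < β) (hT : 0 < T) (K : ℝ) {δ : ℝ} (hδ : 0 < δ) :
    ∃ C, ∀ s : Sol α β T, s.Init K δ → ∀ᶠ a in atTop, ∀ t ∈ Icc 0 T,
      cint a (fun x => s.tflux x t ^ 2)
        + ∫ τ in (0:ℝ)..t, cint a (fun x => s.θ.f x τ ^ β * s.θ.t x τ ^ 2) ≤ C := by
  obtain ⟨p, hp0, hp1, hpβ⟩ : ∃ p : ℝ, 0 < p ∧ 3 * p ≤ 1 ∧ 2 * p < β := by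
    have h1 := min_le_left β 1
    have h2 := min_le_right β 1
    have h3 : 0 < min β 1 := lt_min hβ one_pos
    exact ⟨min β 1 / 4, by linarith, by linarith, by linarith⟩
  obtain ⟨c, E, hc, hE, h1⟩ := exists_low (β := β) (K := K) hα hT hδ
  obtain ⟨D, hD, h2⟩ := exists_mid hα hT hp0 hp1 hpβ hc hE
  obtain ⟨V, hV, h3⟩ := exists_v_le (β := β) (E := E) (p := p) (D := D) hα hT hc
  obtain ⟨N, -, h4⟩ := exists_vx_le (T := T) (D := D) hα hp0 (by linarith : p ≤ β) hc hE hV K δ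
  obtain ⟨G, hG, h5⟩ := exists_high hα hβ hT hp0 hc hE hD hV N K δ
  obtain ⟨C, h6⟩ := exists_tflux hα hβ hT hp0 hc hE hV hG D K δ
  refine ⟨C, fun s hi => ?_⟩
  have l := h1 s hi
  have m := h2 s l
  have v := h3 s l m
  exact h6 s hi l m v (h5 s hi l m v (h4 s hi l m v))

theorem exists_integral_le (hα : 0 ≤ α) (hβ : 0 < β) (hT : 0 < T) (K : ℝ) {δ : ℝ} (hδ : 0 < δ) :
    ∃ C, 0 < C ∧ ∀ s : Sol α β T, s.Init K δ → ∀ t ∈ Icc 0 T,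
      (∫ x, s.tflux x t ^ 2) + ∫ τ in (0:ℝ)..T, ∫ x, s.θ.f x τ ^ β * s.θ.t x τ ^ 2 ≤ C := by
  obtain ⟨C₀, hC₀⟩ := exists_cint_le hα hβ hT K hδ
  obtain ⟨C, hC, C0⟩ : ∃ C, C₀ ≤ C ∧ 0 < C := ⟨max C₀ 1, le_max_left _ _, by positivity⟩
  refine ⟨2 * C + 2 * C, by positivity, fun s hi t ht => ?_⟩
  have X0 : ∀ x t, 0 ≤ s.θ.f x t ^ β * s.θ.t x t ^ 2 := fun x t =>
    mul_nonneg (Real.rpow_nonneg (s.θ_pos x t).le β) (sq_nonneg _)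
  have cX : Continuous fun q : ℝ × ℝ => s.θ.f q.1 q.2 ^ β * s.θ.t q.1 q.2 ^ 2 :=
    Continuous.mul (Continuous.rpow_const (by fun_prop) fun q => Or.inl (s.θ_pos q.1 q.2).ne')
      (by fun_prop)
  have hev : ∀ᶠ a in atTop, 0 < a ∧ ∀ t ∈ Icc 0 T, cint (2 * a) (fun x => s.tflux x t ^ 2)
      + ∫ τ in (0:ℝ)..t, cint (2 * a) (fun x => s.θ.f x τ ^ β * s.θ.t x τ ^ 2) ≤ C := by
    filter_upwards [(tendsto_id.const_mul_atTop two_pos).eventually (hC₀ s hi),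
      eventually_gt_atTop 0] with a h ha
    exact ⟨ha, fun t ht => (h t ht).trans hC⟩
  have i1 : ∫ x, s.tflux x t ^ 2 ≤ 2 * C := by
    refine integral_le_of_eventually_le (by positivity) ?_
    filter_upwards [hev] with a ⟨ha, h⟩
    have h0 : 0 ≤ ∫ τ in (0:ℝ)..t, cint (2 * a) fun x => s.θ.f x τ ^ β * s.θ.t x τ ^ 2 :=
      intervalIntegral.integral_nonneg ht.1 fun τ _ => cint_nonneg (by linarith) fun x => X0 x τ
    have h1 := integral_le_cint_two (f := fun x => s.tflux x t ^ 2) ha (by fun_prop)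
      fun x => sq_nonneg _
    linarith [h t ht]
  have i2 : ∫ τ in (0:ℝ)..T, ∫ x, s.θ.f x τ ^ β * s.θ.t x τ ^ 2 ≤ 2 * C := by
    refine integral_integral_le_of_eventually_le hT.le cX X0 (by positivity) ?_
    filter_upwards [hev] with a ⟨ha, h⟩
    have h0 : 0 ≤ cint (2 * a) fun x => s.tflux x T ^ 2 :=
      cint_nonneg (by linarith) fun x => sq_nonneg _
    have h1 : ∫ τ in (0:ℝ)..T, ∫ x in -a..a, s.θ.f x τ ^ β * s.θ.t x τ ^ 2
        ≤ ∫ τ in (0:ℝ)..T, 2 * cint (2 * a) fun x => s.θ.f x τ ^ β * s.θ.t x τ ^ 2 :=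
      integral_le_of_le hT.le (continuous_integral_param cX)
        (continuous_const.mul (continuous_cint cX)) fun τ _ =>
          integral_le_cint_two ha (cont_slice (f := fun x t => s.θ.f x t ^ β * s.θ.t x t ^ 2) cX τ)
            fun x => X0 x τ
    rw [intervalIntegral.integral_const_mul] at h1
    linarith [h T ⟨hT.le, le_rfl⟩]
  linarith

end Sol

/-- (2.44) of the paper: bound for `θ^β θ_x` in `L^∞(0,T;L²)` and for the
space-time integral of `θ^β θ_t²`. -/
theorem theta_weighted_gradient_bound (α β T K δ : ℝ) (hα : 0 ≤ α) (hβ : 0 < β) (hT : 0 < T)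
    (hK : 0 < K) (hδ₀ : 0 < δ) (hδ₁ : δ ≤ 1) :
    ∃ C : ℝ, 0 < C ∧
      ∀ (v u θ : ℝ → ℝ → ℝ) (w b : ℝ → ℝ → ℝ × ℝ),
        IsClassicalSolution α β T v u θ w b → Admissible K δ v u θ w b →
        ∀ t ∈ Icc (0:ℝ) T,
          (∫ x : ℝ, (θ x t ^ β * pdx θ x t) ^ 2)
            + (∫ s in (0:ℝ)..T, ∫ x : ℝ, θ x s ^ β * (pdt T θ x s) ^ 2) ≤ C := by
  obtain ⟨C, hC, h⟩ := Sol.exists_integral_le hα hβ hT K hδ₀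
  refine ⟨C, hC, fun v u θ w b hs ha t ht => ?_⟩
  have e : ∫ τ in (0:ℝ)..T, ∫ x : ℝ, θ x τ ^ β * (pdt T θ x τ) ^ 2
      = ∫ τ in (0:ℝ)..T, ∫ x : ℝ, θ x (clamp T τ) ^ β * (pdt T θ x (clamp T τ)) ^ 2 := by
    refine intervalIntegral.integral_congr fun τ hτ => ?_
    rw [uIcc_of_le hT.le] at hτ
    simp only [clamp_eq hτ]
  have k := h (hs.toSol hT) (hs.toSol_init hT ha) t ht
  simp only [Sol.tflux, IsClassicalSolution.toSol, Fld.ofClamp, clamp_eq ht] at k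
  rwa [e]
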